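/- arXiv:2310.00345 — 4 statements merged into one kernel-verified Lean document; each statement's English description precedes it below -/
import Mathlib

section
/- If a nontrivial finite group G is the product of two abelian subgroups A and B, then A or B contains a nontrivial normal subgroup of G. -/
open Pointwise

/-- A finite commutative radical ring (written multiplicatively) has a nonzero annihilator. -/
theorem radical_ann {R : Type*} [Group R] [Finite R] [Nontrivial R]
    (f : R → R → R) (comm : ∀ k l, f k l = f l k)
    (mul : ∀ k k' l, f (k * k') l = f k l * f k' l)
    (rc : ∀ k l m, f (f k l) m = f (f k m) l)
    (inj : ∀ k l, f k l * k = 1 → k = 1) : ∃ x, x ≠ 1 ∧ ∀ l, f x l = 1 := by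
  have one : ∀ l, f 1 l = 1 := fun l => by
    have := mul 1 1 l
    simpa using this
  have inv : ∀ k l, f k l⁻¹ = (f k l)⁻¹ := fun k l => by
    have := mul l⁻¹ l k
    rw [inv_mul_cancel, one] at this
    rw [comm k l⁻¹, comm k l]
    exact eq_inv_of_mul_eq_one_left this.symm
  have notin : ∀ k, k ∈ Set.range (f k) → k = 1 := by
    rintro k ⟨l, hl⟩
    apply inj k l⁻¹
    rw [inv, hl, inv_mul_cancel]
  have assoc : ∀ k l m, f (f k l) m = f k (f l m) := fun k l m => by
    rw [comm k l, rc, comm]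
  by_contra! H
  have step : ∀ n : ℕ, ∀ x : R, x ≠ 1 → (Set.range (f x)).ncard ≤ n → False := by
    intro n
    induction n with
    | zero =>
      intro x hx h
      have h0 : (Set.range (f x)).ncard = 0 := by omega
      rw [Set.ncard_eq_zero (Set.toFinite _)] at h0
      exact (Set.range_nonempty (f x)).ne_empty h0
    | succ n ih =>
      intro x hx h
      obtain ⟨l, hl⟩ := H x hx
      apply ih (f x l) hl
      have hss : Set.range (f (f x l)) ⊂ Set.range (f x) := by
        refine ⟨?_, fun hsub => hl (notin _ (hsub ⟨l, rfl⟩))⟩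
        rintro _ ⟨m, rfl⟩
        exact ⟨f l m, (assoc x l m).symm⟩
      have := Set.ncard_lt_ncard hss (Set.toFinite _)
      omega
  obtain ⟨x, hx⟩ := exists_ne (1 : R)
  exact step _ x hx le_rfl

theorem core_aux {G : Type*} [Group G] (A B K : Subgroup G)
    (hG : ∀ g, ∃ a ∈ A, ∃ b ∈ B, g = a * b)
    (hA : ∀ x ∈ A, ∀ y ∈ A, x * y = y * x)
    (hB : ∀ x ∈ B, ∀ y ∈ B, x * y = y * x)
    (hn : K.Normal) (hK : ∀ a ∈ A, ∀ b ∈ B, a⁻¹ * b⁻¹ * a * b ∈ K)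
    (hZ : ∀ z : G, (∀ g, z * g = g * z) → z = 1)
    (c : G) (hcA : c ∈ A) (hc : ∀ k ∈ K, c * k = k * c) (hc1 : c ≠ 1) :
    ∃ N : Subgroup G, N.Normal ∧ N ≠ ⊥ ∧ N ≤ A := by
  let N : Subgroup G := Subgroup.centralizer (A : Set G) ⊓ Subgroup.centralizer (K : Set G)
  have memN : ∀ g, g ∈ N ↔ (∀ a ∈ A, a * g = g * a) ∧ (∀ k ∈ K, k * g = g * k) := by
    intro g
    simp only [N, Subgroup.mem_inf, Subgroup.mem_centralizer_iff, SetLike.mem_coe]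
  refine ⟨N, ⟨?_⟩, ?_, ?_⟩
  · intro n hn' g
    rw [memN] at hn'
    obtain ⟨h1, h2⟩ := hn'
    have key : ∀ y, (g⁻¹ * y * g) * n = n * (g⁻¹ * y * g) →
        y * (g * n * g⁻¹) = (g * n * g⁻¹) * y := by
      intro y hy
      calc y * (g * n * g⁻¹) = g * ((g⁻¹ * y * g) * n) * g⁻¹ := by group
        _ = g * (n * (g⁻¹ * y * g)) * g⁻¹ := by rw [hy]
        _ = _ := by group
    rw [memN]
    refine ⟨fun a ha => key a ?_, fun k hk => key k (h2 _ ?_)⟩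
    · obtain ⟨a', ha', b, hb, rfl⟩ := hG g
      have e : (a' * b)⁻¹ * a * (a' * b) = a * (a⁻¹ * b⁻¹ * a * b) := by
        calc (a' * b)⁻¹ * a * (a' * b) = b⁻¹ * a'⁻¹ * (a * a') * b := by group
          _ = b⁻¹ * a'⁻¹ * (a' * a) * b := by rw [hA a ha a' ha']
          _ = _ := by group
      rw [e, mul_assoc, h2 _ (hK a ha b hb), ← mul_assoc, h1 a ha, mul_assoc]
    · simpa using hn.conj_mem k hk g⁻¹
  · intro h
    have : c ∈ N := (memN c).2 ⟨fun a ha => hA a ha c hcA, fun k hk => (hc k hk).symm⟩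
    rw [h, Subgroup.mem_bot] at this
    exact hc1 this
  · intro g hg
    rw [memN] at hg
    obtain ⟨a, ha, b, hb, rfl⟩ := hG g
    have hb1 : b = 1 := by
      apply hZ
      intro g
      have hbA : ∀ x ∈ A, b * x = x * b := by
        intro x hx
        have := hg.1 x hx
        rw [← mul_assoc, hA x hx a ha, mul_assoc, mul_assoc] at this
        exact (mul_left_cancel this).symm
      obtain ⟨x, hx, y, hy, rfl⟩ := hG g
      rw [← mul_assoc, hbA x hx, mul_assoc, hB b hb y hy, mul_assoc]
    rw [hb1, mul_one]
    exact ha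

theorem ito_aux {G : Type*} [Group G] (A B : Subgroup G)
    (hG : ∀ g, ∃ a ∈ A, ∃ b ∈ B, g = a * b)
    (hG' : ∀ g, ∃ b ∈ B, ∃ a ∈ A, g = b * a)
    (hA : ∀ x ∈ A, ∀ y ∈ A, x * y = y * x)
    (hB : ∀ x ∈ B, ∀ y ∈ B, x * y = y * x) :
    ∃ K : Subgroup G, K.Normal ∧ (∀ a ∈ A, ∀ b ∈ B, a * b * a⁻¹ * b⁻¹ ∈ K) ∧
      ∀ x ∈ K, ∀ y ∈ K, x * y = y * x := by
  let S : Set G := {s | ∃ a ∈ A, ∃ b ∈ B, s = a * b * a⁻¹ * b⁻¹}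
  have cA : ∀ a1 ∈ A, ∀ b ∈ B, ∃ b2 ∈ B, ∀ x ∈ A,
      a1 * (x * b * x⁻¹ * b⁻¹) * a1⁻¹ = x * b2 * x⁻¹ * b2⁻¹ := by
    intro a1 ha1 b hb
    obtain ⟨b2, hb2, a2, ha2, e⟩ := hG' (a1 * b * a1⁻¹)
    refine ⟨b2, hb2, fun x hx => ?_⟩
    have h1 : a1 * x * a1⁻¹ = x := by rw [hA a1 ha1 x hx]; group
    have h2 : a2 * x⁻¹ * a2⁻¹ = x⁻¹ := by rw [hA a2 ha2 x⁻¹ (inv_mem hx)]; group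
    calc a1 * (x * b * x⁻¹ * b⁻¹) * a1⁻¹
        = (a1 * x * a1⁻¹) * (a1 * b * a1⁻¹) * (a1 * x * a1⁻¹)⁻¹ * (a1 * b * a1⁻¹)⁻¹ := by group
      _ = x * b2 * (a2 * x⁻¹ * a2⁻¹) * b2⁻¹ := by rw [h1, e]; group
      _ = _ := by rw [h2]
  have cB : ∀ b1 ∈ B, ∀ a ∈ A, ∃ a3 ∈ A, ∀ y ∈ B,
      b1 * (a * y * a⁻¹ * y⁻¹) * b1⁻¹ = a3 * y * a3⁻¹ * y⁻¹ := by
    intro b1 hb1 a ha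
    obtain ⟨a3, ha3, b3, hb3, e⟩ := hG (b1 * a * b1⁻¹)
    refine ⟨a3, ha3, fun y hy => ?_⟩
    have h1 : b1 * y * b1⁻¹ = y := by rw [hB b1 hb1 y hy]; group
    have h2 : b3 * y * b3⁻¹ = y := by rw [hB b3 hb3 y hy]; group
    calc b1 * (a * y * a⁻¹ * y⁻¹) * b1⁻¹
        = (b1 * a * b1⁻¹) * (b1 * y * b1⁻¹) * (b1 * a * b1⁻¹)⁻¹ * (b1 * y * b1⁻¹)⁻¹ := by group
      _ = a3 * (b3 * y * b3⁻¹) * a3⁻¹ * y⁻¹ := by rw [h1, e]; group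
      _ = _ := by rw [h2]
  have hS : ∀ s ∈ S, ∀ g, g * s * g⁻¹ ∈ S := by
    rintro _ ⟨a, ha, b, hb, rfl⟩ g
    obtain ⟨a1, ha1, b1, hb1, rfl⟩ := hG g
    obtain ⟨a3, ha3, e3⟩ := cB b1 hb1 a ha
    obtain ⟨b2, hb2, e2⟩ := cA a1 ha1 b hb
    refine ⟨a3, ha3, b2, hb2, ?_⟩
    rw [← e2 a3 ha3, ← e3 b hb]
    group
  have hcomm : ∀ s ∈ S, ∀ t ∈ S, s * t = t * s := by
    rintro s ⟨a, ha, b, hb, rfl⟩ t ⟨p, hp, q, hq, rfl⟩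
    obtain ⟨a3, ha3, e3⟩ := cB q⁻¹ (inv_mem hq) a ha
    obtain ⟨b2, hb2, e2⟩ := cA p⁻¹ (inv_mem hp) b hb
    have h1 := e2 a3 ha3
    rw [← e3 b hb] at h1
    have h2 := e3 b2 hb2
    rw [← e2 a ha, ← h1] at h2
    generalize a * b * a⁻¹ * b⁻¹ = s at *
    calc s * (p * q * p⁻¹ * q⁻¹)
        = p * q * (q⁻¹ * (p⁻¹ * s * p⁻¹⁻¹) * q⁻¹⁻¹) * p⁻¹ * q⁻¹ := by group
      _ = p * q * (p⁻¹ * (q⁻¹ * s * q⁻¹⁻¹) * p⁻¹⁻¹) * p⁻¹ * q⁻¹ := by rw [h2]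
      _ = (p * q * p⁻¹ * q⁻¹) * s := by group
  refine ⟨Subgroup.closure S, ?_, fun a ha b hb => Subgroup.subset_closure ⟨a, ha, b, hb, rfl⟩, ?_⟩
  · constructor
    intro n hn g
    induction hn using Subgroup.closure_induction with
    | mem x hx => exact Subgroup.subset_closure (hS x hx g)
    | one => simp
    | mul x y _ _ hx hy =>
      have : g * (x * y) * g⁻¹ = (g * x * g⁻¹) * (g * y * g⁻¹) := by group
      rw [this]; exact mul_mem hx hy
    | inv x _ hx =>
      have : g * x⁻¹ * g⁻¹ = (g * x * g⁻¹)⁻¹ := by group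
      rw [this]; exact inv_mem hx
  · intro x hx y hy
    have h1 : Subgroup.closure S ≤ Subgroup.centralizer S := by
      rw [Subgroup.closure_le]
      intro s hs
      rw [SetLike.mem_coe, Subgroup.mem_centralizer_iff]
      exact fun t ht => hcomm t ht s hs
    have h2 : Subgroup.closure S ≤ Subgroup.centralizer (Subgroup.closure S : Set G) := by
      rw [Subgroup.closure_le]
      intro s hs
      rw [SetLike.mem_coe, Subgroup.mem_centralizer_iff]
      intro t ht
      exact (Subgroup.mem_centralizer_iff.1 (h1 ht) s hs).symm
    exact (Subgroup.mem_centralizer_iff.1 (h2 hx) y hy).symm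

theorem stmt2 {G : Type*} [Group G] [Finite G] [Nontrivial G] (A B : Subgroup G)
    (hprod : (A : Set G) * (B : Set G) = Set.univ)
    (hA : ∀ x ∈ A, ∀ y ∈ A, x * y = y * x)
    (hB : ∀ x ∈ B, ∀ y ∈ B, x * y = y * x) :
    ∃ N : Subgroup G, N.Normal ∧ N ≠ ⊥ ∧ (N ≤ A ∨ N ≤ B) := by
  have hG : ∀ g, ∃ a ∈ A, ∃ b ∈ B, g = a * b := by
    intro g
    have : g ∈ (A : Set G) * (B : Set G) := by rw [hprod]; trivial
    obtain ⟨a, ha, b, hb, e⟩ := Set.mem_mul.1 this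
    exact ⟨a, ha, b, hb, e.symm⟩
  have hG' : ∀ g, ∃ b ∈ B, ∃ a ∈ A, g = b * a := by
    intro g
    obtain ⟨a, ha, b, hb, e⟩ := hG g⁻¹
    exact ⟨b⁻¹, inv_mem hb, a⁻¹, inv_mem ha, by rw [← mul_inv_rev, ← e, inv_inv]⟩
  by_cases hZ : ∀ z : G, (∀ g, z * g = g * z) → z = 1
  swap
  · push Not at hZ
    obtain ⟨z, hz, hz1⟩ := hZ
    obtain ⟨a, ha, b, hb, rfl⟩ := hG z
    have hbA : ∀ x ∈ A, b * x = x * b := by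
      intro x hx
      have := hz x
      rw [← mul_assoc, ← hA a ha x hx, mul_assoc, mul_assoc] at this
      exact mul_left_cancel this
    have hbc : ∀ g, b * g = g * b := by
      intro g
      obtain ⟨x, hx, y, hy, rfl⟩ := hG g
      rw [← mul_assoc, hbA x hx, mul_assoc, hB b hb y hy, mul_assoc]
    have hac : ∀ g, a * g = g * a := by
      intro g
      have := hz g
      rw [mul_assoc, hbc g, ← mul_assoc, ← mul_assoc] at this
      exact mul_right_cancel this
    have nrm : ∀ c : G, (∀ g, c * g = g * c) → (Subgroup.zpowers c).Normal := by
      intro c hc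
      constructor
      rintro _ ⟨n, rfl⟩ g
      have h : Commute c g := hc g
      have h' : g * c ^ n * g⁻¹ = c ^ n := by
        rw [← (h.zpow_left n).eq, mul_inv_cancel_right]
      show g * c ^ n * g⁻¹ ∈ _
      rw [h']
      exact ⟨n, rfl⟩
    by_cases ha1 : a = 1
    · refine ⟨Subgroup.zpowers b, nrm b hbc, ?_, Or.inr (by simpa using hb)⟩
      rw [Ne, Subgroup.zpowers_eq_bot]
      rintro rfl
      exact hz1 (by simp [ha1])
    · refine ⟨Subgroup.zpowers a, nrm a hac, ?_, Or.inl (by simpa using ha)⟩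
      rwa [Ne, Subgroup.zpowers_eq_bot]
  obtain ⟨K, hn, hK, hKc⟩ := ito_aux A B hG hG' hA hB
  have hnt : Nontrivial K := by
    rw [Subgroup.nontrivial_iff_ne_bot]
    rintro rfl
    obtain ⟨z, hz1⟩ := exists_ne (1 : G)
    have hab : ∀ a ∈ A, ∀ b ∈ B, a * b = b * a := by
      intro a ha b hb
      have := Subgroup.mem_bot.1 (hK a ha b hb)
      rw [mul_inv_eq_one, mul_inv_eq_iff_eq_mul] at this
      exact this
    have hac : ∀ a ∈ A, a = 1 := by
      intro a ha
      apply hZ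
      intro g
      obtain ⟨x, hx, y, hy, rfl⟩ := hG g
      rw [← mul_assoc, hA a ha x hx, mul_assoc, hab a ha y hy, mul_assoc]
    have hbc : ∀ b ∈ B, b = 1 := by
      intro b hb
      apply hZ
      intro g
      obtain ⟨x, hx, y, hy, rfl⟩ := hG g
      rw [hac x hx, one_mul, hB b hb y hy]
    obtain ⟨x, hx, y, hy, rfl⟩ := hG z
    exact hz1 (by rw [hac x hx, hbc y hy, one_mul])
  have hdec : ∀ k : K, ∃ a ∈ A, a * (k : G) ∈ B := by
    intro k
    obtain ⟨a, ha, b, hb, e⟩ := hG k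
    exact ⟨a⁻¹, inv_mem ha, by rw [e, inv_mul_cancel_left]; exact hb⟩
  choose α hα hβ using hdec
  let f : K → K → K := fun k l =>
    ⟨(α l)⁻¹ * k * α l * (k : G)⁻¹, mul_mem (by simpa using hn.conj_mem k k.2 (α l)⁻¹)
      (inv_mem k.2)⟩
  have hf : ∀ k l, ((f k l : K) : G) = (α l)⁻¹ * k * α l * (k : G)⁻¹ := fun k l => rfl
  have cj : ∀ (k : K) (g : G), g⁻¹ * k * g ∈ K := fun k g => by
    simpa using hn.conj_mem k k.2 g⁻¹
  have hcm : ∀ k l, f k l = f l k := by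
    intro k l
    apply Subtype.ext
    rw [hf, hf]
    have h := hB _ (hβ k) _ (hβ l)
    have e1 : α k * k * (α l * l) = (α k * α l) * (((α l)⁻¹ * k * α l) * l) := by group
    have e2 : α l * l * (α k * k) = (α l * α k) * (((α k)⁻¹ * l * α k) * k) := by group
    rw [e1, e2, hA _ (hα k) _ (hα l)] at h
    have h := mul_left_cancel h
    rw [mul_inv_eq_iff_eq_mul, mul_assoc _ (l : G)⁻¹ (k : G), hKc _ (inv_mem l.2) _ k.2,
      ← mul_assoc _ (k : G) (l : G)⁻¹, eq_mul_inv_iff_mul_eq]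
    exact h
  obtain ⟨x, hx1, hx⟩ : ∃ x, x ≠ 1 ∧ ∀ l, f x l = 1 := by
    apply radical_ann f hcm
    · intro k k' l
      apply Subtype.ext
      rw [Subgroup.coe_mul, hf, hf, hf, Subgroup.coe_mul]
      have hw := hKc _ (mul_mem (cj k' (α l)) (inv_mem k'.2)) _ (inv_mem k.2)
      calc (α l)⁻¹ * (k * k') * α l * (k * k' : G)⁻¹
          = ((α l)⁻¹ * k * α l) * (((α l)⁻¹ * k' * α l * (k' : G)⁻¹) * (k : G)⁻¹) := by group
        _ = _ := by rw [hw]; group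
    · intro k l m
      apply Subtype.ext
      rw [hf, hf, hf, hf]
      have hw := hA _ (hα l) _ (hα m)
      have hw1 : (α m)⁻¹ * ((α l)⁻¹ * k * α l) * α m = (α l)⁻¹ * ((α m)⁻¹ * k * α m) * α l := by
        calc _ = (α l * α m)⁻¹ * k * (α l * α m) := by group
          _ = (α m * α l)⁻¹ * k * (α m * α l) := by rw [hw]
          _ = _ := by group
      have hw2 := hKc _ (inv_mem (cj k (α m))) _ (mul_mem k.2 (inv_mem (cj k (α l))))
      have hw3 := hKc _ (inv_mem (cj k (α l))) _ (inv_mem (cj k (α m)))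
      calc _ = ((α m)⁻¹ * ((α l)⁻¹ * k * α l) * α m) * (((α m)⁻¹ * k * α m)⁻¹ *
              (k * ((α l)⁻¹ * k * α l)⁻¹)) := by group
        _ = ((α l)⁻¹ * ((α m)⁻¹ * k * α m) * α l) *
              (k * (((α l)⁻¹ * k * α l)⁻¹ * ((α m)⁻¹ * k * α m)⁻¹)) := by
            rw [hw1, hw2, mul_assoc (k : G)]
        _ = ((α l)⁻¹ * ((α m)⁻¹ * k * α m) * α l) *
              (k * ((α m)⁻¹ * k * α m)⁻¹ * ((α l)⁻¹ * k * α l)⁻¹) := by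
            rw [hw3, mul_assoc (k : G)]
        _ = ((α l)⁻¹ * ((α m)⁻¹ * k * α m) * α l) *
              (((α l)⁻¹ * k * α l)⁻¹ * (k * ((α m)⁻¹ * k * α m)⁻¹)) := by
            rw [hKc _ (inv_mem (cj k (α l))) _ (mul_mem k.2 (inv_mem (cj k (α m))))]
        _ = _ := by group
    · intro k l h
      have h := congrArg Subtype.val h
      rw [Subgroup.coe_mul, hf, inv_mul_cancel_right] at h
      apply Subtype.ext
      have h2 : (α l) * ((α l)⁻¹ * k * α l) * (α l)⁻¹ = (k : G) := by group
      rw [← h2, h]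
      simp
  have hx' : ∀ l ∈ K, α x * l = l * α x := by
    intro l hl
    have h := congrArg Subtype.val ((hcm ⟨l, hl⟩ x).trans (hx ⟨l, hl⟩))
    rw [hf, Subgroup.coe_one, mul_inv_eq_one, mul_assoc, inv_mul_eq_iff_eq_mul] at h
    exact h.symm
  by_cases hax : α x = 1
  · have hxB : (x : G) ∈ B := by simpa [hax] using hβ x
    have hK' : ∀ b ∈ B, ∀ a ∈ A, b⁻¹ * a⁻¹ * b * a ∈ K := by
      intro b hb a ha
      have := inv_mem (hK a⁻¹ (inv_mem ha) b⁻¹ (inv_mem hb))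
      simpa [mul_assoc] using this
    obtain ⟨N, h1, h2, h3⟩ := core_aux B A K hG' hB hA hn hK' hZ x hxB
      (fun k hk => hKc _ x.2 _ hk) (fun h => hx1 (Subtype.ext h))
    exact ⟨N, h1, h2, Or.inr h3⟩
  · have hK' : ∀ a ∈ A, ∀ b ∈ B, a⁻¹ * b⁻¹ * a * b ∈ K := by
      intro a ha b hb
      simpa using hK a⁻¹ (inv_mem ha) b⁻¹ (inv_mem hb)
    obtain ⟨N, h1, h2, h3⟩ := core_aux A B K hG hA hB hn hK' hZ (α x) (hα x) hx' hax
    exact ⟨N, h1, h2, Or.inl h3⟩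
end

section
/- Let X = G⟨c⟩ where G = ⟨a, b⟩ ≅ SD_{8n} (n ≥ 2) is semidihedral, ⟨c⟩ is cyclic with G ∩ ⟨c⟩ = 1, and suppose the core of ⟨c⟩ in X is trivial and ⟨a⟩⟨c⟩ is a subgroup of X. Then the core of ⟨a⟩ in X is nontrivial. -/
open Pointwise Subgroup

theorem ito_conj_left {G : Type*} [Group G] (x y u p q : G) (hxp : x * p = p * x)
    (hux : u * x = x * u) (h : u * y * u⁻¹ = q * p) :
    u * (x * y * x⁻¹ * y⁻¹) * u⁻¹ = x * q * x⁻¹ * q⁻¹ := by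
  have hx : u * x * u⁻¹ = x := by rw [hux]; group
  have hp : p * x⁻¹ * p⁻¹ = x⁻¹ := by
    have : p * x⁻¹ = x⁻¹ * p := by
      rw [eq_inv_mul_iff_mul_eq, ← mul_assoc, hxp]; group
    rw [this]; group
  calc u * (x * y * x⁻¹ * y⁻¹) * u⁻¹
      = (u * x * u⁻¹) * (u * y * u⁻¹) * (u * x * u⁻¹)⁻¹ * (u * y * u⁻¹)⁻¹ := by group
    _ = x * q * (p * x⁻¹ * p⁻¹) * q⁻¹ := by rw [hx, h]; group
    _ = _ := by rw [hp]

theorem ito_conj_right {G : Type*} [Group G] (x y v x' q' : G) (hyq : y * q' = q' * y)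
    (hvy : v * y = y * v) (h : v * x * v⁻¹ = x' * q') :
    v * (x * y * x⁻¹ * y⁻¹) * v⁻¹ = x' * y * x'⁻¹ * y⁻¹ := by
  have hy : v * y * v⁻¹ = y := by rw [hvy]; group
  have hq : q' * y * q'⁻¹ = y := by rw [← hyq]; group
  calc v * (x * y * x⁻¹ * y⁻¹) * v⁻¹
      = (v * x * v⁻¹) * (v * y * v⁻¹) * (v * x * v⁻¹)⁻¹ * (v * y * v⁻¹)⁻¹ := by group
    _ = x' * (q' * y * q'⁻¹) * x'⁻¹ * y⁻¹ := by rw [hy, h]; group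
    _ = _ := by rw [hq]

/-- Ito: a product of two abelian subgroups has abelian derived subgroup. -/
theorem ito_metabelian {G : Type*} [Group G] (A C : Subgroup G)
    (hA : ∀ x ∈ A, ∀ y ∈ A, x * y = y * x) (hC : ∀ x ∈ C, ∀ y ∈ C, x * y = y * x)
    (hAC : ∀ g : G, ∃ x ∈ A, ∃ y ∈ C, g = x * y) :
    ∃ D : Subgroup G, D.Normal ∧ (∀ x ∈ D, ∀ y ∈ D, x * y = y * x) ∧
      ∀ g h : G, g * h * g⁻¹ * h⁻¹ ∈ D := by
  have hCA : ∀ g : G, ∃ y ∈ C, ∃ x ∈ A, g = y * x := by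
    intro g
    obtain ⟨x, hx, y, hy, h⟩ := hAC g⁻¹
    refine ⟨y⁻¹, inv_mem hy, x⁻¹, inv_mem hx, ?_⟩
    rw [← inv_inv g, h]; group
  let S : Set G := {g | ∃ x ∈ A, ∃ y ∈ C, g = x * y * x⁻¹ * y⁻¹}
  have hSmem : ∀ x ∈ A, ∀ y ∈ C, x * y * x⁻¹ * y⁻¹ ∈ closure S :=
    fun x hx y hy => subset_closure ⟨x, hx, y, hy, rfl⟩
  -- conjugates
  have hconjA : ∀ u ∈ A, ∀ s ∈ closure S, u * s * u⁻¹ ∈ closure S := by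
    intro u hu s hs
    have : closure S ≤ (closure S).comap (MulAut.conj u).toMonoidHom := by
      rw [closure_le]
      rintro _ ⟨x, hx, y, hy, rfl⟩
      simp only [coe_comap, Set.mem_preimage, SetLike.mem_coe, MulEquiv.coe_toMonoidHom,
        MulAut.conj_apply]
      have e : u * (x * y * x⁻¹ * y⁻¹) * u⁻¹
        = ((u * x) * y * (u * x)⁻¹ * y⁻¹) * (u * y * u⁻¹ * y⁻¹)⁻¹ := by group
      rw [e]
      exact mul_mem (hSmem _ (mul_mem hu hx) _ hy) (inv_mem (hSmem _ hu _ hy))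
    exact this hs
  have hconjC : ∀ u ∈ C, ∀ s ∈ closure S, u * s * u⁻¹ ∈ closure S := by
    intro u hu s hs
    have : closure S ≤ (closure S).comap (MulAut.conj u).toMonoidHom := by
      rw [closure_le]
      rintro _ ⟨x, hx, y, hy, rfl⟩
      simp only [coe_comap, Set.mem_preimage, SetLike.mem_coe, MulEquiv.coe_toMonoidHom,
        MulAut.conj_apply]
      have e : u * (x * y * x⁻¹ * y⁻¹) * u⁻¹
        = (x * u * x⁻¹ * u⁻¹)⁻¹ * (x * (u * y) * x⁻¹ * (u * y)⁻¹) := by group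
      rw [e]
      exact mul_mem (inv_mem (hSmem _ hx _ hu)) (hSmem _ hx _ (mul_mem hu hy))
    exact this hs
  have hN : (closure S).Normal := by
    refine ⟨fun s hs g => ?_⟩
    obtain ⟨x, hx, y, hy, rfl⟩ := hAC g
    have e : x * y * s * (x * y)⁻¹ = x * (y * s * y⁻¹) * x⁻¹ := by group
    rw [e]
    exact hconjA x hx _ (hconjC y hy _ hs)
  refine ⟨closure S, hN, ?_, ?_⟩
  · have hScomm : ∀ s ∈ S, ∀ t ∈ S, s * t = t * s := by
      rintro s ⟨x, hx, y, hy, rfl⟩ _ ⟨u, hu, v, hv, rfl⟩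
      set s := x * y * x⁻¹ * y⁻¹ with hs
      obtain ⟨q, hq, p, hp, h1⟩ := hCA (u⁻¹ * y * u⁻¹⁻¹)
      obtain ⟨x', hx', q', hq', h2⟩ := hAC (v⁻¹ * x * v⁻¹⁻¹)
      have hu' := inv_mem hu
      have hv' := inv_mem hv
      have e1 : u⁻¹ * s * u⁻¹⁻¹ = x * q * x⁻¹ * q⁻¹ :=
        ito_conj_left x y _ p q (hA _ hx _ hp) (hA _ hu' _ hx) h1
      have e2 : v⁻¹ * (x * q * x⁻¹ * q⁻¹) * v⁻¹⁻¹ = x' * q * x'⁻¹ * q⁻¹ :=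
        ito_conj_right x q _ x' q' (hC _ hq _ hq') (hC _ hv' _ hq) h2
      have e3 : v⁻¹ * s * v⁻¹⁻¹ = x' * y * x'⁻¹ * y⁻¹ :=
        ito_conj_right x y _ x' q' (hC _ hy _ hq') (hC _ hv' _ hy) h2
      have e4 : u⁻¹ * (x' * y * x'⁻¹ * y⁻¹) * u⁻¹⁻¹ = x' * q * x'⁻¹ * q⁻¹ :=
        ito_conj_left x' y _ p q (hA _ hx' _ hp) (hA _ hu' _ hx') h1
      have e5 : v⁻¹ * (u⁻¹ * s * u⁻¹⁻¹) * v⁻¹⁻¹ = u⁻¹ * (v⁻¹ * s * v⁻¹⁻¹) * u⁻¹⁻¹ := by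
        rw [e1, e2, e3, e4]
      have e6 : s = (u * v * u⁻¹ * v⁻¹) * s * (u * v * u⁻¹ * v⁻¹)⁻¹ := by
        calc s = (u * v) * (v⁻¹ * (u⁻¹ * s * u⁻¹⁻¹) * v⁻¹⁻¹) * (u * v)⁻¹ := by group
          _ = _ := by rw [e5]; group
      exact (mul_inv_eq_iff_eq_mul.mp e6.symm).symm
    intro x hx y hy
    have h1 : closure S ≤ centralizer S := by
      rw [closure_le]
      intro s hs
      exact mem_centralizer_iff.mpr fun t ht => hScomm t ht s hs
    have h2 : closure S ≤ centralizer (closure S : Set G) := by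
      rw [closure_le]
      intro s hs
      refine mem_centralizer_iff.mpr fun t ht => ?_
      exact (mem_centralizer_iff.mp (h1 ht) s hs).symm
    exact (mem_centralizer_iff.mp (h2 hy) x hx)
  · have key : ∀ x ∈ A, ∀ y ∈ C, (x : G ⧸ closure S) * (y : G ⧸ closure S)
        = (y : G ⧸ closure S) * (x : G ⧸ closure S) := by
      intro x hx y hy
      have := (QuotientGroup.eq_one_iff (N := closure S) _).mpr (hSmem x hx y hy)
      simp only [QuotientGroup.mk_mul, QuotientGroup.mk_inv] at this
      rw [mul_inv_eq_one, mul_inv_eq_iff_eq_mul] at this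
      exact this
    intro g h
    rw [← QuotientGroup.eq_one_iff (N := closure S)]
    simp only [QuotientGroup.mk_mul, QuotientGroup.mk_inv]
    rw [mul_inv_eq_one, mul_inv_eq_iff_eq_mul]
    obtain ⟨x, hx, y, hy, rfl⟩ := hAC g
    obtain ⟨u, hu, v, hv, rfl⟩ := hAC h
    have k1 : Commute (x : G ⧸ closure S) (u : G ⧸ closure S) :=
      congrArg (QuotientGroup.mk (s := closure S)) (hA x hx u hu)
    have k2 : Commute (y : G ⧸ closure S) (v : G ⧸ closure S) :=
      congrArg (QuotientGroup.mk (s := closure S)) (hC y hy v hv)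
    have k3 : Commute (x : G ⧸ closure S) (v : G ⧸ closure S) := key x hx v hv
    have k4 : Commute (y : G ⧸ closure S) (u : G ⧸ closure S) := (key u hu y hy).symm
    exact (Commute.mul_left (k1.mul_right k3) (k4.mul_right k2))

theorem zp_comm {G : Type*} [Group G] (a : G) :
    ∀ x ∈ zpowers a, ∀ y ∈ zpowers a, x * y = y * x := by
  rintro _ ⟨i, rfl⟩ _ ⟨j, rfl⟩
  exact (Commute.refl a).zpow_zpow i j

theorem zp_commute {G : Type*} [Group G] {a x g : G} (hx : x ∈ zpowers a) (h : Commute g a) :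
    Commute g x := by
  obtain ⟨i, rfl⟩ := hx
  exact h.zpow_right i

/-- consequence of trivial core on one side -/
theorem ito_side {G : Type*} [Group G] (a c : G) (D : Subgroup G) (hDn : D.Normal)
    (hDc : ∀ x ∈ D, ∀ y ∈ D, x * y = y * x) (hD : ∀ g h : G, g * h * g⁻¹ * h⁻¹ ∈ D)
    (hac : ∀ g : G, ∃ x ∈ zpowers a, ∃ y ∈ zpowers c, g = x * y)
    (hA : (zpowers a).normalCore = ⊥) (hC : (zpowers c).normalCore = ⊥) :
    (∀ g, Commute g a → g ∈ zpowers a) ∧ (∀ d ∈ D, Commute d a → d = 1) := by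
  have h1 : ∀ y ∈ zpowers c, Commute y a → y = 1 := by
    intro y hy hya
    have : y ∈ (zpowers c).normalCore := by
      intro g
      have : Commute g y := by
        obtain ⟨u, hu, v, hv, rfl⟩ := hac g
        exact Commute.mul_left (zp_commute hu hya).symm (zp_comm c v hv y hy)
      rw [this.eq]
      simpa using hy
    rw [hC] at this
    exact this
  have h2 : ∀ g, Commute g a → g ∈ zpowers a := by
    intro g hg
    obtain ⟨x, hx, y, hy, rfl⟩ := hac g
    have hxa : Commute x a := zp_comm a x hx a (mem_zpowers a)
    have : Commute y a := by
      have := (hxa.inv_left).mul_left hg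
      simpa using this
    rw [h1 y hy this]
    simpa using hx
  refine ⟨h2, ?_⟩
  intro d hd hda
  have : d ∈ (zpowers a).normalCore := by
    intro g
    apply h2
    -- g d g⁻¹ commutes with a iff d commutes with g⁻¹ a g
    have e : Commute d ((g⁻¹ * a * g⁻¹⁻¹ * a⁻¹) * a) :=
      Commute.mul_right (hDc d hd _ (hD _ _)) hda
    have e' : d * (g⁻¹ * a * g) = (g⁻¹ * a * g) * d := by
      have := e.eq
      simpa using this
    show g * d * g⁻¹ * a = a * (g * d * g⁻¹)
    calc g * d * g⁻¹ * a = g * (d * (g⁻¹ * a * g)) * g⁻¹ := by group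
      _ = _ := by rw [e']; group
  rw [hA] at this
  exact this

theorem ito_surj {G : Type*} [Group G] [Finite G] (t : G) (D : Subgroup G) (hDn : D.Normal)
    (h : ∀ d ∈ D, Commute d t → d = 1) (e : G) (he : e ∈ D) :
    ∃ d ∈ D, d * t * d⁻¹ * t⁻¹ = e := by
  let f : D → D := fun d => ⟨(d : G) * t * (d : G)⁻¹ * t⁻¹, by
    have e : (d : G) * t * (d : G)⁻¹ * t⁻¹ = d * (t * (d : G)⁻¹ * t⁻¹) := by group
    rw [e]
    exact mul_mem d.2 (hDn.conj_mem _ (inv_mem d.2) _)⟩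
  have hf : Function.Injective f := by
    intro d d' hdd
    have h0 : (d : G) * t * (d : G)⁻¹ * t⁻¹ = d' * t * (d' : G)⁻¹ * t⁻¹ := congrArg Subtype.val hdd
    have h1 : (d : G) * t * (d : G)⁻¹ = d' * t * (d' : G)⁻¹ := mul_right_cancel h0
    have h2 : (d' : G)⁻¹ * d = 1 := by
      apply h _ (mul_mem (inv_mem d'.2) d.2)
      show (d' : G)⁻¹ * d * t = t * ((d' : G)⁻¹ * d)
      calc (d' : G)⁻¹ * d * t = (d' : G)⁻¹ * (d * t * (d : G)⁻¹) * d := by group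
        _ = _ := by rw [h1]; group
    exact Subtype.ext (inv_mul_eq_one.mp h2).symm
  obtain ⟨d, hd⟩ := Finite.surjective_of_injective hf ⟨e, he⟩
  exact ⟨d, d.2, congrArg Subtype.val hd⟩

/-- A nontrivial product of two cyclic groups: one factor has nontrivial core. -/
theorem ito_core {G : Type*} [Group G] [Finite G] (a c : G) (ha : a ≠ 1)
    (hac : ∀ g : G, ∃ x ∈ zpowers a, ∃ y ∈ zpowers c, g = x * y)
    (hA : (zpowers a).normalCore = ⊥) (hC : (zpowers c).normalCore = ⊥) : False := by
  obtain ⟨D, hDn, hDc, hD⟩ := ito_metabelian (zpowers a) (zpowers c) (zp_comm a) (zp_comm c) hac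
  have hca : ∀ g : G, ∃ y ∈ zpowers c, ∃ x ∈ zpowers a, g = y * x := by
    intro g
    obtain ⟨x, hx, y, hy, h⟩ := hac g⁻¹
    refine ⟨y⁻¹, inv_mem hy, x⁻¹, inv_mem hx, ?_⟩
    rw [← inv_inv g, h]; group
  obtain ⟨hA1, hA2⟩ := ito_side a c D hDn hDc hD hac hA hC
  obtain ⟨hC1, hC2⟩ := ito_side c a D hDn hDc hD hca hC hA
  obtain ⟨d, hd, hde⟩ := ito_surj a D hDn hA2 _ (hD c a)
  have h1 : d * a * d⁻¹ = c * a * c⁻¹ := mul_right_cancel hde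
  have h2 : d⁻¹ * c ∈ zpowers a := by
    apply hA1
    show d⁻¹ * c * a = a * (d⁻¹ * c)
    calc d⁻¹ * c * a = d⁻¹ * (c * a * c⁻¹) * c := by group
      _ = _ := by rw [← h1]; group
  set t := d⁻¹ * c with ht
  have hct : c = d * t := by rw [ht]; group
  obtain ⟨f, hf, hfe⟩ := ito_surj t D hDn (by
    intro f hf hft
    apply hC2 f hf
    rw [hct]
    exact Commute.mul_right (hDc f hf d hd) hft) d hd
  have h3 : c = f * t * f⁻¹ := by
    rw [hct, ← hfe]; group
  obtain ⟨y, hy, x, hx, rfl⟩ := hca f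
  have hxt : x * t = t * x := zp_comm a x hx t h2
  have hyc : y * c = c * y := zp_comm c y hy c (mem_zpowers c)
  have h4 : c = t := by
    have h5 : c = y * t * y⁻¹ := by
      calc c = y * (x * t) * x⁻¹ * y⁻¹ := by conv_lhs => rw [h3]
                                             group
        _ = _ := by rw [hxt]; group
    calc c = y⁻¹ * (y * c) := by group
      _ = y⁻¹ * c * y := by rw [hyc]; group
      _ = y⁻¹ * (y * t * y⁻¹) * y := by rw [← h5]
      _ = t := by group
  have hcA : c ∈ zpowers a := h4 ▸ h2
  have hall : ∀ g : G, g ∈ zpowers a := by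
    intro g
    obtain ⟨x, hx, y, hy, rfl⟩ := hac g
    exact mul_mem hx ((zpowers_le.mpr hcA) hy)
  have : a ∈ (zpowers a).normalCore := fun g => hall _
  rw [hA] at this
  exact ha this

theorem cyc_unique_aux {H : Type*} [Group H] [Finite H] [IsCyclic H] (z y : H)
    (h : y ^ orderOf z = 1) : y ∈ zpowers z := by
  classical
  have := Fintype.ofFinite H
  have h1 : (Finset.univ.filter fun g : H => g ^ orderOf z = 1).card ≤ orderOf z :=
    IsCyclic.card_pow_eq_one_le (orderOf_pos z)
  have h2 : (Finset.univ.filter fun g : H => g ∈ zpowers z).card = orderOf z := by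
    rw [← Nat.card_zpowers, Nat.card_eq_fintype_card, Fintype.card_subtype]
  have h3 : (Finset.univ.filter fun g : H => g ∈ zpowers z) ⊆
      (Finset.univ.filter fun g : H => g ^ orderOf z = 1) := by
    intro g hg
    simp only [Finset.mem_filter, Finset.mem_univ, true_and] at hg ⊢
    exact orderOf_dvd_iff_pow_eq_one.mp (orderOf_dvd_of_mem_zpowers hg)
  have h4 := Finset.eq_of_subset_of_card_le h3 (by omega)
  have h5 : y ∈ (Finset.univ.filter fun g : H => g ^ orderOf z = 1) := by simpa using h
  rw [← h4] at h5
  simpa using h5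

theorem cyc_unique {G : Type*} [Group G] [Finite G] (c z y : G) (hz : z ∈ zpowers c)
    (hy : y ∈ zpowers c) (h : y ^ orderOf z = 1) : y ∈ zpowers z := by
  have h1 : (⟨y, hy⟩ : zpowers c) ∈ zpowers (⟨z, hz⟩ : zpowers c) := by
    apply cyc_unique_aux
    apply Subtype.ext
    simpa [Subgroup.orderOf_mk] using h
  obtain ⟨i, hi⟩ := h1
  exact ⟨i, congrArg Subtype.val hi⟩

theorem core_elt {G : Type*} [Group G] [Finite G] (c : G) (h : (zpowers c).normalCore ≠ ⊥) :
    ∃ z ∈ zpowers c, (orderOf z).Prime ∧ ∀ g, g * z * g⁻¹ ∈ zpowers z := by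
  have hcard : Nat.card (zpowers c).normalCore ≠ 1 := fun hh => h (card_eq_one.mp hh)
  obtain ⟨p, hp, hdvd⟩ := Nat.exists_prime_and_dvd hcard
  haveI := Fact.mk hp
  obtain ⟨⟨z, hz⟩, hzo⟩ := exists_prime_orderOf_dvd_card' p hdvd
  rw [Subgroup.orderOf_mk] at hzo
  refine ⟨z, normalCore_le _ hz, hzo ▸ hp, fun g => ?_⟩
  apply cyc_unique c z _ (normalCore_le _ hz) (hz g)
  rw [conj_pow, pow_orderOf_eq_one]
  simp

theorem ito_elt {G : Type*} [Group G] [Finite G] (a c : G) (ha : a ≠ 1)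
    (hac : ∀ g : G, ∃ x ∈ zpowers a, ∃ y ∈ zpowers c, g = x * y) :
    ∃ z, (z ∈ zpowers a ∨ z ∈ zpowers c) ∧ (orderOf z).Prime ∧
      ∀ g, g * z * g⁻¹ ∈ zpowers z := by
  by_cases hA : (zpowers a).normalCore = ⊥
  · by_cases hC : (zpowers c).normalCore = ⊥
    · exact (ito_core a c ha hac hA hC).elim
    · obtain ⟨z, h1, h2⟩ := core_elt c hC
      exact ⟨z, Or.inr h1, h2⟩
  · obtain ⟨z, h1, h2⟩ := core_elt a hA
    exact ⟨z, Or.inl h1, h2⟩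

theorem ito_elt_sub {X : Type*} [Group X] [Finite X] (M : Subgroup X) (a c : X) (ha : a ≠ 1)
    (haM : a ∈ M) (hcM : c ∈ M)
    (hac : ∀ g ∈ M, ∃ x ∈ zpowers a, ∃ y ∈ zpowers c, g = x * y) :
    ∃ z, (z ∈ zpowers a ∨ z ∈ zpowers c) ∧ (orderOf z).Prime ∧
      ∀ g ∈ M, g * z * g⁻¹ ∈ zpowers z := by
  obtain ⟨z, h1, h2, h3⟩ := ito_elt (G := M) ⟨a, haM⟩ ⟨c, hcM⟩
    (fun h => ha (congrArg Subtype.val h)) (by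
      rintro ⟨g, hg⟩
      obtain ⟨_, ⟨i, rfl⟩, _, ⟨j, rfl⟩, rfl⟩ := hac g hg
      exact ⟨_, ⟨i, rfl⟩, _, ⟨j, rfl⟩, rfl⟩)
  refine ⟨z, ?_, ?_, ?_⟩
  · rcases h1 with ⟨i, hi⟩ | ⟨i, hi⟩
    · exact Or.inl ⟨i, congrArg Subtype.val hi⟩
    · exact Or.inr ⟨i, congrArg Subtype.val hi⟩
  · rwa [Subgroup.orderOf_coe]
  · intro g hg
    obtain ⟨i, hi⟩ := h3 ⟨g, hg⟩
    exact ⟨i, congrArg Subtype.val hi⟩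

theorem conj_zp {G : Type*} [Group G] {g x y : G} (h : g * x * g⁻¹ ∈ zpowers x)
    (hy : y ∈ zpowers x) : g * y * g⁻¹ ∈ zpowers x := by
  obtain ⟨i, rfl⟩ := hy
  show g * x ^ i * g⁻¹ ∈ zpowers x
  rw [← conj_zpow]
  exact zpow_mem h i

theorem zp_normal {X : Type*} [Group X] [Finite X] (a b c x : X)
    (hprod : (closure ({a, b} : Set X) : Set X) * (zpowers c : Set X) = Set.univ)
    (ha : a * x * a⁻¹ ∈ zpowers x) (hb : b * x * b⁻¹ ∈ zpowers x)
    (hc : c * x * c⁻¹ ∈ zpowers x) : (zpowers x).Normal := by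
  rw [← normalizer_eq_top_iff, eq_top_iff]
  have key : ∀ g, g * x * g⁻¹ ∈ zpowers x → g ∈ normalizer (zpowers x : Set X) := by
    intro g hg
    exact mem_normalizer_fintype fun y hy => conj_zp hg hy
  intro g _
  have hg : g ∈ (closure ({a, b} : Set X) : Set X) * (zpowers c : Set X) := by
    rw [hprod]; trivial
  obtain ⟨u, hu, v, hv, rfl⟩ := hg
  refine mul_mem ?_ ?_
  · refine (closure_le _).mpr ?_ hu
    rintro t (rfl | rfl)
    · exact key _ ha
    · exact key _ hb
  · exact (zpowers_le.mpr (key _ hc)) hv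

theorem core_ne {X : Type*} [Group X] (c z : X) (hz : z ∈ zpowers c) (h1 : z ≠ 1)
    (hN : (zpowers z).Normal) : (zpowers c).normalCore ≠ ⊥ := by
  intro h
  have : z ∈ (zpowers c).normalCore :=
    normal_le_normalCore.mpr (zpowers_le.mpr hz) (mem_zpowers z)
  rw [h] at this
  exact h1 this

theorem prime_disj {G : Type*} [Group G] [Finite G] {z w t : G} (hw : (orderOf w).Prime)
    (h : w ∉ zpowers z) (ht : t ∈ zpowers z) (ht' : t ∈ zpowers w) : t = 1 := by
  by_contra hne
  have h1 : orderOf t = orderOf w := by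
    rcases (Nat.dvd_prime hw).mp (orderOf_dvd_of_mem_zpowers ht') with h2 | h2
    · exact (hne (orderOf_eq_one_iff.mp h2)).elim
    · exact h2
  have : zpowers t = zpowers w := by
    apply eq_of_le_of_card_ge (zpowers_le.mpr ht')
    simp [Nat.card_zpowers, h1]
  apply h
  have hwt : w ∈ zpowers t := this ▸ mem_zpowers w
  exact (zpowers_le.mpr ht) hwt

theorem stmt11 {X : Type*} [Group X] [Finite X] (n m : ℕ) (hn : 2 ≤ n) (hm : 2 ≤ m)
    (a b c : X)
    (ha : orderOf a = 4 * n) (hb : orderOf b = 2)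
    (hab : b⁻¹ * a * b = a ^ (2 * n - 1))
    (hG : Nat.card (closure ({a, b} : Set X)) = 8 * n)
    (hc : orderOf c = m)
    (hprod : (closure ({a, b} : Set X) : Set X) * (zpowers c : Set X) = Set.univ)
    (hint : closure ({a, b} : Set X) ⊓ zpowers c = ⊥)
    (hcore : (zpowers c).normalCore = ⊥)
    (hM : ∃ M : Subgroup X, (M : Set X) = (zpowers a : Set X) * (zpowers c : Set X)) :
    (zpowers a).normalCore ≠ ⊥ := by
  obtain ⟨M, hM⟩ := hM
  have hbb : b * b = 1 := by
    have := pow_orderOf_eq_one b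
    rwa [hb, pow_two] at this
  have hbi : b⁻¹ = b := inv_eq_of_mul_eq_one_left hbb
  have hbbm : ∀ g, b * (b * g) = g := fun g => by rw [← mul_assoc, hbb, one_mul]
  have hcc : ∀ g, b * (b * g * b) * b = g := by
    intro g
    calc b * (b * g * b) * b = (b * b) * g * (b * b) := by group
      _ = g := by rw [hbb]; simp
  set e := 2 * n - 1 with he
  -- `b` acts as a power map on `⟨a⟩`
  have hbx : ∀ x ∈ zpowers a, b * x * b = x ^ e := by
    rintro _ ⟨i, rfl⟩
    have h1 : b * a * b⁻¹ = a ^ e := by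
      rw [hbi] at hab ⊢; exact hab
    calc b * a ^ i * b = b * a ^ i * b⁻¹ := by rw [hbi]
      _ = (a ^ e) ^ i := by rw [← conj_zpow, h1]
      _ = (a ^ i) ^ e := by rw [← zpow_natCast, ← zpow_natCast, ← zpow_mul, ← zpow_mul, mul_comm]
  have hbx' : ∀ x ∈ zpowers a, b * x * b⁻¹ ∈ zpowers x := by
    intro x hx
    rw [hbi, hbx x hx]
    exact pow_mem (mem_zpowers x) e
  have hbxa : ∀ x ∈ zpowers a, b * x * b ∈ zpowers a := by
    intro x hx
    rw [hbx x hx]; exact pow_mem hx e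
  have hbcomm : ∀ x ∈ zpowers a, ∀ w, Commute (b * x * b) w → Commute x w := by
    intro x hx w h
    have h2 := hbx _ (hbxa x hx)
    rw [hcc] at h2
    rw [h2]
    exact h.pow_left e
  have hflip : ∀ g h, Commute g (b * h * b) → Commute (b * g * b) h := by
    intro g h hgh
    have h1 : g * (b * h * b) = (b * h * b) * g := hgh
    show b * g * b * h = h * (b * g * b)
    calc b * g * b * h = b * (g * (b * h * b)) * b := by
          simp only [mul_assoc, hbb, mul_one]
      _ = h * (b * g * b) := by
          rw [h1]; simp only [mul_assoc, hbbm]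
  have hdisj : ∀ x ∈ zpowers a, x ∈ zpowers c → x = 1 := by
    intro x hx hxc
    have : x ∈ closure ({a, b} : Set X) ⊓ zpowers c :=
      ⟨(zpowers_le.mpr (subset_closure (by simp))) hx, hxc⟩
    rw [hint] at this
    exact this
  have ha1 : a ≠ 1 := by
    rintro rfl
    rw [orderOf_one] at ha
    omega
  have hMmem : ∀ g, g ∈ M ↔ ∃ x ∈ zpowers a, ∃ y ∈ zpowers c, g = x * y := by
    intro g
    rw [← SetLike.mem_coe, hM, Set.mem_mul]
    constructor
    · rintro ⟨x, hx, y, hy, h⟩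
      exact ⟨x, hx, y, hy, h.symm⟩
    · rintro ⟨x, hx, y, hy, h⟩
      exact ⟨x, hx, y, hy, h.symm⟩
  have hAM : ∀ x ∈ zpowers a, x ∈ M := fun x hx =>
    (hMmem x).mpr ⟨x, hx, 1, one_mem _, by simp⟩
  have hCM : ∀ x ∈ zpowers c, x ∈ M := fun x hx =>
    (hMmem x).mpr ⟨1, one_mem _, x, hx, by simp⟩
  have haM := hAM a (mem_zpowers a)
  have hcM := hCM c (mem_zpowers c)
  -- `X = M ∪ bM`
  have hcl : ∀ g ∈ closure ({a, b} : Set X), g ∈ zpowers a ∨ b * g ∈ zpowers a := by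
    intro g hg
    induction hg using closure_induction_left with
    | one => exact Or.inl (one_mem _)
    | mul_left t ht g _ ih =>
      rcases ht with rfl | rfl
      · rcases ih with h | h
        · exact Or.inl (mul_mem (mem_zpowers _) h)
        · right
          have : b * (t * g) = (b * t * b) * (b * g) := by
            simp only [mul_assoc, hbbm]
          rw [this]
          exact mul_mem (hbxa _ (mem_zpowers _)) h
      · rcases ih with h | h
        · right; rwa [hbbm]
        · left; exact h
    | inv_mul_cancel t ht g _ ih =>
      rcases ht with rfl | rfl
      · rcases ih with h | h
        · exact Or.inl (mul_mem (inv_mem (mem_zpowers _)) h)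
        · right
          have : b * (t⁻¹ * g) = (b * t⁻¹ * b) * (b * g) := by
            simp only [mul_assoc, hbbm]
          rw [this]
          exact mul_mem (hbxa _ (inv_mem (mem_zpowers _))) h
      · rw [hbi]
        rcases ih with h | h
        · right; rwa [hbbm]
        · left; exact h
  have hX : ∀ g, g ∈ M ∨ b * g ∈ M := by
    intro g
    have hg : g ∈ (closure ({a, b} : Set X) : Set X) * (zpowers c : Set X) := by
      rw [hprod]; trivial
    obtain ⟨u, hu, v, hv, rfl⟩ := hg
    rcases hcl u hu with h | h
    · exact Or.inl (mul_mem (hAM _ h) (hCM _ hv))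
    · right
      show b * (u * v) ∈ M
      rw [← mul_assoc]
      exact mul_mem (hAM _ h) (hCM _ hv)
  have hMb : ∀ g ∈ M, b * g * b ∈ M := by
    intro g hg
    rcases hX (b * g * b) with h | h
    · exact h
    · have h1 : b * (b * g * b) = g * b := by simp only [mul_assoc, hbbm]
      rw [h1] at h
      have hbM : b ∈ M := (mul_mem_cancel_left hg).mp h
      exact mul_mem (mul_mem hbM hg) hbM
  obtain ⟨z, hz, hp, hzM⟩ := ito_elt_sub M a c ha1 haM hcM fun g hg => (hMmem g).mp hg
  have hz1 : z ≠ 1 := by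
    rintro rfl
    rw [orderOf_one] at hp
    exact Nat.not_prime_one hp
  rcases hz with hz | hz
  · exact core_ne a z hz hz1 (zp_normal a b c z hprod (hzM a haM) (hbx' z hz) (hzM c hcM))
  -- now `z ∈ ⟨c⟩`
  obtain ⟨w, hw⟩ : ∃ w, w = b * z * b := ⟨_, rfl⟩
  have hwz : b * w * b = z := by rw [hw, hcc]
  have hwo : orderOf w = orderOf z := by
    have h1 : w = MulAut.conj b z := by simp [hw, hbi]
    rw [h1]
    exact (MulAut.conj b).orderOf_eq z
  have hwp : (orderOf w).Prime := hwo ▸ hp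
  have hwnz : w ∉ zpowers z := by
    intro h
    refine core_ne c z hz hz1 (zp_normal a b c z hprod (hzM a haM) ?_ (hzM c hcM)) hcore
    rw [hbi, ← hw]; exact h
  have hwnc : w ∉ zpowers c := by
    intro h
    apply hwnz
    apply cyc_unique c z w hz h
    rw [← hwo, pow_orderOf_eq_one]
  have hwM : w ∈ M := by rw [hw]; exact hMb z (hCM z hz)
  have hwN : ∀ g ∈ M, g * w * g⁻¹ ∈ zpowers w := by
    intro g hg
    obtain ⟨i, hi⟩ := hzM _ (hMb g hg)
    refine ⟨i, ?_⟩
    have hi' : z ^ i = b * g * b * z * (b * g * b)⁻¹ := hi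
    show w ^ i = g * w * g⁻¹
    have h1 : w ^ i = b * z ^ i * b⁻¹ := by
      rw [← conj_zpow, hbi, hw]
    rw [h1, hi', hw]
    simp only [mul_inv_rev, hbi, mul_assoc, hbbm, hbb, mul_one]
  have hzw : Commute z w := by
    have h1 : z * w * z⁻¹ * w⁻¹ = 1 := by
      apply prime_disj hwp hwnz
      · have : z * w * z⁻¹ * w⁻¹ = z * (w * z * w⁻¹)⁻¹ := by group
        rw [this]
        exact mul_mem (mem_zpowers z) (inv_mem (hzM w hwM))
      · exact mul_mem (hwN z (hCM z hz)) (inv_mem (mem_zpowers w))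
    rw [mul_inv_eq_one, mul_inv_eq_iff_eq_mul] at h1
    exact h1
  obtain ⟨x, hx, y, hy, hwxy⟩ := (hMmem w).mp hwM
  have hyz : Commute y z := zp_comm c y hy z hz
  have hxw' : x = w * y⁻¹ := by rw [hwxy]; group
  have hx1 : x ≠ 1 := by
    intro h
    rw [h, one_mul] at hwxy
    exact hwnc (hwxy ▸ hy)
  have hxz : Commute x z := by
    rw [hxw']
    exact hzw.symm.mul_left hyz.inv_left
  have hxw : Commute x w := by
    apply hbcomm x hx
    apply hflip
    rw [hwz]; exact hxz
  have hyw : Commute y w := by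
    have : y = x⁻¹ * w := by rw [hwxy]; group
    rw [this]
    exact hxw.inv_left.mul_left (Commute.refl w)
  have hyo : y ^ orderOf z = 1 := by
    have h1 : x ^ orderOf z = (y⁻¹) ^ orderOf z := by
      rw [hxw', (hyw.symm.inv_right).mul_pow, ← hwo, pow_orderOf_eq_one, one_mul]
    have h2 : x ^ orderOf z = 1 :=
      hdisj _ (pow_mem hx _) (h1 ▸ pow_mem (inv_mem hy) _)
    rw [h2, inv_pow] at h1
    exact inv_eq_one.mp h1.symm
  have hyzz : y ∈ zpowers z := cyc_unique c z y hz hy hyo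
  have hax : Commute a x := zp_comm a a (mem_zpowers a) x hx
  have haw : Commute a w := by
    have h1 : a * w * a⁻¹ * w⁻¹ = 1 := by
      apply prime_disj hwp hwnz
      · have h2 : a * w * a⁻¹ = x * (a * y * a⁻¹) := by
          calc a * w * a⁻¹ = (a * x) * y * a⁻¹ := by rw [hwxy]; group
            _ = _ := by rw [hax.eq]; group
        have h3 : a * w * a⁻¹ * w⁻¹ = w * (y⁻¹ * (a * y * a⁻¹)) * w⁻¹ := by
          rw [h2, hxw']; group
        rw [h3]
        exact conj_zp (hzM w hwM) (mul_mem (inv_mem hyzz) (conj_zp (hzM a haM) hyzz))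
      · exact mul_mem (hwN a haM) (inv_mem (mem_zpowers w))
    rw [mul_inv_eq_one, mul_inv_eq_iff_eq_mul] at h1
    exact h1
  have haz : Commute a z := by
    apply hbcomm a (mem_zpowers a)
    apply hflip
    rw [← hw]; exact haw
  have hcz : Commute c z := zp_comm c c (mem_zpowers c) z hz
  have hMz : ∀ g ∈ M, Commute g z := by
    intro g hg
    obtain ⟨u, hu, v, hv, rfl⟩ := (hMmem g).mp hg
    exact (zp_commute hu haz.symm).symm.mul_left (zp_commute hv hcz.symm).symm
  have hcw : Commute c w := by
    have := hflip (b * c * b) w (by rw [hwz]; exact hMz _ (hMb c hcM))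
    rwa [hcc] at this
  have hcy : Commute c y := zp_comm c c (mem_zpowers c) y hy
  have hcx : Commute c x := by
    rw [hxw']
    exact hcw.mul_right hcy.inv_right
  have hself : ∀ g, Commute g x → g * x * g⁻¹ ∈ zpowers x := by
    intro g hg
    rw [hg.eq]
    simp
  exact core_ne a x hx hx1
    (zp_normal a b c x hprod (hself a hax) (hbx' x hx) (hself c hcx))
end

section
/- Let X = G⟨c⟩ where G = ⟨a, b⟩ ≅ SD_{8n} (n ≥ 2), ⟨c⟩ is cyclic with G ∩ ⟨c⟩ = 1, the core of ⟨c⟩ in X is trivial, and ⟨a⟩⟨c⟩ is a subgroup of X. Then ⟨a^4⟩ is normal in X. -/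
open Pointwise Subgroup

namespace SDProof

universe u

theorem cyc_mem {X : Type u} [Group X] [Finite X] {a g h : X} (hg : g ∈ zpowers a)
    (hh : h ∈ zpowers a) (ho : h ^ orderOf g = 1) : h ∈ zpowers g := by
  have hg' : g ∈ Submonoid.powers a := (mem_powers_iff_mem_zpowers).2 hg
  have hh' : h ∈ Submonoid.powers a := (mem_powers_iff_mem_zpowers).2 hh
  obtain ⟨i, rfl⟩ := hg'
  obtain ⟨j, rfl⟩ := hh'
  simp only at ho ⊢
  rw [orderOf_pow, ← pow_mul] at ho
  have hd := orderOf_dvd_of_pow_eq_one ho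
  have hpos : 0 < orderOf a := orderOf_pos a
  have hgd : Nat.gcd (orderOf a) i ∣ j := by
    have hgpos : 0 < Nat.gcd (orderOf a) i := Nat.gcd_pos_of_pos_left _ hpos
    obtain ⟨q, hq⟩ := Nat.gcd_dvd_left (orderOf a) i
    set G := Nat.gcd (orderOf a) i with hG
    have h1 : orderOf a / G = q := by
      rw [hq, Nat.mul_div_cancel_left _ hgpos]
    rw [h1] at hd
    have hqpos : 0 < q := by
      rcases Nat.eq_zero_or_pos q with h | h
      · rw [h] at hq; omega
      · exact h
    rw [hq] at hd
    exact Nat.dvd_of_mul_dvd_mul_right hqpos hd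
  obtain ⟨t, ht⟩ := hgd
  rw [mem_zpowers_iff]
  refine ⟨Nat.gcdB (orderOf a) i * t, ?_⟩
  have hb := Nat.gcd_eq_gcd_ab (orderOf a) i
  have : ((j : ℤ)) = (orderOf a : ℤ) * (Nat.gcdA (orderOf a) i * t)
      + i * (Nat.gcdB (orderOf a) i * t) := by
    rw [ht]; push_cast; rw [hb]; ring
  rw [← zpow_natCast a j, this, zpow_add, zpow_mul a (orderOf a : ℤ), zpow_natCast a (orderOf a),
    pow_orderOf_eq_one, one_zpow, one_mul, zpow_mul a (i : ℤ), zpow_natCast a i]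

theorem cyc_mem_prime {X : Type u} [Group X] [Finite X] {a g h : X} {p : ℕ} (hg : g ∈ zpowers a)
    (hh : h ∈ zpowers a) (ho : orderOf g = p) (hp : h ^ p = 1) : h ∈ zpowers g :=
  cyc_mem hg hh (by rw [ho]; exact hp)

/-- The configuration: `⟨a⟩⟨c⟩` is a subgroup normalised by the involution `b`, and
`b` inverts `a ^ 2`. -/
structure Cfg {X : Type u} [Group X] (a b c : X) : Prop where
  gen : Subgroup.closure ({a, b, c} : Set X) = ⊤
  comm : ∀ i j : ℤ, ∃ k l : ℤ, c ^ i * a ^ j = a ^ k * c ^ l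
  bc : ∃ s v : ℤ, b * c * b = a ^ s * c ^ v
  ba : ∃ r : ℤ, b * a * b = a ^ r
  bb : b * b = 1
  inv : b * a ^ 2 * b = (a ^ 2)⁻¹
  int : ∀ i j : ℤ, a ^ i = c ^ j → a ^ i = 1

namespace Cfg

variable {X : Type u} [Group X] {a b c : X}

theorem binv (h : Cfg a b c) : b⁻¹ = b := inv_eq_of_mul_eq_one_left h.bb

theorem conj_b_mul (h : Cfg a b c) (x y : X) : b * (x * y) * b = (b * x * b) * (b * y * b) := by
  have : b * x * b * (b * y * b) = b * x * (b * b) * y * b := by group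
  rw [this, h.bb]; group

theorem conj_b_zpow (h : Cfg a b c) (x : X) (n : ℤ) : b * x ^ n * b = (b * x * b) ^ n := by
  have h1 : ∀ y : X, b * y * b = b * y * b⁻¹ := fun y => by rw [h.binv]
  rw [h1, h1, conj_zpow]

theorem conj_b_pow (h : Cfg a b c) (x : X) (n : ℕ) : b * x ^ n * b = (b * x * b) ^ n := by
  simpa using h.conj_b_zpow x n

theorem conj_b_b (h : Cfg a b c) (x : X) : b * (b * x * b) * b = x := by
  have : b * (b * x * b) * b = (b * b) * x * (b * b) := by group
  rw [this, h.bb]; group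

theorem normal_of [Finite X] (h : Cfg a b c) (H : Subgroup X)
    (ha : ∀ x ∈ H, a * x * a⁻¹ ∈ H) (hb : ∀ x ∈ H, b * x * b ∈ H)
    (hc : ∀ x ∈ H, c * x * c⁻¹ ∈ H) : H.Normal := by
  rw [← Subgroup.normalizer_eq_top_iff, eq_top_iff, ← h.gen, Subgroup.closure_le]
  intro x hx
  simp only [Set.mem_insert_iff, Set.mem_singleton_iff] at hx
  rcases hx with rfl | rfl | rfl
  · exact Subgroup.mem_normalizer_fintype ha
  · refine Subgroup.mem_normalizer_fintype (fun y hy => ?_)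
    rw [h.binv]; exact hb y hy
  · exact Subgroup.mem_normalizer_fintype hc

theorem normal_zpowers [Finite X] (h : Cfg a b c) (g : X)
    (ha : a * g * a⁻¹ ∈ zpowers g) (hb : b * g * b ∈ zpowers g)
    (hc : c * g * c⁻¹ ∈ zpowers g) : (zpowers g).Normal := by
  refine h.normal_of _ ?_ ?_ ?_
  · rintro x ⟨i, rfl⟩
    simp only [← conj_zpow]; exact zpow_mem ha i
  · rintro x ⟨i, rfl⟩
    simp only [h.conj_b_zpow]; exact zpow_mem hb i
  · rintro x ⟨i, rfl⟩
    simp only [← conj_zpow]; exact zpow_mem hc i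

/-- Conjugating by `b` preserves subgroups of `⟨a⟩`. -/
theorem b_conj_mem (h : Cfg a b c) {g : X} (hg : g ∈ zpowers a) : b * g * b ∈ zpowers g := by
  obtain ⟨i, rfl⟩ := hg
  obtain ⟨r, hr⟩ := h.ba
  refine ⟨r, ?_⟩
  simp only [h.conj_b_zpow, hr]
  rw [← zpow_mul, ← zpow_mul, mul_comm]

theorem normal_of_mem [Finite X] (h : Cfg a b c) {g : X} (hg : g ∈ zpowers a)
    (hc : c * g * c⁻¹ ∈ zpowers a) : (zpowers g).Normal := by
  refine h.normal_zpowers g ?_ (h.b_conj_mem hg) ?_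
  · obtain ⟨i, rfl⟩ := hg
    have : a * a ^ i * a⁻¹ = a ^ i := by group
    simp only [this]; exact mem_zpowers _
  · refine cyc_mem hg hc ?_
    rw [conj_pow, pow_orderOf_eq_one]; group

theorem int' (h : Cfg a b c) {x : X} (h1 : x ∈ zpowers a) (h2 : x ∈ zpowers c) : x = 1 := by
  obtain ⟨i, rfl⟩ := h1
  obtain ⟨j, hj⟩ := h2
  exact h.int i j hj.symm

/-- uniqueness of the factorisation -/
theorem uniq (h : Cfg a b c) {i j k l : ℤ} (e : a ^ i * c ^ j = a ^ k * c ^ l) :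
    a ^ i = a ^ k ∧ c ^ j = c ^ l := by
  have h1 : a ^ (i - k) = c ^ (l - j) := by
    have : a ^ (-k) * (a ^ i * c ^ j) * c ^ (-j) = a ^ (-k) * (a ^ k * c ^ l) * c ^ (-j) := by rw [e]
    calc a ^ (i - k) = a ^ (-k) * (a ^ i * c ^ j) * c ^ (-j) := by group
      _ = _ := this
      _ = c ^ (l - j) := by group
  have h2 := h.int _ _ h1
  have h3 : c ^ (l - j) = 1 := by rw [← h1]; exact h2
  constructor
  · rw [zpow_sub] at h2; exact mul_inv_eq_one.1 h2
  · rw [zpow_sub] at h3; exact (mul_inv_eq_one.1 h3).symm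

/-- the subgroup `⟨a⟩⟨c⟩` -/
def M (h : Cfg a b c) : Subgroup X where
  carrier := {x | ∃ i j : ℤ, x = a ^ i * c ^ j}
  one_mem' := ⟨0, 0, by simp⟩
  mul_mem' := by
    rintro x y ⟨i, j, rfl⟩ ⟨k, l, rfl⟩
    obtain ⟨s, t, e⟩ := h.comm j k
    refine ⟨i + s, t + l, ?_⟩
    calc a ^ i * c ^ j * (a ^ k * c ^ l) = a ^ i * (c ^ j * a ^ k) * c ^ l := by group
      _ = _ := by rw [e]; group
  inv_mem' := by
    rintro x ⟨i, j, rfl⟩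
    obtain ⟨s, t, e⟩ := h.comm (-j) (-i)
    refine ⟨s, t, ?_⟩
    rw [← e]; group

theorem mem_M (h : Cfg a b c) {x : X} : x ∈ h.M ↔ ∃ i j : ℤ, x = a ^ i * c ^ j := Iff.rfl

theorem a_mem (h : Cfg a b c) : a ∈ h.M := ⟨1, 0, by simp⟩
theorem c_mem (h : Cfg a b c) : c ∈ h.M := ⟨0, 1, by simp⟩

theorem b_M (h : Cfg a b c) {x : X} (hx : x ∈ h.M) : b * x * b ∈ h.M := by
  obtain ⟨i, j, rfl⟩ := hx
  obtain ⟨r, hr⟩ := h.ba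
  obtain ⟨s, v, hs⟩ := h.bc
  rw [h.conj_b_mul, h.conj_b_zpow, h.conj_b_zpow]
  refine h.M.mul_mem (h.M.zpow_mem ?_ _) (h.M.zpow_mem ?_ _)
  · rw [hr]; exact h.M.zpow_mem h.a_mem _
  · rw [hs]; exact ⟨s, v, rfl⟩

end Cfg

theorem exists_prime_pow {X : Type u} [Group X] [Finite X] {g : X} (hg : g ≠ 1) :
    ∃ n : ℕ, (orderOf (g ^ n)).Prime := by
  have h1 : orderOf g ≠ 1 := fun h => hg (orderOf_eq_one_iff.1 h)
  obtain ⟨q, hq, hd⟩ := Nat.exists_prime_and_dvd h1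
  refine ⟨orderOf g / q, ?_⟩
  rw [orderOf_pow_orderOf_div (orderOf_pos g).ne' hd]
  exact hq

theorem mem_of_prime {X : Type u} [Group X] [Finite X] {x t : X} (hp : (orderOf x).Prime)
    (ht : t ∈ zpowers x) (h1 : t ≠ 1) : x ∈ zpowers t := by
  refine cyc_mem ht (mem_zpowers x) ?_
  have hd : orderOf t ∣ orderOf x := orderOf_dvd_of_mem_zpowers ht
  rcases (Nat.dvd_prime hp).1 hd with h | h
  · exact absurd (orderOf_eq_one_iff.1 h) h1
  · rw [h, pow_orderOf_eq_one]

theorem order_lt {X : Type u} [Group X] [Finite X] {x y : X}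
    (hc : ∀ i j : ℤ, ∃ k l : ℤ, y ^ i * x ^ j = x ^ k * y ^ l)
    (hJ : ∀ g ∈ zpowers x, y * g * y⁻¹ ∈ zpowers x → g = 1) (hy : y ∉ zpowers x) :
    orderOf x < orderOf y := by
  classical
  have hf : ∀ g : zpowers x, ∃ z : zpowers y, ∃ k ∈ zpowers x, y * (g : X) = k * (z : X) := by
    rintro ⟨g, j, rfl⟩
    obtain ⟨k, l, e⟩ := hc 1 j
    exact ⟨⟨y ^ l, l, rfl⟩, x ^ k, ⟨k, rfl⟩, by simpa using e⟩
  choose f k hk hfk using hf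
  have hinj : Function.Injective f := by
    intro g g' e
    have h1 := hfk g
    have h2 := hfk g'
    rw [e] at h1
    have h3 : y * ((g : X) * (g' : X)⁻¹) * y⁻¹ = k g * (k g')⁻¹ := by
      calc y * ((g : X) * (g' : X)⁻¹) * y⁻¹ = (y * g) * (y * g')⁻¹ := by group
        _ = _ := by rw [h1, h2]; group
    have h4 := hJ _ ((zpowers x).mul_mem g.2 ((zpowers x).inv_mem g'.2))
      (by rw [h3]; exact (zpowers x).mul_mem (hk g) ((zpowers x).inv_mem (hk g')))
    exact Subtype.ext (mul_inv_eq_one.1 h4)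
  rw [← Nat.card_zpowers, ← Nat.card_zpowers]
  have := Fintype.ofFinite (zpowers x)
  have := Fintype.ofFinite (zpowers y)
  rw [Nat.card_eq_fintype_card, Nat.card_eq_fintype_card]
  refine Fintype.card_lt_of_injective_of_notMem f hinj (b := 1) ?_
  rintro ⟨g, hg⟩
  have h1 := hfk g
  rw [hg] at h1
  apply hy
  have : y = k g * (g : X)⁻¹ := by
    rw [eq_mul_inv_iff_mul_eq, h1]; simp
  rw [this]
  exact (zpowers x).mul_mem (hk g) ((zpowers x).inv_mem g.2)

namespace Cfg

variable {X : Type u} [Group X] {a b c : X}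

theorem comm' (h : Cfg a b c) (i j : ℤ) : ∃ k l : ℤ, a ^ i * c ^ j = c ^ k * a ^ l := by
  obtain ⟨k, l, e⟩ := h.comm (-j) (-i)
  refine ⟨-l, -k, ?_⟩
  have : (c ^ (-j) * a ^ (-i))⁻¹ = (a ^ k * c ^ l)⁻¹ := by rw [e]
  simpa [mul_inv_rev] using this

theorem exists_P [Finite X] (h : Cfg a b c) (ha : a ≠ 1)
    (hcf : ∀ x ∈ zpowers c, (zpowers x).Normal → x = 1) :
    ∃ w ∈ zpowers a, (orderOf w).Prime ∧ (zpowers w).Normal := by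
  by_cases hJ : ∃ g ∈ zpowers a, g ≠ 1 ∧ c * g * c⁻¹ ∈ zpowers a
  · obtain ⟨g, hg, h1, hc⟩ := hJ
    obtain ⟨n, hn⟩ := exists_prime_pow h1
    refine ⟨g ^ n, pow_mem hg n, hn, h.normal_of_mem (pow_mem hg n) ?_⟩
    rw [← conj_pow]; exact pow_mem hc n
  have hJ' : ∀ g ∈ zpowers a, c * g * c⁻¹ ∈ zpowers a → g = 1 := by
    intro g hg hc
    by_contra h1
    exact hJ ⟨g, hg, h1, hc⟩
  have hca : c ∉ zpowers a := by
    intro hc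
    have : c = 1 := h.int' hc (mem_zpowers c)
    apply ha
    apply hJ' a (mem_zpowers a)
    rw [this]; simp
  have hac : a ∉ zpowers c := fun hc => ha (h.int' (mem_zpowers a) hc)
  have hlt := order_lt h.comm hJ' hca
  have hK : ∃ g ∈ zpowers c, g ≠ 1 ∧ a * g * a⁻¹ ∈ zpowers c := by
    by_contra hK
    have hK' : ∀ g ∈ zpowers c, a * g * a⁻¹ ∈ zpowers c → g = 1 := by
      intro g hg hc
      by_contra h1
      exact hK ⟨g, hg, h1, hc⟩
    have := order_lt h.comm' hK' hac
    omega
  obtain ⟨g, hg, hg1, hga⟩ := hK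
  obtain ⟨n, hn⟩ := exists_prime_pow hg1
  obtain ⟨x, hx⟩ : ∃ x, x = g ^ n := ⟨_, rfl⟩
  rw [← hx] at hn
  have hxc : x ∈ zpowers c := by rw [hx]; exact pow_mem hg n
  have hxa : a * x * a⁻¹ ∈ zpowers x := by
    refine cyc_mem hxc ?_ ?_
    · rw [hx, ← conj_pow]; exact pow_mem hga n
    · rw [conj_pow, pow_orderOf_eq_one]; group
  have hcx : Commute c x := by
    obtain ⟨i, rfl⟩ := hxc
    exact Commute.self_zpow c i
  have hx1 : x ≠ 1 := by
    rintro rfl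
    rw [orderOf_one] at hn; exact Nat.not_prime_one hn
  have hbx : b * x * b ∉ zpowers x := by
    intro hb
    refine hx1 (hcf x hxc (h.normal_zpowers x hxa hb ?_))
    rw [hcx.eq]; simp
  obtain ⟨x', hx'⟩ : ∃ x', x' = b * x * b := ⟨_, rfl⟩
  have hbx' : b * x' * b = x := by rw [hx', h.conj_b_b]
  have hord : orderOf x' = orderOf x := by
    rw [hx']
    have := orderOf_injective (MulAut.conj b).toMonoidHom (MulAut.conj b).injective x
    simpa [h.binv] using this
  -- M normalises ⟨x⟩ and ⟨x'⟩
  have hMx : ∀ y ∈ h.M, y * x * y⁻¹ ∈ zpowers x := by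
    have hle : h.M ≤ Subgroup.normalizer (zpowers x : Set X) := by
      rintro y ⟨i, j, rfl⟩
      refine mul_mem (zpow_mem ?_ _) (zpow_mem ?_ _)
      · refine Subgroup.mem_normalizer_fintype ?_
        rintro z ⟨q, rfl⟩
        simp only [← conj_zpow]; exact zpow_mem hxa q
      · refine Subgroup.mem_normalizer_fintype ?_
        rintro z ⟨q, rfl⟩
        simp only [← conj_zpow]
        refine zpow_mem ?_ q
        rw [hcx.eq]; simp
    intro y hy
    exact (Subgroup.mem_normalizer_iff.1 (hle hy) x).1 (mem_zpowers x)
  have hMx' : ∀ y ∈ h.M, y * x' * y⁻¹ ∈ zpowers x' := by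
    intro y hy
    obtain ⟨q, hq⟩ := hMx _ (h.b_M hy)
    refine ⟨q, ?_⟩
    simp only at hq ⊢
    rw [hx', ← h.conj_b_zpow, hq]
    have e1 : (b * y * b)⁻¹ = b * y⁻¹ * b := by
      simp [mul_inv_rev, h.binv, mul_assoc]
    rw [e1]
    have : b * (b * y * b * x * (b * y⁻¹ * b)) * b
      = (b * b) * y * (b * x * b) * y⁻¹ * (b * b) := by group
    rw [this, h.bb]; group
  have hxM : x ∈ h.M := by
    obtain ⟨i, rfl⟩ := hxc
    exact zpow_mem h.c_mem i
  have hxM' : x' ∈ h.M := by rw [hx']; exact h.b_M hxM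
  have htriv : ∀ t, t ∈ zpowers x → t ∈ zpowers x' → t = 1 := by
    intro t h1 h2
    by_contra ht
    have := mem_of_prime (by rw [hord]; exact hn) h2 ht
    apply hbx
    rw [← hx']
    exact (zpowers_le.2 h1) this
  have hcomm : Commute x x' := by
    have h1 : x * x' * x⁻¹ * x'⁻¹ = 1 := by
      apply htriv
      · have : x * x' * x⁻¹ * x'⁻¹ = x * (x' * x * x'⁻¹)⁻¹ := by group
        rw [this]
        exact mul_mem (mem_zpowers x) (inv_mem (hMx x' hxM'))
      · exact mul_mem (hMx' x hxM) (inv_mem (mem_zpowers x'))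
    rw [mul_inv_eq_one, mul_inv_eq_iff_eq_mul] at h1
    exact h1
  obtain ⟨i, j, hij⟩ := hxM'
  obtain ⟨w, hw⟩ : ∃ w, w = a ^ i := ⟨_, rfl⟩
  have hwa : w ∈ zpowers a := ⟨i, hw.symm⟩
  have hwx' : w = x' * c ^ (-j) := by rw [hij, hw]; group
  have hwx : Commute w x := by
    rw [hwx']
    exact (hcomm.symm).mul_left (hcx.zpow_left _)
  have conjb : ∀ y z : X, Commute y z → Commute (b * y * b) (b * z * b) := by
    intro y z hyz
    change b * y * b * (b * z * b) = b * z * b * (b * y * b)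
    rw [← h.conj_b_mul, ← h.conj_b_mul, hyz.eq]
  have gen_comm : ∀ y ∈ zpowers a, ∀ z, Commute y z → Commute y (b * z * b) := by
    intro y hy z hyz
    have h1 := conjb y z hyz
    have h2 : y ∈ zpowers (b * y * b) := by
      have := h.b_conj_mem (g := b * y * b) ((zpowers_le.2 hy) (h.b_conj_mem hy))
      rwa [h.conj_b_b] at this
    obtain ⟨q, hq⟩ := h2
    simp only at hq
    rw [← hq, hq]
    rw [← hq]
    exact h1.zpow_left q
  have hwcx' : Commute w x' := by
    rw [hx']; exact gen_comm w hwa x hwx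
  have hcj : Commute x' (c ^ (-j)) := by
    have : c ^ (-j) = x'⁻¹ * w := by rw [hwx']; group
    rw [this]
    exact ((Commute.refl x').inv_right).mul_right hwcx'.symm
  have hwp : w ^ orderOf x = (c ^ (-j)) ^ orderOf x := by
    rw [hwx', hcj.mul_pow, ← hord, pow_orderOf_eq_one, one_mul]
  have hwp1 : w ^ orderOf x = 1 := by
    refine h.int' (pow_mem hwa _) ?_
    rw [hwp]
    exact pow_mem (zpow_mem (mem_zpowers c) _) _
  have hcjx : c ^ (-j) ∈ zpowers x :=
    cyc_mem hxc (zpow_mem (mem_zpowers c) _) (by rw [← hwp, hwp1])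
  have hw1 : w ≠ 1 := by
    intro e
    rw [e] at hwx'
    apply hbx
    rw [← hx']
    have : x' = (c ^ (-j))⁻¹ := eq_inv_of_mul_eq_one_left hwx'.symm
    rw [this]
    exact inv_mem hcjx
  have hwo : orderOf w = orderOf x := by
    have hd := orderOf_dvd_of_pow_eq_one hwp1
    rcases (Nat.dvd_prime hn).1 hd with e | e
    · exact absurd (orderOf_eq_one_iff.1 e) hw1
    · exact e
  have hax' : Commute a x' := by
    have haw : a * w * a⁻¹ = w := by rw [hw]; group
    have e1 : x'⁻¹ * (a * x' * a⁻¹) = c ^ (-j) * (a * c ^ (-j) * a⁻¹)⁻¹ := by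
      have e2 : (a * x' * a⁻¹) * (a * c ^ (-j) * a⁻¹) = x' * c ^ (-j) := by
        rw [← hwx']
        conv_rhs => rw [← haw, hwx']
        group
      rw [eq_mul_inv_iff_mul_eq, mul_assoc, e2]; group
    have e3 : x'⁻¹ * (a * x' * a⁻¹) = 1 := by
      apply htriv
      · rw [e1]
        obtain ⟨q, hq⟩ := hcjx
        simp only at hq
        rw [← hq]
        refine mul_mem ⟨q, rfl⟩ (inv_mem ?_)
        rw [← conj_zpow]; exact zpow_mem hxa q
      · exact mul_mem (inv_mem (mem_zpowers x')) (hMx' a h.a_mem)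
    rw [inv_mul_eq_one, eq_mul_inv_iff_mul_eq] at e3
    exact e3.symm
  have hax : Commute a x := by
    have := gen_comm a (mem_zpowers a) x' hax'
    rwa [hbx'] at this
  have hcx' : Commute c x' := by
    obtain ⟨s, v, hs⟩ := h.bc
    have h1 : Commute (b * c * b) x := by
      rw [hs]
      exact (hax.zpow_left s).mul_left (hcx.zpow_left v)
    have h2 := conjb _ _ h1
    rw [h.conj_b_b, ← hx'] at h2
    exact h2
  have hcw : Commute c w := by
    rw [hwx']
    exact hcx'.mul_right (Commute.self_zpow c _)
  refine ⟨w, hwa, by rw [hwo]; exact hn, h.normal_of_mem hwa ?_⟩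
  rw [hcw.eq]; simpa using hwa

end Cfg

/-- Data left over after the reduction. -/
structure Pkg {X : Type u} [Group X] (a b c w x : X) (k p : ℕ) : Prop where
  cfg : Cfg a b c
  hp : p.Prime
  wa : w ∈ zpowers a
  wo : orderOf w = p
  wn : (zpowers w).Normal
  xc : x ∈ zpowers c
  xd : x = c ^ (orderOf c / p)
  pd : p ∣ orderOf c
  xo : orderOf x = p
  wx : Commute w x
  gx : ∀ g, ∃ i j : ℤ, g * x * g⁻¹ = w ^ i * x ^ j
  ga : ∀ g, ∃ i j l : ℤ, g * a ^ k * g⁻¹ = (a ^ k) ^ i * w ^ j * x ^ l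
  xn : ¬ (zpowers x).Normal

theorem conj_commute {X : Type u} [Group X] {w y : X} (hw : (zpowers w).Normal)
    (h : Commute w y) (g : X) : Commute w (g * y * g⁻¹) := by
  obtain ⟨t, ht⟩ := hw.conj_mem w (mem_zpowers w) g⁻¹
  simp only [inv_inv] at ht
  have h1 : Commute (w ^ t) y := h.zpow_left t
  rw [ht] at h1
  have h2 : w = g * (g⁻¹ * w * g) * g⁻¹ := by group
  have h3 : Commute (g * (g⁻¹ * w * g) * g⁻¹) (g * y * g⁻¹) := by
    unfold Commute SemiconjBy at h1 ⊢
    calc _ = g * ((g⁻¹ * w * g) * y) * g⁻¹ := by group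
      _ = g * (y * (g⁻¹ * w * g)) * g⁻¹ := by rw [h1]
      _ = _ := by group
  rwa [← h2] at h3

theorem reduce {X : Type u} [Group X] [Finite X] {a b c w : X} {k p : ℕ} (h : Cfg a b c)
    (hcf : ∀ x ∈ zpowers c, (zpowers x).Normal → x = 1)
    (hp : p.Prime) (wa : w ∈ zpowers a) (wo : orderOf w = p) (wn : (zpowers w).Normal)
    (L : Subgroup X) (hL : L.Normal) (wL : w ∈ L)
    (eL : ∀ l ∈ L, ∃ i j : ℤ, l = w ^ i * c ^ j)
    (eT : ∀ g, ∃ i : ℤ, ∃ l ∈ L, g * a ^ k * g⁻¹ = (a ^ k) ^ i * l) :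
    c * a ^ k * c⁻¹ ∈ zpowers a ∨ ∃ x, Pkg a b c w x k p := by
  have key : ∀ l ∈ L, Commute w l → ∃ i j : ℤ, l = w ^ i * c ^ j ∧ c ^ j ∈ L ∧ Commute w (c ^ j) := by
    intro l hl hw
    obtain ⟨i, j, e⟩ := eL l hl
    have e2 : c ^ j = w ^ (-i) * l := by rw [e]; group
    refine ⟨i, j, e, ?_, ?_⟩
    · rw [e2]; exact mul_mem (zpow_mem wL _) hl
    · rw [e2]; exact (Commute.self_zpow w _).mul_right hw
  have wp : w ^ p = 1 := by rw [← wo]; exact pow_orderOf_eq_one w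
  have hY : ∀ y ∈ zpowers c, y ∈ L → Commute w y → y ^ p = 1 := by
    intro y yc yL yw
    apply hcf _ (pow_mem yc p)
    have hg : ∀ g, g * y ^ p * g⁻¹ ∈ zpowers (y ^ p) := by
      intro g
      obtain ⟨i, j, e, -, cw⟩ := key _ (hL.conj_mem y yL g) (conj_commute wn yw g)
      have e2 : g * y ^ p * g⁻¹ = (c ^ j) ^ p := by
        rw [← conj_pow, e, ((cw.zpow_left i)).mul_pow, ← zpow_natCast (w ^ i), zpow_comm,
          zpow_natCast, wp, one_zpow, one_mul]
      refine cyc_mem (pow_mem yc p) ?_ ?_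
      · rw [e2]; exact pow_mem (zpow_mem (mem_zpowers c) _) _
      · rw [conj_pow, pow_orderOf_eq_one]; group
    constructor
    rintro z ⟨q, rfl⟩ g
    simp only [← conj_zpow]
    exact zpow_mem (hg g) q
  have aw : Commute w (a ^ k) := by
    obtain ⟨i, rfl⟩ := wa
    exact ((Commute.refl a).zpow_left i).pow_right k
  have hA : ∀ g, ∃ i j l : ℤ, g * a ^ k * g⁻¹ = (a ^ k) ^ i * w ^ j * c ^ l ∧ c ^ l ∈ L ∧
      Commute w (c ^ l) := by
    intro g
    obtain ⟨i, l, lL, e⟩ := eT g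
    have h1 := conj_commute wn aw g
    have h2 : Commute w l := by
      have : l = (a ^ k) ^ (-i) * (g * a ^ k * g⁻¹) := by rw [e]; group
      rw [this]
      exact (aw.zpow_right _).mul_right h1
    obtain ⟨j, q, e3, e4, e5⟩ := key l lL h2
    exact ⟨i, j, q, by rw [e, e3, mul_assoc], e4, e5⟩
  by_cases hy : ∃ y ∈ zpowers c, y ∈ L ∧ Commute w y ∧ y ≠ 1
  · right
    obtain ⟨y, yc, yL, yw, y1⟩ := hy
    have yo : orderOf y = p := by
      have := hY y yc yL yw
      rcases (Nat.dvd_prime hp).1 (orderOf_dvd_of_pow_eq_one this) with h | h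
      · exact absurd (orderOf_eq_one_iff.1 h) y1
      · exact h
    have pd : p ∣ orderOf c := by rw [← yo]; exact orderOf_dvd_of_mem_zpowers yc
    obtain ⟨x, xd⟩ : ∃ x, x = c ^ (orderOf c / p) := ⟨_, rfl⟩
    have xo : orderOf x = p := by
      rw [xd]; exact orderOf_pow_orderOf_div (orderOf_pos c).ne' pd
    have xc : x ∈ zpowers c := by rw [xd]; exact pow_mem (mem_zpowers c) _
    have xp : x ^ p = 1 := by rw [← xo]; exact pow_orderOf_eq_one x
    obtain ⟨q, hq⟩ := cyc_mem_prime yc xc yo xp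
    simp only at hq
    have xL : x ∈ L := by rw [← hq]; exact zpow_mem yL _
    have xw : Commute w x := by rw [← hq]; exact yw.zpow_right _
    have inx : ∀ l : ℤ, c ^ l ∈ L → Commute w (c ^ l) → ∃ q : ℤ, x ^ q = c ^ l := by
      intro l h1 h2
      have h3 : c ^ l ∈ zpowers c := zpow_mem (mem_zpowers c) l
      exact cyc_mem_prime xc h3 xo (hY _ h3 h1 h2)
    refine ⟨x, h, hp, wa, wo, wn, xc, xd, pd, xo, xw, ?_, ?_, ?_⟩
    · intro g
      obtain ⟨i, j, e, h1, h2⟩ := key _ (hL.conj_mem x xL g) (conj_commute wn xw g)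
      obtain ⟨q, hq⟩ := inx j h1 h2
      exact ⟨i, q, by rw [e, hq]⟩
    · intro g
      obtain ⟨i, j, l, e, h1, h2⟩ := hA g
      obtain ⟨q, hq⟩ := inx l h1 h2
      exact ⟨i, j, q, by rw [e, hq]⟩
    · intro hn
      have := hcf x xc hn
      rw [this, orderOf_one] at xo
      rw [← xo] at hp; exact Nat.not_prime_one hp
  · left
    obtain ⟨i, j, l, e, h1, h2⟩ := hA c
    have : c ^ l = 1 := by
      by_contra h3
      exact hy ⟨c ^ l, zpow_mem (mem_zpowers c) l, h1, h2, h3⟩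
    rw [e, this, mul_one]
    exact mul_mem (zpow_mem (pow_mem (mem_zpowers a) k) _) (zpow_mem wa _)

namespace Pkg

variable {X : Type u} [Group X] {a b c w x : X} {k p : ℕ}

theorem x1 (h : Pkg a b c w x k p) : x ≠ 1 := by
  rintro rfl
  have := h.xo
  rw [orderOf_one] at this
  exact Nat.not_prime_one (this ▸ h.hp)

theorem w1 (h : Pkg a b c w x k p) : w ≠ 1 := by
  rintro rfl
  have := h.wo
  rw [orderOf_one] at this
  exact Nat.not_prime_one (this ▸ h.hp)

theorem xa (h : Pkg a b c w x k p) : x ∉ zpowers a := fun hx => h.x1 (h.cfg.int' hx h.xc)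

theorem xp (h : Pkg a b c w x k p) : x ^ p = 1 := by rw [← h.xo]; exact pow_orderOf_eq_one x
theorem wp (h : Pkg a b c w x k p) : w ^ p = 1 := by rw [← h.wo]; exact pow_orderOf_eq_one w

theorem aw (h : Pkg a b c w x k p) : Commute w a := by
  obtain ⟨i, rfl⟩ := h.wa
  exact (Commute.refl a).zpow_left i

theorem cx (h : Pkg a b c w x k p) : Commute c x := by
  obtain ⟨i, rfl⟩ := h.xc
  exact (Commute.refl c).zpow_right i

theorem x2cases (h : Pkg a b c w x k 2) (j : ℤ) : x ^ j = 1 ∨ x ^ j = x := by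
  have hx : x ^ (2 : ℤ) = 1 := by have := h.xp; exact_mod_cast this
  rcases Int.even_or_odd' j with ⟨q, rfl | rfl⟩
  · left; rw [zpow_mul, hx, one_zpow]
  · right; rw [zpow_add, zpow_mul, hx, one_zpow]; simp

/-- conjugates of `x` have non-trivial `x`-component -/
theorem gx' (h : Pkg a b c w x k p) (g : X) : ∃ i j : ℤ, g * x * g⁻¹ = w ^ i * x ^ j ∧ x ^ j ≠ 1 := by
  obtain ⟨i, j, e⟩ := h.gx g
  refine ⟨i, j, e, fun hj => ?_⟩
  rw [hj, mul_one] at e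
  have h1 : g⁻¹ * w ^ i * g⁻¹⁻¹ ∈ zpowers w := h.wn.conj_mem _ ⟨i, rfl⟩ g⁻¹
  have h2 : x = g⁻¹ * w ^ i * g⁻¹⁻¹ := by rw [← e]; group
  rw [← h2] at h1
  exact h.xa ((zpowers_le.2 h.wa) h1)

theorem gx2 (h : Pkg a b c w x k 2) (g : X) : ∃ i : ℤ, g * x * g⁻¹ = w ^ i * x := by
  obtain ⟨i, j, e, hj⟩ := h.gx' g
  rcases h.x2cases j with h1 | h1
  · exact absurd h1 hj
  · exact ⟨i, by rw [e, h1]⟩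

theorem a2x (h : Pkg a b c w x k 2) : Commute (a ^ 2) x := by
  obtain ⟨i, e⟩ := h.gx2 a
  have hw : w ^ (2 : ℤ) = 1 := by have := h.wp; exact_mod_cast this
  have h1 : a ^ 2 * x * (a ^ 2)⁻¹ = x := by
    calc a ^ 2 * x * (a ^ 2)⁻¹ = a * (a * x * a⁻¹) * a⁻¹ := by rw [pow_two]; group
      _ = a * w ^ i * x * a⁻¹ := by rw [e]; group
      _ = w ^ i * (a * x * a⁻¹) := by rw [← (h.aw.zpow_left i).eq]; group
      _ = (w ^ (2 : ℤ)) ^ i * x := by rw [e]; group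
      _ = x := by rw [hw]; simp
  exact mul_inv_eq_iff_eq_mul.1 h1

theorem caseSD2 (h : Pkg a b c w x 2 2) : c * a ^ 4 * c⁻¹ ∈ zpowers a := by
  obtain ⟨i, j, l, e⟩ := h.ga c
  have hx : (x ^ l) ^ 2 = 1 := by
    rcases h.x2cases l with h1 | h1
    · rw [h1, one_pow]
    · rw [h1]; exact h.xp
  have hu : Commute ((a ^ 2) ^ i * w ^ j) (x ^ l) :=
    ((h.a2x.zpow_left i).mul_left (h.wx.zpow_left j)).zpow_right l
  have e4 : c * a ^ 4 * c⁻¹ = ((a ^ 2) ^ i * w ^ j) ^ 2 := by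
    calc c * a ^ 4 * c⁻¹ = (c * a ^ 2 * c⁻¹) ^ 2 := by rw [conj_pow, ← pow_mul]
      _ = _ := by rw [e, hu.mul_pow, hx, mul_one]
  rw [e4]
  exact pow_mem (mul_mem (zpow_mem (pow_mem (mem_zpowers a) 2) _) (zpow_mem h.wa _)) 2

theorem odd_aux [Finite X] (h : Pkg a b c w x k 2) {β : X} {s v : ℤ} (hβ : β * β = 1)
    (hβa : β * a * β = a⁻¹) (hβc : β * c * β = a ^ s * c ^ v) (hβx : β * x * β ≠ x) :
    Odd (orderOf (c ^ (v - 1))) := by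
  by_contra ho
  rw [Nat.not_odd_iff_even, even_iff_two_dvd] at ho
  have hβi : β = β⁻¹ := (inv_eq_of_mul_eq_one_left hβ).symm
  have cz : ∀ (y : X) (n : ℤ), β * y ^ n * β = (β * y * β) ^ n := by
    intro y n
    have h1 : ∀ y : X, β * y * β = β * y * β⁻¹ := fun y => by rw [← hβi]
    rw [h1, h1, conj_zpow]
  have e1 : (β * c * β) ^ v = a ^ s * c := by
    have : a ^ s * (β * (β * c * β) * β) = a ^ s * (β * (a ^ s * c ^ v) * β) := by rw [hβc]
    have h2 : β * (β * c * β) * β = (β * β) * c * (β * β) := by group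
    have h3 : β * (a ^ s * c ^ v) * β = (β * a ^ s * β) * (β * c ^ v * β) := by
      calc β * (a ^ s * c ^ v) * β = β * a ^ s * 1 * c ^ v * β := by group
        _ = β * a ^ s * (β * β) * c ^ v * β := by rw [hβ]
        _ = _ := by group
    rw [h2, hβ, h3, cz, cz, hβa] at this
    simp only [one_mul, mul_one] at this
    rw [this]; group
  have e2 : β * c ^ (v - 1) * β = (c ^ (v - 1))⁻¹ := by
    rw [cz]
    calc (β * c * β) ^ (v - 1) = (β * c * β)⁻¹ * (β * c * β) ^ v := by
          rw [← zpow_neg_one, ← zpow_add]; congr 1; ring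
      _ = (a ^ s * c ^ v)⁻¹ * (a ^ s * c) := by rw [e1, hβc]
      _ = _ := by group
  have hx : x ∈ zpowers (c ^ (v - 1)) := by
    refine cyc_mem (zpow_mem (mem_zpowers c) _) h.xc ?_
    obtain ⟨q, hq⟩ := ho
    rw [hq, pow_mul, h.xp, one_pow]
  obtain ⟨q, hq⟩ := hx
  simp only at hq
  apply hβx
  have hxi : x⁻¹ = x := inv_eq_of_mul_eq_one_left (by rw [← pow_two]; exact h.xp)
  calc β * x * β = β * (c ^ (v - 1)) ^ q * β := by rw [hq]
    _ = ((c ^ (v - 1)) ^ q)⁻¹ := by rw [cz, e2, inv_zpow]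
    _ = x := by rw [hq, hxi]

theorem caseD2_aux [Finite X] (h : Pkg a b c w x 2 2) {β : X} (hβ : β * β = 1)
    (hβa : β * a * β = a⁻¹) (hβc : β * c * β ∈ h.cfg.M) (hβx : β * x * β ≠ x) :
    c * a ^ 2 * c⁻¹ ∈ zpowers a := by
  have hβi : β⁻¹ = β := (inv_eq_of_mul_eq_one_left hβ)
  obtain ⟨s, v, e⟩ := hβc
  have o1 := h.odd_aux hβ hβa e hβx
  have hM : a ^ (-2 : ℤ) * (β * c * β) * a ^ (2 : ℤ) ∈ h.cfg.M := by
    refine mul_mem (mul_mem (zpow_mem h.cfg.a_mem _) ?_) (zpow_mem h.cfg.a_mem _)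
    exact ⟨s, v, e⟩
  have cz : ∀ (y : X) (n : ℤ), β * y ^ n * β = (β * y * β) ^ n := by
    intro y n
    have h1 : ∀ y : X, β * y * β = β * y * β⁻¹ := fun y => by rw [hβi]
    rw [h1, h1, conj_zpow]
  have sw : β * a ^ (2 : ℤ) = a ^ (-2 : ℤ) * β := by
    have := cz a 2
    rw [hβa] at this
    calc β * a ^ (2 : ℤ) = β * a ^ (2 : ℤ) * (β * β) := by rw [hβ, mul_one]
      _ = (β * a ^ (2 : ℤ) * β) * β := by group
      _ = _ := by rw [this]; group
  obtain ⟨s', v', e'⟩ := hM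
  have o2 : Odd (orderOf (c ^ (v' - 1))) := by
    refine h.odd_aux (β := β * a ^ (2 : ℤ)) (s := s') ?_ ?_ ?_ ?_
    · nth_rewrite 1 [sw]
      calc a ^ (-2 : ℤ) * β * (β * a ^ (2 : ℤ)) = a ^ (-2 : ℤ) * (β * β) * a ^ (2 : ℤ) := by group
        _ = 1 := by rw [hβ]; group
    · nth_rewrite 1 [sw]
      calc a ^ (-2 : ℤ) * β * a * (β * a ^ (2 : ℤ))
          = a ^ (-2 : ℤ) * (β * a * β) * a ^ (2 : ℤ) := by group
        _ = a⁻¹ := by rw [hβa]; group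
    · rw [← e']
      nth_rewrite 1 [sw]
      group
    · intro hx
      apply hβx
      nth_rewrite 1 [sw] at hx
      have h1 : β * x * β = a ^ 2 * (a ^ (-2 : ℤ) * β * x * (β * a ^ (2 : ℤ))) * (a ^ 2)⁻¹ := by
        group
      rw [h1, hx, h.a2x.eq]; group
  obtain ⟨i, j, l, ed⟩ := h.ga (β * c * β)
  have hxl : x ^ l = 1 := by
    rcases h.x2cases l with hx | hx
    · exact hx
    exfalso
    rw [hx] at ed
    obtain ⟨f, ef⟩ := h.gx2 (a ^ (-s))
    obtain ⟨wi, hw⟩ := h.wa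
    simp only at hw
    obtain ⟨q, hq⟩ := h.xc
    simp only at hq
    have e3 : a ^ s' * c ^ v' = a ^ (-2 + (2 * i + wi * j + s + wi * f)) * c ^ (q + v) := by
      calc a ^ s' * c ^ v' = a ^ (-2 : ℤ) * (β * c * β) * a ^ (2 : ℤ) := e'.symm
        _ = a ^ (-2 : ℤ) * ((β * c * β) * a ^ 2 * (β * c * β)⁻¹) * (β * c * β) := by group
        _ = a ^ (-2 : ℤ) * ((a ^ 2) ^ i * w ^ j * x) * (a ^ s * c ^ v) := by rw [ed, e]
        _ = a ^ (-2 : ℤ) * (a ^ 2) ^ i * w ^ j * a ^ s * (a ^ (-s) * x * (a ^ (-s))⁻¹) * c ^ v := by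
            group
        _ = a ^ (-2 : ℤ) * (a ^ 2) ^ i * (a ^ wi) ^ j * a ^ s * ((a ^ wi) ^ f * c ^ q) * c ^ v := by
            rw [ef, hw, hq]
        _ = a ^ (-2 : ℤ) * a ^ (2 * i) * a ^ (wi * j) * a ^ s * (a ^ (wi * f) * c ^ q) * c ^ v := by
            rw [zpow_mul a wi, zpow_mul a wi, zpow_mul a 2]; norm_cast
        _ = _ := by simp only [zpow_add]; group
    have e4 := (h.cfg.uniq e3).2
    have e5 : x = c ^ (v' - 1) * (c ^ (v - 1))⁻¹ := by
      rw [← hq]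
      calc c ^ q = c ^ (q + v) * c ^ (-v) := by group
        _ = c ^ v' * c ^ (-v) := by rw [e4]
        _ = _ := by group
    have e6 : x ^ (orderOf (c ^ (v' - 1)) * orderOf (c ^ (v - 1))) = 1 := by
      have cc : Commute (c ^ (v' - 1)) (c ^ (v - 1))⁻¹ :=
        (((Commute.refl c).zpow_left _).zpow_right _).inv_right
      rw [e5, cc.mul_pow, pow_mul, pow_orderOf_eq_one, one_pow, mul_comm (orderOf _), pow_mul,
        inv_pow, pow_orderOf_eq_one]; simp
    have h7 := orderOf_dvd_of_pow_eq_one e6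
    rw [h.xo, ← even_iff_two_dvd] at h7
    exact (Nat.not_even_iff_odd.2 (o2.mul o1)) h7
  rw [hxl, mul_one] at ed
  have hmem : (β * c * β) * a ^ 2 * (β * c * β)⁻¹ ∈ zpowers a := by
    rw [ed]
    exact mul_mem (zpow_mem (pow_mem (mem_zpowers a) 2) _) (zpow_mem h.wa _)
  obtain ⟨q, hq⟩ := hmem
  simp only at hq
  have e8 : c * a ^ 2 * c⁻¹ = a ^ q := by
    have h1 : (β * c * β) * a ^ 2 * (β * c * β)⁻¹ = β * (c * (a ^ 2)⁻¹ * c⁻¹) * β := by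
      have h0 : (β * c * β)⁻¹ = β * c⁻¹ * β := by simp [mul_inv_rev, hβi, mul_assoc]
      have h2 := cz a 2
      rw [hβa] at h2
      rw [h0]
      calc β * c * β * a ^ 2 * (β * c⁻¹ * β) = β * c * (β * a ^ (2 : ℤ) * β) * c⁻¹ * β := by group
        _ = _ := by rw [h2]; group
    rw [h1] at hq
    have h3 : β * a ^ q * β = c * (a ^ 2)⁻¹ * c⁻¹ := by
      rw [hq]
      calc β * (β * (c * (a ^ 2)⁻¹ * c⁻¹) * β) * β
          = (β * β) * (c * (a ^ 2)⁻¹ * c⁻¹) * (β * β) := by group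
        _ = _ := by rw [hβ]; group
    rw [cz, hβa] at h3
    calc c * a ^ 2 * c⁻¹ = (c * (a ^ 2)⁻¹ * c⁻¹)⁻¹ := by group
      _ = _ := by rw [← h3]; group
  rw [e8]
  exact ⟨q, rfl⟩

theorem caseD2 [Finite X] (h : Pkg a b c w x 2 2) (hb : b * a * b = a⁻¹) :
    c * a ^ 2 * c⁻¹ ∈ zpowers a := by
  by_cases h1 : b * x * b = x
  · by_cases h2 : b * a * x * (b * a) = x
    · exfalso
      have e1 : a * x * a⁻¹ = x := by
        have e0 : a * b = b * a⁻¹ := by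
          calc a * b = (b * b) * a * b := by rw [h.cfg.bb, one_mul]
            _ = b * (b * a * b) := by group
            _ = _ := by rw [hb]
        have : b * a * x * (b * a) = b * (a * x * a⁻¹) * b := by
          have e9 : b * a = a⁻¹ * b := by
            calc b * a = (b * a) * (b * b) := by rw [h.cfg.bb, mul_one]
              _ = (b * a * b) * b := by group
              _ = _ := by rw [hb]
          nth_rewrite 2 [e9]
          group
        rw [this] at h2
        rw [← h.cfg.conj_b_b (a * x * a⁻¹), h2, h1]
      apply h.xn
      apply h.cfg.normal_zpowers
      · rw [e1]; exact mem_zpowers x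
      · rw [h1]; exact mem_zpowers x
      · rw [h.cx.eq]; simp
    · refine h.caseD2_aux (β := b * a) ?_ ?_ ?_ h2
      · calc b * a * (b * a) = (b * a * b) * a := by group
          _ = 1 := by rw [hb]; group
      · calc b * a * a * (b * a) = (b * a * 1 * a * b) * a := by group
          _ = (b * a * (b * b) * a * b) * a := by rw [h.cfg.bb]
          _ = (b * a * b) * (b * a * b) * a := by group
          _ = _ := by rw [hb]; group
      · have : b * a * c * (b * a) = (b * (a * c) * b) * a := by group
        rw [this]
        exact mul_mem (h.cfg.b_M (mul_mem h.cfg.a_mem h.cfg.c_mem)) h.cfg.a_mem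
  · exact h.caseD2_aux h.cfg.bb hb (h.cfg.b_M h.cfg.c_mem) h1

end Pkg

/-- An action on an elementary abelian group of order `p ^ 2` with an invariant line. -/
structure Act {Q : Type u} [Group Q] (A x : Q) (p : ℕ) : Prop where
  comm : Commute A x
  Ap : A ^ p = 1
  xp : x ^ p = 1
  ind : ∀ i j : ℤ, A ^ i * x ^ j = 1 → (p : ℤ) ∣ i ∧ (p : ℤ) ∣ j
  gA : ∀ g : Q, ∃ i j : ℤ, g * A * g⁻¹ = A ^ i * x ^ j
  gx : ∀ g : Q, ∃ j : ℤ, g * x * g⁻¹ = x ^ j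

namespace Act

variable {Q : Type u} [Group Q] {A x : Q} {p : ℕ}

theorem uniq (h : Act A x p) {i j k l : ℤ} (e : A ^ i * x ^ j = A ^ k * x ^ l) :
    (i : ZMod p) = k ∧ (j : ZMod p) = l := by
  have h1 : A ^ (i - k) * x ^ (j - l) = 1 := by
    calc A ^ (i - k) * x ^ (j - l) = A ^ (-k) * (A ^ i * x ^ j) * x ^ (-l) := by group
      _ = 1 := by rw [e]; group
  obtain ⟨h2, h3⟩ := h.ind _ _ h1
  constructor
  · have := (ZMod.intCast_zmod_eq_zero_iff_dvd (i - k) p).2 h2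
    push_cast at this; exact sub_eq_zero.1 this
  · have := (ZMod.intCast_zmod_eq_zero_iff_dvd (j - l) p).2 h3
    push_cast at this; exact sub_eq_zero.1 this

theorem uniqx (h : Act A x p) {j l : ℤ} (e : x ^ j = x ^ l) : (j : ZMod p) = l := by
  have : A ^ (0 : ℤ) * x ^ j = A ^ (0 : ℤ) * x ^ l := by rw [e]
  exact (h.uniq this).2

noncomputable def α (h : Act A x p) (g : Q) : ZMod p := ((h.gA g).choose : ZMod p)
noncomputable def β (h : Act A x p) (g : Q) : ZMod p := ((h.gA g).choose_spec.choose : ZMod p)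
noncomputable def γ (h : Act A x p) (g : Q) : ZMod p := ((h.gx g).choose : ZMod p)

theorem αβ (h : Act A x p) {g : Q} {i j : ℤ} (e : g * A * g⁻¹ = A ^ i * x ^ j) :
    h.α g = i ∧ h.β g = j := by
  have := (h.gA g).choose_spec.choose_spec
  have h2 := h.uniq (e.symm.trans this)
  exact ⟨h2.1.symm, h2.2.symm⟩

theorem γe (h : Act A x p) {g : Q} {j : ℤ} (e : g * x * g⁻¹ = x ^ j) : h.γ g = j := by
  have := (h.gx g).choose_spec
  exact (h.uniqx (e.symm.trans this)).symm

theorem mul_formula (h : Act A x p) (g k : Q) :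
    h.α (g * k) = h.α g * h.α k ∧ h.γ (g * k) = h.γ g * h.γ k ∧
      h.β (g * k) = h.β g * h.α k + h.γ g * h.β k := by
  obtain ⟨i, j, e⟩ := h.gA g
  obtain ⟨i', j', e'⟩ := h.gA k
  obtain ⟨l, el⟩ := h.gx g
  obtain ⟨l', el'⟩ := h.gx k
  have e1 : g * k * A * (g * k)⁻¹ = A ^ (i * i') * x ^ (j * i' + l * j') := by
    calc g * k * A * (g * k)⁻¹ = g * (k * A * k⁻¹) * g⁻¹ := by group
      _ = (g * A ^ i' * g⁻¹) * (g * x ^ j' * g⁻¹) := by rw [e']; group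
      _ = (A ^ i * x ^ j) ^ i' * (x ^ l) ^ j' := by rw [← conj_zpow, ← conj_zpow, e, el]
      _ = A ^ (i * i') * x ^ (j * i') * x ^ (l * j') := by
          rw [((h.comm.zpow_left i).zpow_right j).mul_zpow, zpow_mul, zpow_mul, zpow_mul]
      _ = _ := by rw [mul_assoc, ← zpow_add]
  have e2 : g * k * x * (g * k)⁻¹ = x ^ (l * l') := by
    calc g * k * x * (g * k)⁻¹ = g * (k * x * k⁻¹) * g⁻¹ := by group
      _ = (g * x * g⁻¹) ^ l' := by rw [el', conj_zpow]
      _ = _ := by rw [el, zpow_mul]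
  have f1 := h.αβ e
  have f2 := h.αβ e'
  have f3 := h.αβ e1
  have f4 := h.γe el
  have f5 := h.γe el'
  have f6 := h.γe e2
  rw [f1.1, f1.2, f2.1, f2.2, f3.1, f3.2, f4, f5, f6]
  push_cast
  exact ⟨rfl, rfl, rfl⟩

theorem αm (h : Act A x p) (g k : Q) : h.α (g * k) = h.α g * h.α k := (h.mul_formula g k).1
theorem γm (h : Act A x p) (g k : Q) : h.γ (g * k) = h.γ g * h.γ k := (h.mul_formula g k).2.1
theorem βm (h : Act A x p) (g k : Q) :
    h.β (g * k) = h.β g * h.α k + h.γ g * h.β k := (h.mul_formula g k).2.2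

theorem αβ_comm (h : Act A x p) {g : Q} (e : Commute g A) : h.α g = 1 ∧ h.β g = 0 := by
  have := h.αβ (g := g) (i := 1) (j := 0) (by rw [e.eq]; simp)
  simpa using this

theorem γ_comm (h : Act A x p) {g : Q} (e : Commute g x) : h.γ g = 1 := by
  have := h.γe (g := g) (j := 1) (by rw [e.eq]; simp)
  simpa using this

theorem α1 (h : Act A x p) : h.α 1 = 1 := (h.αβ_comm (Commute.one_left A)).1
theorem β1 (h : Act A x p) : h.β 1 = 0 := (h.αβ_comm (Commute.one_left A)).2
theorem γ1 (h : Act A x p) : h.γ 1 = 1 := h.γ_comm (Commute.one_left x)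

theorem γ_ne [Fact p.Prime] (h : Act A x p) (g : Q) : h.γ g ≠ 0 := by
  intro hg
  have := h.γm g g⁻¹
  rw [mul_inv_cancel, h.γ1, hg, zero_mul] at this
  exact one_ne_zero this

/-- powers of an element acting unipotently -/
theorem pow_formula (h : Act A x p) (g : Q) (ha : h.α g = 1) (hg : h.γ g = 1) (n : ℤ) :
    h.α (g ^ n) = 1 ∧ h.γ (g ^ n) = 1 ∧ h.β (g ^ n) = n * h.β g := by
  induction n using Int.induction_on with
  | zero => simp [h.α1, h.γ1, h.β1]
  | succ k ih =>
    obtain ⟨h1, h2, h3⟩ := ih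
    rw [zpow_add_one, h.αm, h.γm, h.βm, h1, h2, h3, ha, hg]
    refine ⟨by ring, by ring, ?_⟩
    push_cast; ring
  | pred k ih =>
    obtain ⟨h1, h2, h3⟩ := ih
    have e : g ^ (-(k : ℤ)) = g ^ (-(k : ℤ) - 1) * g := by
      rw [← zpow_add_one]; congr 1; ring
    have k1 := h.αm (g ^ (-(k : ℤ) - 1)) g
    have k2 := h.γm (g ^ (-(k : ℤ) - 1)) g
    have k3 := h.βm (g ^ (-(k : ℤ) - 1)) g
    rw [← e] at k1 k2 k3
    rw [h1, ha, mul_one] at k1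
    rw [h2, hg, mul_one] at k2
    rw [h3, ha, ← k2] at k3
    refine ⟨k1.symm, k2.symm, ?_⟩
    push_cast at k3 ⊢
    linear_combination -k3

/-- Case `α c ≠ 1`. -/
theorem case3 [Fact p.Prime] (h : Act A x p) {a b c : Q} (hA : Commute a A)
    (hb : h.α b = -1) (hb0 : h.β b = 0) (hcx : Commute c x) (hc : h.α c ≠ 1) (hcb : h.β c ≠ 0)
    {e f s v : ℤ} (hca : c * a = a ^ e * c ^ f) (hbc : b * c = a ^ s * c ^ v * b) :
    h.γ a = 1 ∧ h.γ b = -1 := by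
  have hae : ∀ n : ℤ, h.α (a ^ n) = 1 ∧ h.β (a ^ n) = 0 := fun n => h.αβ_comm (hA.zpow_left n)
  have hcn : ∀ n : ℤ, h.γ (c ^ n) = 1 := fun n => h.γ_comm (hcx.zpow_left n)
  have gc : h.γ c = 1 := h.γ_comm hcx
  have ha := h.αβ_comm hA
  have key : ∀ n : ℤ, h.α (c ^ n) = h.α c → h.β (c ^ n) = h.β c := by
    intro n hn
    have e1 : h.β (c * c ^ n) = h.β (c ^ n * c) := by rw [((Commute.refl c).zpow_right n).eq]
    rw [h.βm, h.βm, gc, hcn, hn] at e1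
    have e2 : (h.α c - 1) * (h.β (c ^ n) - h.β c) = 0 := by linear_combination -e1
    rcases mul_eq_zero.1 e2 with h1 | h1
    · exact absurd (sub_eq_zero.1 h1) hc
    · exact sub_eq_zero.1 h1
  constructor
  · have c1 : h.α (c * a) = h.α (a ^ e * c ^ f) := by rw [hca]
    have c2 : h.γ (c * a) = h.γ (a ^ e * c ^ f) := by rw [hca]
    have c3 : h.β (c * a) = h.β (a ^ e * c ^ f) := by rw [hca]
    rw [h.αm, h.αm, ha.1, (hae e).1, mul_one, one_mul] at c1
    rw [h.γm, h.γm, gc, hcn, mul_one, one_mul] at c2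
    rw [h.βm, h.βm, ha.1, ha.2, (hae e).2, ← c2, key f c1.symm] at c3
    have e2 : (h.γ a - 1) * h.β c = 0 := by linear_combination -c3
    rcases mul_eq_zero.1 e2 with h1 | h1
    · exact sub_eq_zero.1 h1
    · exact absurd h1 hcb
  · have c1 : h.α (b * c) = h.α (a ^ s * c ^ v * b) := by rw [hbc]
    have c2 : h.γ (b * c) = h.γ (a ^ s * c ^ v * b) := by rw [hbc]
    have c3 : h.β (b * c) = h.β (a ^ s * c ^ v * b) := by rw [hbc]
    rw [h.αm, h.αm, h.αm, (hae s).1, hb] at c1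
    rw [h.γm, h.γm, h.γm, gc, hcn, mul_one, mul_one] at c2
    have c4 : h.γ (a ^ s) = 1 := by
      have := h.γ_ne b
      field_simp at c2
      exact c2.symm
    have c5 : h.α (c ^ v) = h.α c := by linear_combination c1
    rw [h.βm, h.βm, h.βm, h.γm, hcn, (hae s).2, c4, hb0, hb, key v c5] at c3
    have e2 : (h.γ b + 1) * h.β c = 0 := by linear_combination c3
    rcases mul_eq_zero.1 e2 with h1 | h1
    · exact eq_neg_of_add_eq_zero_left h1
    · exact absurd h1 hcb

theorem pow_prod (h : Act A x p) {g : Q} {z u l : ℤ} (hg : g * A * g⁻¹ = A * x ^ z)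
    (hx : Commute g x) (N : ℕ) : ∃ f : ℤ, 2 * f = 2 * N * l + z * u * (N * (N - 1)) ∧
      (A ^ u * x ^ l * g) ^ N = A ^ (N * u) * x ^ f * g ^ N := by
  induction N with
  | zero => exact ⟨0, by simp, by simp⟩
  | succ N ih =>
    obtain ⟨f, h1, h2⟩ := ih
    refine ⟨f + l + z * u * N, ?_, ?_⟩
    · push_cast; linear_combination h1
    · rw [pow_succ', h2]
      have e1 : g * A ^ (N * u) = A ^ (N * u) * x ^ (z * (N * u)) * g := by
        have : g * A ^ (N * u) * g⁻¹ = A ^ (N * u) * x ^ (z * (N * u)) := by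
          rw [← conj_zpow, hg, (h.comm.zpow_right z).mul_zpow, zpow_mul x]
        rw [← this]; group
      calc A ^ u * x ^ l * g * (A ^ (N * u) * x ^ f * g ^ N)
          = A ^ u * x ^ l * (g * A ^ (N * u)) * x ^ f * g ^ N := by group
        _ = A ^ u * (x ^ l * A ^ (N * u)) * x ^ (z * (N * u)) * (g * x ^ f) * g ^ N := by
            rw [e1]; group
        _ = A ^ u * (A ^ (N * u) * x ^ l) * x ^ (z * (N * u)) * (x ^ f * g) * g ^ N := by
            rw [(hx.zpow_right f).eq, ((h.comm.zpow_left (N * u)).zpow_right l).eq]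
        _ = (A ^ u * A ^ (N * u)) * (x ^ l * x ^ (z * (N * u)) * x ^ f) * (g * g ^ N) := by group
        _ = _ := by
            rw [← zpow_add, ← zpow_add, ← zpow_add, ← pow_succ']
            have i1 : u + N * u = ((N + 1 : ℕ) : ℤ) * u := by push_cast; ring
            have i2 : l + z * (N * u) + f = f + l + z * u * N := by ring
            rw [i1, i2]

/-- Case `α c = 1`. -/
theorem case4 [Fact p.Prime] (hp2 : p ≠ 2) (h : Act A x p) {b e : Q} {n : ℕ} {i j q : ℤ}
    (hb : h.α b = -1) (hex : Commute e x) (he : h.α e = 1) (heb : h.β e ≠ 0)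
    (hn : p ∣ n) (hx : x = e ^ n) (hbe : b * e * b⁻¹ = A ^ i * x ^ j * e ^ q) : False := by
  have he3 : h.γ e = 1 := h.γ_comm hex
  obtain ⟨k1, k2, k3⟩ := h.pow_formula e he he3 q
  have hA : Commute (A ^ i * x ^ j) A :=
    ((Commute.refl A).zpow_left i).mul_left (h.comm.symm.zpow_left j)
  have hX : Commute (A ^ i * x ^ j) x :=
    (h.comm.zpow_left i).mul_left ((Commute.refl x).zpow_left j)
  have s1 := h.αβ_comm hA
  have s2 := h.γ_comm hX
  have hbe' : b * e = A ^ i * x ^ j * e ^ q * b := by rw [← hbe]; group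
  have c3 : h.β (b * e) = h.β (A ^ i * x ^ j * e ^ q * b) := by rw [hbe']
  rw [h.βm, h.βm, h.βm (A ^ i * x ^ j), h.γm (A ^ i * x ^ j), s1.2, s2, k1, k2, k3, he, hb] at c3
  have g1 : h.γ b = -q := by
    have e2 : (h.γ b + q) * h.β e = 0 := by linear_combination c3
    rcases mul_eq_zero.1 e2 with h1 | h1
    · exact eq_neg_of_add_eq_zero_left h1
    · exact absurd h1 heb
  -- now the n-th power
  obtain ⟨z1, z, ez⟩ := h.gA (e ^ q)
  have hz := h.αβ ez
  have hpp : p.Prime := Fact.out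
  have ez' : e ^ q * A * (e ^ q)⁻¹ = A * x ^ z := by
    have h1 : ((z1 - 1 : ℤ) : ZMod p) = 0 := by
      push_cast; rw [← hz.1, k1, sub_self]
    obtain ⟨t, ht⟩ := (ZMod.intCast_zmod_eq_zero_iff_dvd _ p).1 h1
    have h2 : z1 = 1 + p * t := by linarith
    rw [ez, h2, zpow_add, zpow_mul, zpow_natCast, h.Ap, one_zpow]; simp
  obtain ⟨f, f1, f2⟩ := h.pow_prod (u := i) (l := j) ez' (hex.zpow_left q) n
  have hpf : (p : ℤ) ∣ f := by
    obtain ⟨t, rfl⟩ := hn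
    have : (p : ℤ) ∣ 2 * f := by
      rw [f1]
      refine ⟨2 * t * j + z * i * (t * ((p * t : ℕ) - 1)), ?_⟩
      push_cast; ring
    have hcop : IsCoprime (p : ℤ) 2 := by
      have : Nat.Coprime p 2 := (Nat.coprime_primes hpp Nat.prime_two).2 hp2
      exact_mod_cast Nat.isCoprime_iff_coprime.2 this
    exact hcop.dvd_of_dvd_mul_left this
  have e5 : b * x * b⁻¹ = x ^ q := by
    have : b * x * b⁻¹ = (b * e * b⁻¹) ^ n := by rw [conj_pow, ← hx]
    rw [this, hbe, f2]
    obtain ⟨t, rfl⟩ := hn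
    obtain ⟨r, rfl⟩ := hpf
    have a1 : A ^ (((p * t : ℕ) : ℤ) * i) = 1 := by
      push_cast
      rw [mul_assoc, zpow_mul, zpow_natCast, h.Ap, one_zpow]
    rw [a1, zpow_mul, zpow_natCast x, h.xp, one_zpow, one_mul, one_mul]
    rw [← zpow_natCast (e ^ q), ← zpow_mul, mul_comm q, zpow_mul, zpow_natCast e, ← hx]
  have g2 := h.γe e5
  have h2 : (2 : ZMod p) * h.γ b = 0 := by linear_combination g1 + g2
  rcases mul_eq_zero.1 h2 with h3 | h3
  · have : ((2 : ℕ) : ZMod p) = 0 := by exact_mod_cast h3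
    rw [ZMod.natCast_eq_zero_iff] at this
    exact hp2 ((Nat.prime_dvd_prime_iff_eq hpp Nat.prime_two).1 this)
  · exact h.γ_ne b h3

end Act

/-- the subgroup `⟨y⟩⟨t⟩` -/
def prodSub {X : Type u} [Group X] (y t : X)
    (hc : ∀ i j : ℤ, ∃ k l : ℤ, t ^ i * y ^ j = y ^ k * t ^ l) : Subgroup X where
  carrier := {x | ∃ i j : ℤ, x = y ^ i * t ^ j}
  one_mem' := ⟨0, 0, by simp⟩
  mul_mem' := by
    rintro x z ⟨i, j, rfl⟩ ⟨k, l, rfl⟩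
    obtain ⟨s, r, e⟩ := hc j k
    refine ⟨i + s, r + l, ?_⟩
    calc y ^ i * t ^ j * (y ^ k * t ^ l) = y ^ i * (t ^ j * y ^ k) * t ^ l := by group
      _ = _ := by rw [e]; group
  inv_mem' := by
    rintro x ⟨i, j, rfl⟩
    obtain ⟨s, r, e⟩ := hc (-j) (-i)
    refine ⟨s, r, ?_⟩
    rw [← e]; group

theorem mem_prodSub {X : Type u} [Group X] {y t : X}
    (hc : ∀ i j : ℤ, ∃ k l : ℤ, t ^ i * y ^ j = y ^ k * t ^ l) {x : X} :
    x ∈ prodSub y t hc ↔ ∃ i j : ℤ, x = y ^ i * t ^ j := Iff.rfl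

theorem card_prod {X : Type u} [Group X] [Finite X] {y t : X} (K : Subgroup X)
    (hK : ∀ x, x ∈ K ↔ ∃ i j : ℤ, x = y ^ i * t ^ j)
    (hi : ∀ z, z ∈ zpowers y → z ∈ zpowers t → z = 1) :
    Nat.card K = orderOf y * orderOf t := by
  rw [← Nat.card_zpowers, ← Nat.card_zpowers, ← Nat.card_prod]
  symm
  have hmem : ∀ q : zpowers y × zpowers t, (q.1 : X) * (q.2 : X) ∈ K := by
    rintro ⟨⟨_, i, rfl⟩, ⟨_, j, rfl⟩⟩
    exact (hK _).2 ⟨i, j, rfl⟩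
  refine Nat.card_eq_of_bijective (fun q => (⟨(q.1 : X) * (q.2 : X), hmem q⟩ : K)) ⟨?_, ?_⟩
  · rintro ⟨g, k⟩ ⟨g', k'⟩ e
    have e' : (g : X) * k = g' * k' := by simpa using e
    have e2 : (g' : X)⁻¹ * g = k' * (k : X)⁻¹ := by
      calc (g' : X)⁻¹ * g = (g' : X)⁻¹ * (g * k) * (k : X)⁻¹ := by group
        _ = _ := by rw [e']; group
    have e3 := hi _ (mul_mem (inv_mem g'.2) g.2) (by rw [e2]; exact mul_mem k'.2 (inv_mem k.2))
    have e4 : (g : X) = g' := (inv_mul_eq_one.1 e3).symm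
    have e5 : (k : X) = k' := by rw [e4] at e'; exact mul_left_cancel e'
    exact Prod.ext (Subtype.ext e4) (Subtype.ext e5)
  · rintro ⟨z, hz⟩
    obtain ⟨i, j, rfl⟩ := (hK z).1 hz
    exact ⟨⟨⟨y ^ i, i, rfl⟩, ⟨t ^ j, j, rfl⟩⟩, rfl⟩

theorem fix_coset {X : Type u} [Group X] [Finite X] {p : ℕ} [Fact p.Prime] (M R : Subgroup X)
    (hRM : R ≤ M) {r : ℕ} (hr : ¬ p ∣ r) (hcard : Nat.card R * r = Nat.card M)
    {y : X} (hy : y ∈ M) {t : ℕ} (hyt : y ^ p ^ t = 1) : ∃ g ∈ M, g⁻¹ * y * g ∈ R := by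
  obtain ⟨y', hy'⟩ : ∃ y' : M, (y' : X) = y := ⟨⟨y, hy⟩, rfl⟩
  have hP : IsPGroup p (zpowers y') := by
    rw [IsPGroup.iff_orderOf]
    rintro ⟨z, i, rfl⟩
    have hz : y' ^ p ^ t = 1 := by
      apply Subtype.ext; push_cast; rw [hy']; exact hyt
    have : orderOf (⟨y' ^ i, i, rfl⟩ : zpowers y') ∣ p ^ t := by
      apply orderOf_dvd_of_pow_eq_one
      apply Subtype.ext
      push_cast
      rw [← zpow_natCast, zpow_comm, zpow_natCast, hz, one_zpow]
    obtain ⟨s, -, hs⟩ := (Nat.dvd_prime_pow Fact.out).1 this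
    exact ⟨s, hs⟩
  have hidx : ¬ p ∣ Nat.card (M ⧸ R.subgroupOf M) := by
    have h1 := Subgroup.card_mul_index (R.subgroupOf M)
    have h2 : Nat.card (R.subgroupOf M) = Nat.card R :=
      Nat.card_congr (Subgroup.subgroupOfEquivOfLe hRM).toEquiv
    rw [h2, ← hcard] at h1
    have h3 := Nat.eq_of_mul_eq_mul_left Nat.card_pos h1
    rw [Subgroup.index] at h3
    rw [h3]; exact hr
  obtain ⟨q, hq⟩ := hP.nonempty_fixed_point_of_prime_not_dvd_card (M ⧸ R.subgroupOf M) hidx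
  induction q using QuotientGroup.induction_on with
  | H g =>
    have h1 := hq ⟨y', mem_zpowers y'⟩
    have h2 : ((y' * g : M) : M ⧸ R.subgroupOf M) = (g : M ⧸ R.subgroupOf M) := h1
    have h3 := QuotientGroup.eq.1 h2.symm
    rw [Subgroup.mem_subgroupOf] at h3
    refine ⟨g, g.2, ?_⟩
    push_cast at h3
    rw [hy'] at h3
    rwa [mul_assoc]

namespace Pkg

variable {X : Type u} [Group X] {a b c w x : X} {k p : ℕ}

theorem w_mem (h : Pkg a b c w x k p) (hk : Nat.Coprime p k) : w ∈ zpowers (a ^ k) := by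
  obtain ⟨i, hi⟩ := h.wa
  simp only at hi
  obtain ⟨u, v, huv⟩ := Nat.isCoprime_iff_coprime.2 hk
  refine ⟨i * v, ?_⟩
  simp only
  calc (a ^ k) ^ (i * v) = (a ^ i) ^ (v * k) := by
        rw [← zpow_natCast a k, ← zpow_mul, ← zpow_mul]; congr 1; ring
    _ = w ^ (u * p + v * k) := by
        rw [hi, zpow_add, mul_comm u, zpow_mul w p, zpow_natCast w p, h.wp, one_zpow, one_mul]
    _ = w := by rw [huv, zpow_one]

theorem zpow_x_eq (h : Pkg a b c w x k p) {i j : ℤ} (e : (i : ZMod p) = j) : x ^ i = x ^ j := by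
  have h1 : ((i - j : ℤ) : ZMod p) = 0 := by push_cast; rw [e, sub_self]
  obtain ⟨t, ht⟩ := (ZMod.intCast_zmod_eq_zero_iff_dvd _ p).1 h1
  have h2 : i = j + p * t := by linarith
  rw [h2, zpow_add, zpow_mul, zpow_natCast, h.xp, one_zpow, mul_one]

theorem zpow_x_eq' (h : Pkg a b c w x k p) {i j : ℤ} (e : x ^ i = x ^ j) : (i : ZMod p) = j := by
  have h1 : x ^ (i - j) = 1 := by rw [zpow_sub, e, mul_inv_cancel]
  have h2 := orderOf_dvd_iff_zpow_eq_one.2 h1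
  rw [h.xo] at h2
  have := (ZMod.intCast_zmod_eq_zero_iff_dvd _ p).2 h2
  push_cast at this; exact sub_eq_zero.1 this

theorem gx_mul (h : Pkg a b c w x k p) {g g' : X} {i j i' j' : ℤ}
    (e : g * x * g⁻¹ = w ^ i * x ^ j) (e' : g' * x * g'⁻¹ = w ^ i' * x ^ j') :
    ∃ l : ℤ, (g * g') * x * (g * g')⁻¹ = w ^ l * x ^ (j * j') := by
  obtain ⟨q, hq⟩ := h.wn.conj_mem (w ^ i') ⟨i', rfl⟩ g
  simp only at hq
  refine ⟨q + i * j', ?_⟩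
  calc (g * g') * x * (g * g')⁻¹ = g * (g' * x * g'⁻¹) * g⁻¹ := by group
    _ = (g * w ^ i' * g⁻¹) * (g * x ^ j' * g⁻¹) := by rw [e']; group
    _ = w ^ q * (w ^ i * x ^ j) ^ j' := by rw [← hq, ← e, conj_zpow]
    _ = _ := by
      rw [((h.wx.zpow_left i).zpow_right j).mul_zpow, ← zpow_mul, ← zpow_mul, ← mul_assoc,
        ← zpow_add]

theorem gx_uniq (h : Pkg a b c w x k p) {g : X} {i j i' j' : ℤ}
    (e : g * x * g⁻¹ = w ^ i * x ^ j) (e' : g * x * g⁻¹ = w ^ i' * x ^ j') :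
    (j : ZMod p) = j' := by
  apply h.zpow_x_eq'
  obtain ⟨s, hs⟩ := h.wa
  obtain ⟨t, ht⟩ := h.xc
  simp only at hs ht
  rw [e] at e'
  rw [← hs, ← ht, ← zpow_mul, ← zpow_mul, ← zpow_mul, ← zpow_mul] at e'
  have := (h.cfg.uniq e').2
  rw [← ht, ← zpow_mul, ← zpow_mul]; exact this

theorem Ax [Fact p.Prime] (h : Pkg a b c w x k p) {k0 : ℕ} (hk : k = 2 * k0)
    (hB : b * a ^ k0 * b = (a ^ k0)⁻¹) : ∃ i : ℤ, a ^ k * x * (a ^ k)⁻¹ = w ^ i * x := by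
  obtain ⟨i, u, eB⟩ := h.gx (a ^ k0)
  obtain ⟨i', t, eb⟩ := h.gx b
  obtain ⟨l1, e1⟩ := h.gx_mul eb eb
  obtain ⟨l2, e2⟩ := h.gx_mul eB eB
  obtain ⟨l3, e3⟩ := h.gx_mul eb eB
  obtain ⟨l4, e4⟩ := h.gx_mul e3 e3
  have e0 : (1 : X) * x * 1⁻¹ = w ^ (0 : ℤ) * x ^ (1 : ℤ) := by simp
  have b4 : b * a ^ k0 * (b * a ^ k0) = 1 := by
    calc b * a ^ k0 * (b * a ^ k0) = (b * a ^ k0 * b) * a ^ k0 := by group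
      _ = 1 := by rw [hB]; group
  rw [h.cfg.bb] at e1
  rw [b4] at e4
  have z1 := h.gx_uniq e1 e0
  have z4 := h.gx_uniq e4 e0
  push_cast at z1 z4
  have z2 : ((u * u : ℤ) : ZMod p) = (1 : ℤ) := by
    push_cast
    linear_combination z4 - u * u * z1
  rw [h.zpow_x_eq z2, zpow_one, ← pow_add, ← two_mul, ← hk] at e2
  exact ⟨l2, e2⟩

theorem conj_Ap (h : Pkg a b c w x k p) {i0 : ℤ} (hAx : a ^ k * x * (a ^ k)⁻¹ = w ^ i0 * x) :
    c * (a ^ k) ^ p * c⁻¹ ∈ zpowers a := by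
  have := h.wn
  let π : X →* X ⧸ zpowers w := QuotientGroup.mk' (zpowers w)
  have hw : π w = 1 := (QuotientGroup.eq_one_iff w).2 (mem_zpowers w)
  have hcm : Commute (π (a ^ k)) (π x) := by
    have e1 := congrArg π hAx
    rw [map_mul, map_mul, map_mul, map_zpow, hw, one_zpow, one_mul, map_inv] at e1
    exact mul_inv_eq_iff_eq_mul.1 e1
  obtain ⟨i, j, l, e⟩ := h.ga c
  have e2 : π (c * (a ^ k) ^ p * c⁻¹) = π (((a ^ k) ^ i) ^ p) := by
    rw [← conj_pow, map_pow, e, map_mul, map_mul, map_zpow, map_zpow, map_zpow, hw, one_zpow,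
      mul_one, ((hcm.zpow_left i).zpow_right l).mul_pow, ← map_zpow π x, ← map_pow π (x ^ l)]
    have : (x ^ l) ^ p = 1 := by
      rw [← zpow_natCast, zpow_comm, zpow_natCast, h.xp, one_zpow]
    simp only [this, map_one, mul_one, map_pow, map_zpow]
  have e3 := QuotientGroup.eq.1 e2.symm
  have e4 : c * (a ^ k) ^ p * c⁻¹ = ((a ^ k) ^ i) ^ p *
    ((((a ^ k) ^ i) ^ p)⁻¹ * (c * (a ^ k) ^ p * c⁻¹)) := by group
  rw [e4]
  exact mul_mem (pow_mem (zpow_mem (pow_mem (mem_zpowers a) k) _) _) ((zpowers_le.2 h.wa) e3)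

theorem w_mem_p [Fact p.Prime] (h : Pkg a b c w x k p) (hk : Nat.Coprime p k)
    (hcA : c * (a ^ k) ^ p * c⁻¹ ∈ zpowers a) (hne : c * a ^ k * c⁻¹ ∉ zpowers a) :
    w ∈ zpowers ((a ^ k) ^ p) := by
  obtain ⟨i, hi⟩ := h.w_mem hk
  simp only at hi
  by_cases hpi : (p : ℤ) ∣ i
  · obtain ⟨t, rfl⟩ := hpi
    exact ⟨t, by simp only; rw [← hi, zpow_mul, zpow_natCast]⟩
  · exfalso
    apply hne
    have hc : IsCoprime (p : ℤ) i :=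
      (Int.isCoprime_iff_gcd_eq_one).2 (by
        rw [Int.gcd_comm]
        have := (Nat.Prime.coprime_iff_not_dvd h.hp (n := i.natAbs)).2
          (fun hh => hpi (Int.natCast_dvd.2 hh))
        rw [Int.gcd_comm]
        simpa [Int.gcd] using this)
    obtain ⟨u, v, huv⟩ := hc
    have e : a ^ k = ((a ^ k) ^ p) ^ u * w ^ v := by
      rw [← hi, ← zpow_natCast (a ^ k) p, ← zpow_mul, ← zpow_mul, ← zpow_add, mul_comm (p : ℤ),
        mul_comm i, huv, zpow_one]
    have e2 : c * a ^ k * c⁻¹ = (c * (a ^ k) ^ p * c⁻¹) ^ u * (c * w * c⁻¹) ^ v := by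
      rw [conj_zpow, conj_zpow]
      calc c * a ^ k * c⁻¹ = c * (((a ^ k) ^ p) ^ u * w ^ v) * c⁻¹ := by rw [← e]
        _ = _ := by group
    rw [e2]
    exact mul_mem (zpow_mem hcA _)
      (zpow_mem ((zpowers_le.2 h.wa) (h.wn.conj_mem w (mem_zpowers w) c)) _)

/-- The action on `⟨A, x⟩ / ⟨A ^ p⟩`. -/
theorem act (h : Pkg a b c w x k p) (hN : (zpowers ((a ^ k) ^ p)).Normal)
    (hw : w ∈ zpowers ((a ^ k) ^ p)) {i0 : ℤ} (hAx : a ^ k * x * (a ^ k)⁻¹ = w ^ i0 * x) :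
    Act (QuotientGroup.mk' (zpowers ((a ^ k) ^ p)) (a ^ k))
      (QuotientGroup.mk' (zpowers ((a ^ k) ^ p)) x) p := by
  obtain ⟨π, hπ⟩ : ∃ π, π = QuotientGroup.mk' (zpowers ((a ^ k) ^ p)) := ⟨_, rfl⟩
  have hk : ∀ g, π g = 1 ↔ g ∈ zpowers ((a ^ k) ^ p) := by
    intro g; rw [hπ]; exact QuotientGroup.eq_one_iff g
  have hs : Function.Surjective π := by rw [hπ]; exact QuotientGroup.mk'_surjective _
  rw [← hπ]
  have hw1 : π w = 1 := (hk w).2 hw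
  have hpA : p ∣ orderOf (a ^ k) := by
    rw [← h.wo]
    exact orderOf_dvd_of_mem_zpowers ((zpowers_le.2 (pow_mem (mem_zpowers _) p)) hw)
  refine ⟨?_, ?_, ?_, ?_, ?_, ?_⟩
  · have e1 := congrArg π hAx
    rw [map_mul, map_mul, map_mul, map_zpow, hw1, one_zpow, one_mul, map_inv] at e1
    exact mul_inv_eq_iff_eq_mul.1 e1
  · rw [← map_pow, hk]; exact mem_zpowers _
  · rw [← map_pow, h.xp, map_one]
  · intro i j e
    rw [← map_zpow, ← map_zpow, ← map_mul, hk] at e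
    obtain ⟨r, hr⟩ := e
    simp only at hr
    have e2 : x ^ j = (a ^ k) ^ (-i) * ((a ^ k) ^ p) ^ r := by rw [hr]; group
    have e3 : x ^ j = 1 := by
      refine h.cfg.int' ?_ (zpow_mem h.xc j)
      rw [e2]
      exact mul_mem (zpow_mem (pow_mem (mem_zpowers a) k) _)
        (zpow_mem (pow_mem (pow_mem (mem_zpowers a) k) _) _)
    constructor
    · rw [e3, mul_one] at hr
      have e4 : (a ^ k) ^ (i - p * r) = 1 := by
        rw [zpow_sub, zpow_mul, zpow_natCast, hr, mul_inv_cancel]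
      have e5 := orderOf_dvd_iff_zpow_eq_one.2 e4
      have e6 : (p : ℤ) ∣ i - p * r := dvd_trans (by exact_mod_cast hpA) e5
      have : i = (i - p * r) + p * r := by ring
      rw [this]
      exact dvd_add e6 (dvd_mul_right _ _)
    · have e5 := orderOf_dvd_iff_zpow_eq_one.2 e3
      rwa [h.xo] at e5
  · intro g
    obtain ⟨g, rfl⟩ := hs g
    obtain ⟨i, j, l, e⟩ := h.ga g
    refine ⟨i, l, ?_⟩
    rw [← map_inv, ← map_mul, ← map_mul, e, map_mul, map_mul, map_zpow, map_zpow, map_zpow, hw1,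
      one_zpow, mul_one]
  · intro g
    obtain ⟨g, rfl⟩ := hs g
    obtain ⟨i, j, e⟩ := h.gx g
    refine ⟨j, ?_⟩
    rw [← map_inv, ← map_mul, ← map_mul, e, map_mul, map_zpow, map_zpow, hw1,
      one_zpow, one_mul]

end Pkg

namespace Pkg

variable {X : Type u} [Group X] {a b c w x : X} {k p : ℕ}

theorem wz (h : Pkg a b c w x k p) {n : ℕ} (hn : Nat.Coprime p n) {i : ℤ}
    (e : w ^ ((n : ℤ) * i) = 1) : w ^ i = 1 := by
  have h1 := orderOf_dvd_iff_zpow_eq_one.2 e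
  rw [h.wo] at h1
  have h2 : (p : ℤ) ∣ i := (Nat.isCoprime_iff_coprime.2 hn).dvd_of_dvd_mul_left h1
  obtain ⟨t, rfl⟩ := h2
  rw [zpow_mul, zpow_natCast, h.wp, one_zpow]

theorem w_inv (h : Pkg a b c w x k p) (hp2 : Nat.Coprime p 2) : b * w * b = w⁻¹ := by
  have h2 := h.wa
  obtain ⟨i, hi⟩ := h2
  simp only at hi
  have e1 : b * w ^ 2 * b = (w ^ 2)⁻¹ := by
    have : w ^ 2 = (a ^ 2) ^ i := by
      rw [← hi, ← zpow_natCast, ← zpow_natCast, ← zpow_mul, ← zpow_mul, mul_comm]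
    rw [this, h.cfg.conj_b_zpow, h.cfg.inv, inv_zpow]
  obtain ⟨u, v, huv⟩ := Nat.isCoprime_iff_coprime.2 hp2
  have e2 : w = (w ^ 2) ^ v := by
    have : w = w ^ (u * p + v * (2 : ℕ)) := by rw [huv, zpow_one]
    rw [zpow_add, mul_comm u, zpow_mul w p, zpow_natCast w p, h.wp, one_zpow, one_mul, mul_comm,
      zpow_mul, zpow_natCast] at this
    exact this
  calc b * w * b = b * (w ^ 2) ^ v * b := by rw [← e2]
    _ = ((w ^ 2) ^ v)⁻¹ := by rw [h.cfg.conj_b_zpow, e1, inv_zpow]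
    _ = _ := by rw [← e2]

/-- End of case 3: with `γ a = 1`, `γ b = -1`, the subgroup `⟨x⟩` is normal. -/
theorem fin3 [Finite X] (h : Pkg a b c w x k p) (hp2 : Nat.Coprime p 2) {i j : ℤ}
    (ha : a * x * a⁻¹ = w ^ i * x) (hb : b * x * b = w ^ j * x⁻¹) : False := by
  have hwz : ∀ n : ℤ, b * w ^ n * b = w ^ (-n) := by
    intro n; rw [h.cfg.conj_b_zpow, h.w_inv hp2, inv_zpow, zpow_neg]
  have hj : w ^ j = 1 := by
    apply h.wz hp2
    have e1 : b * (b * x * b) * b = x := h.cfg.conj_b_b x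
    have e2 : b * x⁻¹ * b = (w ^ j * x⁻¹)⁻¹ := by
      rw [← hb]; simp [mul_inv_rev, h.cfg.binv, mul_assoc]
    rw [hb, h.cfg.conj_b_mul, hwz, e2] at e1
    have e3 : w ^ (-j) * (w ^ j * x⁻¹)⁻¹ = (w ^ ((2 : ℕ) * j : ℤ))⁻¹ * x := by
      rw [mul_inv_rev, inv_inv, ← (h.wx.zpow_left j).inv_left.eq, ← mul_assoc, ← zpow_neg,
        ← zpow_neg, ← zpow_add]
      congr 2; push_cast; ring
    rw [e3] at e1
    exact inv_eq_one.1 (mul_eq_right.1 e1)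
  rw [hj, one_mul] at hb
  have ha2 : a ^ 2 * x * (a ^ 2)⁻¹ = w ^ (2 * i) * x := by
    calc a ^ 2 * x * (a ^ 2)⁻¹ = a * (a * x * a⁻¹) * a⁻¹ := by rw [pow_two]; group
      _ = a * w ^ i * x * a⁻¹ := by rw [ha]; group
      _ = w ^ i * (a * x * a⁻¹) := by rw [← (h.aw.zpow_left i).eq]; group
      _ = w ^ (2 * i) * x := by rw [ha]; group
  have hi : w ^ i = 1 := by
    apply h.wz (n := 4) (by have := hp2.mul_right hp2; simpa using this)
    have e1 : b * (a ^ 2 * x * (a ^ 2)⁻¹) * b = (a ^ 2)⁻¹ * x⁻¹ * a ^ 2 := by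
      have e0 : b * (a ^ 2)⁻¹ * b = a ^ 2 := by
        have := h.cfg.conj_b_b (a ^ 2)
        rwa [h.cfg.inv] at this
      rw [h.cfg.conj_b_mul, h.cfg.conj_b_mul, h.cfg.inv, hb, e0]
    rw [ha2, h.cfg.conj_b_mul, hwz, hb] at e1
    -- `w ^ (-2 * i) x⁻¹ = a⁻² x⁻¹ a²`
    have hwa : Commute (w ^ (-(2 * i))) (a ^ 2) := (h.aw.zpow_left _).pow_right 2
    have e2 : w ^ (-(2 * i)) * (w ^ (2 * i) * x)⁻¹ = x⁻¹ := by
      calc w ^ (-(2 * i)) * (w ^ (2 * i) * x)⁻¹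
          = w ^ (-(2 * i)) * (a ^ 2 * x⁻¹ * (a ^ 2)⁻¹) := by rw [← ha2]; group
        _ = (w ^ (-(2 * i)) * a ^ 2) * x⁻¹ * (a ^ 2)⁻¹ := by group
        _ = a ^ 2 * (w ^ (-(2 * i)) * x⁻¹) * (a ^ 2)⁻¹ := by rw [hwa.eq]; group
        _ = x⁻¹ := by rw [e1]; group
    have e3 : w ^ (-(2 * i)) * (w ^ (2 * i) * x)⁻¹ = (w ^ ((4 : ℕ) * i : ℤ))⁻¹ * x⁻¹ := by
      rw [mul_inv_rev, ← ((h.wx.zpow_left (2 * i)).inv_left.inv_right).eq, ← mul_assoc, ← zpow_neg,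
        ← zpow_neg, ← zpow_add]
      congr 2; push_cast; ring
    rw [e3] at e2
    exact inv_eq_one.1 (mul_eq_right.1 e2)
  rw [hi, one_mul] at ha
  apply h.xn
  apply h.cfg.normal_zpowers
  · rw [ha]; exact mem_zpowers x
  · rw [hb]; exact inv_mem (mem_zpowers x)
  · rw [h.cx.eq]; simp

theorem exists_R [Finite X] [Fact p.Prime] (h : Pkg a b c w x k p) (hk : Nat.Coprime p k)
    {i0 : ℤ} (hAx : a ^ k * x * (a ^ k)⁻¹ = w ^ i0 * x) {t m' : ℕ} (ht : orderOf c = p ^ t * m')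
    (hm' : ¬ p ∣ m') {n : ℕ} (hx : x = (c ^ m') ^ n) :
    ∃ i j q : ℤ, (a ^ i * b) * c ^ m' * (a ^ i * b)⁻¹ = (a ^ k) ^ j * (c ^ m') ^ q := by
  obtain ⟨A, hA⟩ : ∃ A, A = a ^ k := ⟨_, rfl⟩
  obtain ⟨e, he⟩ : ∃ e, e = c ^ m' := ⟨_, rfl⟩
  obtain ⟨wi, hwi⟩ := h.w_mem hk
  have ga := h.ga
  simp only at hwi
  rw [← hA] at hAx hwi ga ⊢
  rw [← he] at hx ⊢
  -- S
  have hxA : x * A * x⁻¹ ∈ zpowers A := by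
    have : x * A * x⁻¹ = w ^ (-i0) * A := by
      have e1 : x⁻¹ = (A * x * A⁻¹)⁻¹ * w ^ i0 := by
        rw [hAx, mul_inv_rev, mul_assoc, inv_mul_cancel, mul_one]
      have e2 : A * x = w ^ i0 * x * A := by rw [← hAx]; group
      calc x * A * x⁻¹ = w ^ (-i0) * (w ^ i0 * x * A) * x⁻¹ := by group
        _ = _ := by rw [← e2]; group
    rw [this]
    refine mul_mem (zpow_mem ?_ _) (mem_zpowers A)
    rw [← hwi]; exact zpow_mem (mem_zpowers A) _
  have hxA' : ∀ i j : ℤ, x ^ i * A ^ j * (x ^ i)⁻¹ ∈ zpowers A := by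
    have hle : zpowers x ≤ Subgroup.normalizer (zpowers A : Set X) := by
      rw [zpowers_le]
      refine Subgroup.mem_normalizer_fintype ?_
      rintro z ⟨q, rfl⟩
      simp only [← conj_zpow]; exact zpow_mem hxA q
    intro i j
    exact (Subgroup.mem_normalizer_iff.1 (hle ⟨i, rfl⟩) _).1 ⟨j, rfl⟩
  have hS : ∀ i j : ℤ, ∃ k l : ℤ, x ^ i * A ^ j = A ^ k * x ^ l := by
    intro i j
    obtain ⟨q, hq⟩ := hxA' i j
    simp only at hq
    exact ⟨q, i, by rw [hq]; group⟩
  have gS : ∀ (g : X) (j : ℤ), ∃ k l : ℤ, g * A ^ j * g⁻¹ = A ^ k * x ^ l := by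
    intro g j
    rw [← conj_zpow]
    have : g * A * g⁻¹ ∈ prodSub A x hS := by
      obtain ⟨i, j, l, e⟩ := ga g
      refine ⟨i + wi * j, l, ?_⟩
      rw [e, ← hwi, zpow_add, zpow_mul]
    exact zpow_mem this j
  have hR : ∀ i j : ℤ, ∃ k l : ℤ, e ^ i * A ^ j = A ^ k * e ^ l := by
    intro i j
    obtain ⟨q, l, hq⟩ := gS (e ^ i) j
    refine ⟨q, n * l + i, ?_⟩
    calc e ^ i * A ^ j = e ^ i * A ^ j * (e ^ i)⁻¹ * e ^ i := by group
      _ = _ := by rw [hq, hx, zpow_add, zpow_mul, zpow_natCast, mul_assoc]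
  have ec : e ∈ zpowers c := by rw [he]; exact pow_mem (mem_zpowers c) _
  have Aa : A ∈ zpowers a := by rw [hA]; exact pow_mem (mem_zpowers a) _
  have pp : p.Prime := Fact.out
  have hm0 : m' ≠ 0 := by rintro rfl; exact hm' (dvd_zero p)
  have oe : orderOf e = p ^ t := by
    rw [he, orderOf_pow, ht, Nat.gcd_eq_right (dvd_mul_left _ _),
      Nat.mul_div_cancel _ (Nat.pos_of_ne_zero hm0)]
  have cM := card_prod h.cfg.M (fun _ => Iff.rfl) (fun z h1 h2 => h.cfg.int' h1 h2)
  have cR := card_prod (prodSub A e hR) (fun _ => Iff.rfl)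
    (fun z h1 h2 => h.cfg.int' (zpowers_le.2 Aa h1) (zpowers_le.2 ec h2))
  have oA : orderOf A * Nat.gcd (orderOf a) k = orderOf a := by
    rw [hA, orderOf_pow, Nat.div_mul_cancel (Nat.gcd_dvd_left _ _)]
  have hRM : prodSub A e hR ≤ h.cfg.M := by
    rintro z ⟨i, j, rfl⟩
    refine mul_mem (zpow_mem ?_ _) (zpow_mem ?_ _)
    · exact zpowers_le.2 h.cfg.a_mem Aa
    · exact zpowers_le.2 h.cfg.c_mem ec
  have hr : ¬ p ∣ Nat.gcd (orderOf a) k * m' := by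
    intro hd
    rcases (Nat.Prime.dvd_mul pp).1 hd with h1 | h1
    · have h2 := h1.trans (Nat.gcd_dvd_right _ _)
      exact (Nat.Prime.coprime_iff_not_dvd pp).1 hk h2
    · exact hm' h1
  have hcard : Nat.card (prodSub A e hR) * (Nat.gcd (orderOf a) k * m') = Nat.card h.cfg.M := by
    rw [cM, cR, oe, ht]
    calc orderOf A * p ^ t * (Nat.gcd (orderOf a) k * m')
        = (orderOf A * Nat.gcd (orderOf a) k) * (p ^ t * m') := by ring
      _ = _ := by rw [oA]
  have hy : b * e * b ∈ h.cfg.M := h.cfg.b_M (zpowers_le.2 h.cfg.c_mem ec)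
  have hyt : (b * e * b) ^ p ^ t = 1 := by
    rw [← h.cfg.conj_b_pow, ← oe, pow_orderOf_eq_one, mul_one, h.cfg.bb]
  obtain ⟨g, ⟨i, j, rfl⟩, hg⟩ := fix_coset h.cfg.M (prodSub A e hR) hRM hr hcard hy hyt
  have cnorm : ∀ r ∈ prodSub A e hR, c ^ j * r * (c ^ j)⁻¹ ∈ prodSub A e hR := by
    rintro r ⟨u, v, rfl⟩
    obtain ⟨q, l, hq⟩ := gS (c ^ j) u
    have ce : c ^ j * e ^ v = e ^ v * c ^ j := by
      have : Commute c e := by rw [he]; exact (Commute.refl c).pow_right _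
      exact ((this.zpow_left j).zpow_right v).eq
    refine ⟨q, n * l + v, ?_⟩
    calc c ^ j * (A ^ u * e ^ v) * (c ^ j)⁻¹
        = (c ^ j * A ^ u * (c ^ j)⁻¹) * (c ^ j * e ^ v) * (c ^ j)⁻¹ := by group
      _ = A ^ q * x ^ l * e ^ v := by rw [hq, ce]; group
      _ = _ := by rw [hx, zpow_add, zpow_mul, zpow_natCast, mul_assoc]
  have h2 := cnorm _ hg
  obtain ⟨u, v, huv⟩ := h2
  refine ⟨-i, u, v, ?_⟩
  rw [← huv]
  have : (a ^ (-i) * b)⁻¹ = b * a ^ i := by rw [mul_inv_rev, h.cfg.binv]; group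
  rw [this]
  group

theorem caseOdd [Finite X] (h : Pkg a b c w x k p) (hp2 : p ≠ 2) {k0 : ℕ} (hk : k = 2 * k0)
    (hk4 : k ∣ 4) (hB : b * a ^ k0 * b = (a ^ k0)⁻¹) : c * a ^ k * c⁻¹ ∈ zpowers a := by
  by_contra hne
  have : Fact p.Prime := ⟨h.hp⟩
  have c2 : Nat.Coprime p 2 := (Nat.coprime_primes h.hp Nat.prime_two).2 hp2
  have ck : Nat.Coprime p k := by
    have : Nat.Coprime p 4 := by have := c2.mul_right c2; simpa using this
    exact Nat.Coprime.coprime_dvd_right hk4 this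
  obtain ⟨i0, hAx⟩ := h.Ax hk hB
  have hcA := h.conj_Ap hAx
  have hw := h.w_mem_p ck hcA hne
  have hN := h.cfg.normal_of_mem (pow_mem (pow_mem (mem_zpowers a) k) p) hcA
  have H := h.act hN hw hAx
  obtain ⟨π, hπ⟩ : ∃ π, π = QuotientGroup.mk' (zpowers ((a ^ k) ^ p)) := ⟨_, rfl⟩
  rw [← hπ] at H
  have hw1 : π w = 1 := by rw [hπ]; exact (QuotientGroup.eq_one_iff w).2 hw
  have haA : Commute (π a) (π (a ^ k)) := by
    have := (Commute.refl a).pow_right k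
    exact this.map π
  have hbA : H.α (π b) = -1 ∧ H.β (π b) = 0 := by
    have e1 : b * a ^ k * b⁻¹ = (a ^ k)⁻¹ := by
      rw [h.cfg.binv, hk, mul_comm, pow_mul, h.cfg.conj_b_pow, hB, inv_pow]
    have e2 := H.αβ (g := π b) (i := -1) (j := 0) (by
      rw [← map_inv, ← map_mul, ← map_mul, e1]; simp)
    simpa using e2
  have hcx : Commute (π c) (π x) := h.cx.map π
  have hcb : H.β (π c) ≠ 0 := by
    intro h0
    obtain ⟨i, j, l, e⟩ := h.ga c
    have e2 := (H.αβ (g := π c) (i := i) (j := l) (by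
      rw [← map_inv, ← map_mul, ← map_mul, e, map_mul, map_mul, map_zpow, map_zpow, map_zpow, hw1,
      one_zpow, mul_one])).2
    rw [h0] at e2
    have e3 : x ^ l = x ^ (0 : ℤ) := h.zpow_x_eq (by rw [← e2]; simp)
    rw [zpow_zero] at e3
    apply hne
    rw [e, e3, mul_one]
    exact mul_mem (zpow_mem (pow_mem (mem_zpowers a) k) _) (zpow_mem h.wa _)
  have hγ : ∀ (g : X) (i j : ℤ), g * x * g⁻¹ = w ^ i * x ^ j → H.γ (π g) = j := by
    intro g i j e
    apply H.γe
    rw [← map_inv, ← map_mul, ← map_mul, e, map_mul, map_zpow, map_zpow, hw1, one_zpow, one_mul]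
  by_cases hc1 : H.α (π c) = 1
  · obtain ⟨t, m', hm', ht⟩ := Nat.exists_eq_pow_mul_and_not_dvd (orderOf_pos c).ne' p h.hp.ne_one
    have ht0 : t ≠ 0 := by
      rintro rfl
      rw [pow_zero, one_mul] at ht
      exact hm' (ht ▸ h.pd)
    obtain ⟨t, rfl⟩ := Nat.exists_eq_succ_of_ne_zero ht0
    have hx : x = (c ^ m') ^ (p ^ t) := by
      rw [h.xd, ht, ← pow_mul]
      congr 1
      rw [Nat.succ_eq_add_one, pow_succ]
      rw [show p ^ t * p * m' = m' * p ^ t * p by ring, Nat.mul_div_cancel _ h.hp.pos]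
    obtain ⟨i, j, q, e⟩ := h.exists_R ck hAx ht hm' hx
    have hex : Commute (π (c ^ m')) (π x) := (h.cx.pow_left m').map π
    obtain ⟨k1, k2, k3⟩ := H.pow_formula (π c) hc1 (H.γ_comm hcx) m'
    rw [zpow_natCast, ← map_pow] at k1 k2 k3
    have heb : H.β (π (c ^ m')) ≠ 0 := by
      rw [k3]
      refine mul_ne_zero ?_ hcb
      intro h0
      apply hm'
      rw [← ZMod.natCast_eq_zero_iff]
      exact_mod_cast h0
    have hn : p ∣ p ^ t := by
      rcases Nat.eq_zero_or_pos t with h0 | h0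
      · exfalso
        rw [h0, pow_zero, pow_one] at hx
        apply heb
        rw [← hx]
        exact (H.αβ_comm H.comm.symm).2
      · exact dvd_pow_self p h0.ne'
    have hb' : H.α (π (a ^ i * b)) = -1 := by
      rw [map_mul, H.αm, hbA.1, map_zpow, (H.αβ_comm (haA.zpow_left i)).1, one_mul]
    refine H.case4 hp2 (i := j) (j := 0) (q := q) hb' hex k1 heb hn ?_ ?_
    · rw [← map_pow, ← hx]
    · rw [← map_inv, ← map_mul, ← map_mul, e]; simp
  · obtain ⟨e, f, hca⟩ := h.cfg.comm 1 1
    obtain ⟨s, v, hbc⟩ := h.cfg.bc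
    have := H.case3 (e := e) (f := f) (s := s) (v := v) haA hbA.1 hbA.2 hcx hc1 hcb
      (by rw [← map_zpow, ← map_zpow, ← map_mul, ← map_mul, ← hca]; simp)
      (by
        rw [← map_zpow, ← map_zpow, ← map_mul, ← map_mul, ← map_mul, ← hbc]
        congr 1
        rw [mul_assoc (b * c), h.cfg.bb, mul_one])
    obtain ⟨i, j, ea⟩ := h.gx a
    obtain ⟨i', j', eb⟩ := h.gx b
    have g1 : x ^ j = x ^ (1 : ℤ) := h.zpow_x_eq (by rw [← hγ _ _ _ ea, this.1]; simp)
    have g2 : x ^ j' = x ^ (-1 : ℤ) := h.zpow_x_eq (by rw [← hγ _ _ _ eb, this.2]; simp)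
    rw [g1, zpow_one] at ea
    rw [g2, zpow_neg_one, h.cfg.binv] at eb
    exact h.fin3 c2 ea eb

end Pkg

def Good {X : Type u} [Group X] (a c : X) (k : ℕ) : Prop :=
  ∃ C : Subgroup X, C.Normal ∧ C ≤ zpowers c ∧ (zpowers (a ^ k) ⊔ C).Normal

theorem Cfg.quot {X : Type u} [Group X] {a b c : X} (h : Cfg a b c) (N : Subgroup X) [N.Normal]
    (hi : ∀ i j : ℤ, (a ^ i)⁻¹ * c ^ j ∈ N → a ^ i ∈ N) :
    Cfg (QuotientGroup.mk' N a) (QuotientGroup.mk' N b) (QuotientGroup.mk' N c) := by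
  obtain ⟨π, hπ⟩ : ∃ π, π = QuotientGroup.mk' N := ⟨_, rfl⟩
  have hs : Function.Surjective π := by rw [hπ]; exact QuotientGroup.mk'_surjective _
  have hk : ∀ g, π g = 1 ↔ g ∈ N := by
    intro g; rw [hπ]; exact QuotientGroup.eq_one_iff g
  rw [← hπ]
  refine ⟨?_, ?_, ?_, ?_, ?_, ?_, ?_⟩
  · have h1 : π '' {a, b, c} = {π a, π b, π c} := by
      rw [Set.image_insert_eq, Set.image_insert_eq, Set.image_singleton]
    rw [← h1, ← MonoidHom.map_closure, h.gen, ← MonoidHom.range_eq_map,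
      MonoidHom.range_eq_top.2 hs]
  · intro i j
    obtain ⟨k, l, e⟩ := h.comm i j
    refine ⟨k, l, ?_⟩
    simpa using congrArg π e
  · obtain ⟨s, v, e⟩ := h.bc
    exact ⟨s, v, by simpa using congrArg π e⟩
  · obtain ⟨r, e⟩ := h.ba
    exact ⟨r, by simpa using congrArg π e⟩
  · rw [← map_mul, h.bb, map_one]
  · simpa using congrArg π h.inv
  · intro i j e
    rw [← map_zpow, hk]
    apply hi i j
    rw [← hk, map_mul, map_inv, map_zpow, map_zpow, e, inv_mul_cancel]

theorem Cfg.quot_c {X : Type u} [Group X] {a b c x : X} (h : Cfg a b c) (hx : x ∈ zpowers c)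
    [(zpowers x).Normal] : Cfg (QuotientGroup.mk' (zpowers x) a) (QuotientGroup.mk' (zpowers x) b)
      (QuotientGroup.mk' (zpowers x) c) := by
  apply h.quot
  intro i j e
  have h1 := zpowers_le.2 hx e
  have h2 : a ^ i ∈ zpowers c := by
    have : a ^ i = c ^ j * ((a ^ i)⁻¹ * c ^ j)⁻¹ := by group
    rw [this]; exact mul_mem ⟨j, rfl⟩ (inv_mem h1)
  have h3 : a ^ i = 1 := h.int' ⟨i, rfl⟩ h2
  rw [h3]; exact one_mem _

theorem Cfg.quot_a {X : Type u} [Group X] {a b c x : X} (h : Cfg a b c) (hx : x ∈ zpowers a)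
    [(zpowers x).Normal] : Cfg (QuotientGroup.mk' (zpowers x) a) (QuotientGroup.mk' (zpowers x) b)
      (QuotientGroup.mk' (zpowers x) c) := by
  apply h.quot
  intro i j e
  have h1 := zpowers_le.2 hx e
  have h2 : c ^ j ∈ zpowers a := by
    have : c ^ j = a ^ i * ((a ^ i)⁻¹ * c ^ j) := by group
    rw [this]; exact mul_mem ⟨i, rfl⟩ h1
  rw [h.int' h2 ⟨j, rfl⟩, mul_one] at e
  exact inv_mem_iff.1 e

theorem step_x {X : Type u} [Group X] {a c x : X} {k : ℕ} (hx : x ∈ zpowers c)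
    [(zpowers x).Normal]
    (hg : Good (QuotientGroup.mk' (zpowers x) a) (QuotientGroup.mk' (zpowers x) c) k) :
    Good a c k := by
  obtain ⟨C, h1, h2, h3⟩ := hg
  have hs := QuotientGroup.mk'_surjective (zpowers x)
  have hker : zpowers x ≤ C.comap (QuotientGroup.mk' (zpowers x)) := by
    intro g hg
    rw [Subgroup.mem_comap]
    have : QuotientGroup.mk' (zpowers x) g = 1 := (QuotientGroup.eq_one_iff g).2 hg
    rw [this]; exact one_mem _
  refine ⟨C.comap (QuotientGroup.mk' (zpowers x)), h1.comap _, ?_, ?_⟩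
  · intro g hg
    obtain ⟨j, hj⟩ := h2 (Subgroup.mem_comap.1 hg)
    simp only at hj
    rw [← map_zpow] at hj
    have e := zpowers_le.2 hx (QuotientGroup.eq.1 hj)
    have : g = c ^ j * ((c ^ j)⁻¹ * g) := by group
    rw [this]; exact mul_mem ⟨j, rfl⟩ e
  · have e1 : zpowers (a ^ k) ⊔ C.comap (QuotientGroup.mk' (zpowers x)) =
        (zpowers ((QuotientGroup.mk' (zpowers x) a) ^ k) ⊔ C).comap
          (QuotientGroup.mk' (zpowers x)) := by
      rw [← Subgroup.comap_sup_eq _ _ _ hs, ← map_pow, ← MonoidHom.map_zpowers,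
        Subgroup.comap_map_eq, QuotientGroup.ker_mk', sup_assoc, sup_eq_right.2 hker]
    rw [e1]
    exact h3.comap _

theorem step_w {X : Type u} [Group X] [Finite X] {a b c w : X} {k p : ℕ} (h : Cfg a b c)
    (hcf : ∀ x ∈ zpowers c, (zpowers x).Normal → x = 1)
    (hp : p.Prime) (wa : w ∈ zpowers a) (wo : orderOf w = p) [wn : (zpowers w).Normal]
    (hg : Good (QuotientGroup.mk' (zpowers w) a) (QuotientGroup.mk' (zpowers w) c) k) :
    c * a ^ k * c⁻¹ ∈ zpowers a ∨ ∃ x, Pkg a b c w x k p := by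
  obtain ⟨C, h1, h2, h3⟩ := hg
  obtain ⟨π, hπ⟩ : ∃ π, π = QuotientGroup.mk' (zpowers w) := ⟨_, rfl⟩
  have hk : ∀ g, π g = 1 ↔ g ∈ zpowers w := by
    intro g; rw [hπ]; exact QuotientGroup.eq_one_iff g
  rw [← hπ] at h2 h3
  refine reduce h hcf hp wa wo wn (C.comap π) (h1.comap _) ?_ ?_ ?_
  · rw [Subgroup.mem_comap, (hk w).2 (mem_zpowers w)]; exact one_mem _
  · intro l hl
    obtain ⟨j, hj⟩ := h2 (Subgroup.mem_comap.1 hl)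
    simp only at hj
    have e : l * (c ^ j)⁻¹ ∈ zpowers w := by
      rw [← hk, map_mul, map_inv, map_zpow, hj, mul_inv_cancel]
    obtain ⟨i, hi⟩ := e
    simp only at hi
    exact ⟨i, j, by rw [hi]; group⟩
  · intro g
    have e1 : π g * (π a) ^ k * (π g)⁻¹ ∈ zpowers ((π a) ^ k) ⊔ C :=
      h3.conj_mem _ (Subgroup.mem_sup_left (mem_zpowers _)) _
    obtain ⟨y, ⟨i, rfl⟩, z, hz, e⟩ := Subgroup.mem_sup_of_normal_right.1 e1
    simp only at e
    refine ⟨i, ((a ^ k) ^ i)⁻¹ * (g * a ^ k * g⁻¹), ?_, by group⟩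
    rw [Subgroup.mem_comap]
    simp only [map_mul, map_inv, map_zpow, map_pow]
    rw [← e, inv_mul_cancel_left]
    exact hz

theorem card_quot_lt {X : Type u} [Group X] [Finite X] {x : X} (hx : x ≠ 1) :
    Nat.card (X ⧸ zpowers x) < Nat.card X := by
  rw [Subgroup.card_eq_card_quotient_mul_card_subgroup (zpowers x), Nat.card_zpowers]
  have h1 : orderOf x ≠ 1 := fun h => hx (orderOf_eq_one_iff.1 h)
  have h2 := orderOf_pos x
  have h3 : 0 < Nat.card (X ⧸ zpowers x) := Nat.card_pos
  exact lt_mul_of_one_lt_right h3 (by omega)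

theorem good_of_mem {X : Type u} [Group X] [Finite X] {a b c : X} {k : ℕ} (h : Cfg a b c)
    (hc : c * a ^ k * c⁻¹ ∈ zpowers a) : Good a c k :=
  ⟨⊥, inferInstance, bot_le, by
    rw [sup_bot_eq]; exact h.normal_of_mem (pow_mem (mem_zpowers a) k) hc⟩

theorem mainD : ∀ (n : ℕ) (X : Type u) [Group X] [Finite X], Nat.card X = n →
    ∀ a b c : X, Cfg a b c → b * a * b = a⁻¹ → Good a c 2 := by
  intro n
  induction n using Nat.strong_induction_on with
  | _ n ih =>
  intro X _ _ hn a b c h hb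
  by_cases hcf : ∀ x ∈ zpowers c, (zpowers x).Normal → x = 1
  · by_cases ha : a = 1
    · apply good_of_mem h
      rw [ha]; simp
    · obtain ⟨w, wa, wp, wn⟩ := h.exists_P ha hcf
      have w1 : w ≠ 1 := by
        rintro rfl
        rw [orderOf_one] at wp; exact Nat.not_prime_one wp
      have hq := ih _ (hn ▸ card_quot_lt w1) (X ⧸ zpowers w) rfl _ _ _ (h.quot_a wa)
        (by rw [← map_mul, ← map_mul, hb, map_inv])
      apply good_of_mem h
      rcases step_w h hcf wp wa rfl hq with h1 | ⟨x, h1⟩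
      · exact h1
      · by_cases hp2 : orderOf w = 2
        · rw [hp2] at h1
          exact h1.caseD2 hb
        · exact h1.caseOdd hp2 (k0 := 1) rfl (by norm_num) (by simpa using hb)
  · push Not at hcf
    obtain ⟨x, hx, hxn, hx1⟩ := hcf
    have hq := ih _ (hn ▸ card_quot_lt hx1) (X ⧸ zpowers x) rfl _ _ _ (h.quot_c hx)
      (by rw [← map_mul, ← map_mul, hb, map_inv])
    exact step_x hx hq

theorem mainSD : ∀ (n : ℕ) (X : Type u) [Group X] [Finite X], Nat.card X = n →
    ∀ a b c : X, Cfg a b c → Good a c 4 := by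
  intro n
  induction n using Nat.strong_induction_on with
  | _ n ih =>
  intro X _ _ hn a b c h
  by_cases hcf : ∀ x ∈ zpowers c, (zpowers x).Normal → x = 1
  · by_cases ha : a = 1
    · apply good_of_mem h
      rw [ha]; simp
    · obtain ⟨w, wa, wp, wn⟩ := h.exists_P ha hcf
      have w1 : w ≠ 1 := by
        rintro rfl
        rw [orderOf_one] at wp; exact Nat.not_prime_one wp
      apply good_of_mem h
      by_cases hp2 : orderOf w = 2
      · have hD : b * a * b * a ∈ zpowers w := by
          obtain ⟨r, hr⟩ := h.ba
          refine cyc_mem_prime wa ?_ hp2 ?_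
          · rw [hr]; exact mul_mem ⟨r, rfl⟩ (mem_zpowers a)
          · have hc : Commute (b * a * b) a := by
              rw [hr]; exact (Commute.refl a).zpow_left r
            rw [hc.mul_pow, ← h.conj_b_pow, h.inv, inv_mul_cancel]
        have hD' : QuotientGroup.mk' (zpowers w) b * QuotientGroup.mk' (zpowers w) a *
            QuotientGroup.mk' (zpowers w) b = (QuotientGroup.mk' (zpowers w) a)⁻¹ := by
          apply eq_inv_of_mul_eq_one_left
          rw [← map_mul, ← map_mul, ← map_mul]
          exact (QuotientGroup.eq_one_iff _).2 hD
        have hq := mainD _ (X ⧸ zpowers w) rfl _ _ _ (h.quot_a wa) hD'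
        rcases step_w h hcf wp wa rfl hq with h1 | ⟨x, h1⟩
        · have : c * a ^ 4 * c⁻¹ = (c * a ^ 2 * c⁻¹) ^ 2 := by rw [conj_pow, ← pow_mul]
          rw [this]; exact pow_mem h1 2
        · rw [hp2] at h1
          exact h1.caseSD2
      · have hq := ih _ (hn ▸ card_quot_lt w1) (X ⧸ zpowers w) rfl _ _ _ (h.quot_a wa)
        rcases step_w h hcf wp wa rfl hq with h1 | ⟨x, h1⟩
        · exact h1
        · exact h1.caseOdd hp2 (k0 := 2) rfl (by norm_num) h.inv
  · push Not at hcf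
    obtain ⟨x, hx, hxn, hx1⟩ := hcf
    have hq := ih _ (hn ▸ card_quot_lt hx1) (X ⧸ zpowers x) rfl _ _ _ (h.quot_c hx)
    exact step_x hx hq

end SDProof

theorem stmt12 {X : Type*} [Group X] [Finite X] (n m : ℕ) (hn : 2 ≤ n) (hm : 2 ≤ m)
    (a b c : X)
    (ha : orderOf a = 4 * n) (hb : orderOf b = 2)
    (hab : b⁻¹ * a * b = a ^ (2 * n - 1))
    (hG : Nat.card (closure ({a, b} : Set X)) = 8 * n)
    (hc : orderOf c = m)
    (hprod : (closure ({a, b} : Set X) : Set X) * (zpowers c : Set X) = Set.univ)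
    (hint : closure ({a, b} : Set X) ⊓ zpowers c = ⊥)
    (hcore : (zpowers c).normalCore = ⊥)
    (hM : ∃ M : Subgroup X, (M : Set X) = (zpowers a : Set X) * (zpowers c : Set X)) :
    (zpowers (a ^ 4)).Normal := by
  obtain ⟨M, hM⟩ := hM
  have memM : ∀ x, x ∈ M ↔ ∃ i j : ℤ, x = a ^ i * c ^ j := by
    intro x
    rw [← SetLike.mem_coe, hM, Set.mem_mul]
    constructor
    · rintro ⟨_, ⟨i, rfl⟩, _, ⟨j, rfl⟩, rfl⟩
      exact ⟨i, j, rfl⟩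
    · rintro ⟨i, j, rfl⟩
      exact ⟨a ^ i, ⟨i, rfl⟩, c ^ j, ⟨j, rfl⟩, rfl⟩
  have aG : a ∈ closure ({a, b} : Set X) := subset_closure (by simp)
  have bG : b ∈ closure ({a, b} : Set X) := subset_closure (by simp)
  have triv : ∀ z, z ∈ closure ({a, b} : Set X) → z ∈ zpowers c → z = 1 := by
    intro z h1 h2
    have : z ∈ closure ({a, b} : Set X) ⊓ zpowers c := ⟨h1, h2⟩
    rw [hint] at this; exact Subgroup.mem_bot.1 this
  have trivA : ∀ z, z ∈ zpowers a → z ∈ zpowers c → z = 1 :=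
    fun z h1 h2 => triv z (zpowers_le.2 aG h1) h2
  have cM : Nat.card M = 4 * n * m := by
    rw [SDProof.card_prod M memM trivA, ha, hc]
  have cX : Nat.card X = 8 * n * m := by
    have h1 : Nat.card (closure ({a, b} : Set X) × zpowers c) = Nat.card X := by
      refine Nat.card_eq_of_bijective (fun q => (q.1 : X) * (q.2 : X)) ⟨?_, ?_⟩
      · exact Subgroup.mul_injective_of_disjoint (disjoint_iff.2 hint)
      · intro z
        have : z ∈ (closure ({a, b} : Set X) : Set X) * (zpowers c : Set X) := by
          rw [hprod]; trivial
        obtain ⟨y, hy, t, ht, rfl⟩ := Set.mem_mul.1 this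
        exact ⟨⟨⟨y, hy⟩, ⟨t, ht⟩⟩, rfl⟩
    rw [← h1, Nat.card_prod, hG, Nat.card_zpowers, hc]
  have hidx : M.index = 2 := by
    have h1 := M.card_mul_index
    rw [cM, cX] at h1
    have h2 : 4 * n * m * M.index = 4 * n * m * 2 := by rw [h1]; ring
    exact Nat.eq_of_mul_eq_mul_left (by positivity) h2
  have hMn : M.Normal := Subgroup.normal_of_index_eq_two hidx
  have bb : b * b = 1 := by
    rw [← pow_two, ← hb]; exact pow_orderOf_eq_one b
  have binv : b⁻¹ = b := inv_eq_of_mul_eq_one_left bb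
  rw [binv] at hab
  have h : SDProof.Cfg a b c := by
    refine ⟨?_, ?_, ?_, ?_, bb, ?_, ?_⟩
    · rw [eq_top_iff]
      rintro z -
      have : z ∈ (closure ({a, b} : Set X) : Set X) * (zpowers c : Set X) := by
        rw [hprod]; trivial
      obtain ⟨y, hy, t, ht, rfl⟩ := Set.mem_mul.1 this
      refine mul_mem ?_ ?_
      · refine Subgroup.closure_mono ?_ hy
        rintro q (rfl | rfl) <;> simp
      · refine zpowers_le.2 (subset_closure (by simp)) ht
    · intro i j
      exact (memM _).1 (mul_mem ((memM _).2 ⟨0, i, by simp⟩) ((memM _).2 ⟨j, 0, by simp⟩))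
    · have h1 : c ∈ M := (memM c).2 ⟨0, 1, by simp⟩
      have h2 := hMn.conj_mem c h1 b
      rw [binv] at h2
      exact (memM _).1 h2
    · exact ⟨(2 * n - 1 : ℕ), by rw [hab, zpow_natCast]⟩
    · have h1 : b * a ^ 2 * b = (b * a * b) ^ 2 := by
        rw [pow_two, pow_two]
        calc b * (a * a) * b = b * a * 1 * a * b := by group
          _ = b * a * (b * b) * a * b := by rw [bb]
          _ = _ := by group
      rw [h1, hab]
      apply eq_inv_of_mul_eq_one_left
      rw [← pow_mul, ← pow_add]
      have : (2 * n - 1) * 2 + 2 = 4 * n := by omega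
      rw [this, ← ha, pow_orderOf_eq_one]
    · intro i j e
      exact trivA _ ⟨i, rfl⟩ ⟨j, e.symm⟩
  obtain ⟨C, h1, h2, h3⟩ := SDProof.mainSD _ X rfl a b c h
  have hC : C = ⊥ := by
    rw [eq_bot_iff, ← hcore]
    exact Subgroup.normal_le_normalCore.2 h2
  rw [hC, sup_bot_eq] at h3
  exact h3
end

section
/- Let X = G⟨c⟩ be a group with G = ⟨a,b⟩ ≅ Z_4 × Z_2 (a of order 4, b of order 2), ⟨c⟩ cyclic with G ∩ ⟨c⟩ = 1, ⟨c⟩ core-free in X, and G not normal in X. Then |⟨c⟩| ∈ {2, 4}, and X is isomorphic to one of exactly five groups, each of order 16 or 32, given by explicit presentations (e.g., ⟨a,b,c | a⁴=b²=c²=1, a^b=a, a^c=a, b^c=a²b⟩, ⟨a,b,c | a⁴=b²=c²=1, a^b=a, a^c=a³, b^c=b⟩, ⟨a,b,c | a⁴=b²=c²=1, a^b=a, a^c=ab, b^c=b⟩, ⟨a,b,c | a⁴=b²=c⁴=1, a^b=a, a^c=a, b^c=a³bc²⟩, ⟨a,b,c | a⁴=b²=c⁴=1, a^b=a, a^c=abc²,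 b^c=a²⟩). -/
open Pointwise Subgroup

namespace Q17

/-! ### The finite search: skew morphisms of `Z_4 × Z_2`, encoded as packed natural numbers -/

/-- Application that forces the kernel to evaluate the argument first. -/
def frc {α : Type} (f : ℕ → α) (x : ℕ) : α := Nat.rec (f 0) (fun n _ => f n) (Nat.succ x)

theorem frc_eq {α : Type} (f : ℕ → α) (x : ℕ) : frc f x = f x := rfl

/-- The `n`-th octal digit. -/
def lk (S n : ℕ) : ℕ := (S >>> (3 * n)) % 8

/-- Addition of `Z_4 × Z_2`, where `(i, j)` is coded as `i + 4 j`. -/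
def ad (n m : ℕ) : ℕ := (n % 4 + m % 4) % 4 + 4 * ((n / 4 + m / 4) % 2)

/-- Negation of `Z_4 × Z_2`. -/
def ng (n : ℕ) : ℕ := (4 - n % 4) % 4 + 4 * (n / 4)

def uu (S n x : ℕ) : ℕ :=
  frc (fun p => frc (fun q => ad p q) (lk S (frc (fun y => ad n y) x))) (frc ng (lk S n))

theorem uu_eq (S n x : ℕ) : uu S n x = ad (ng (lk S n)) (lk S (ad n x)) := rfl

def ball (p : ℕ → Bool) : Bool :=
  p 0 && (p 1 && (p 2 && (p 3 && (p 4 && (p 5 && (p 6 && p 7))))))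

def cmt (S : ℕ) : Bool :=
  ball fun n => ball fun x => Nat.beq (uu S n (lk S x)) (lk S (uu S n x))

def iter (S : ℕ) : ℕ → ℕ → ℕ
  | 0, x => x
  | k+1, x => lk S (iter S k x)

def per (S : ℕ) : Bool := ball fun x => Nat.beq (iter S 12 x) x

def bex (p : ℕ → Bool) : ℕ → Bool
  | 0 => false
  | k+1 => p k || bex p k

def pwr (S : ℕ) : Bool :=
  ball fun n => bex (fun k => ball fun x => Nat.beq (uu S n x) (iter S k x)) 12

def nrm (S : ℕ) : Bool := ball fun n => ball fun x => Nat.beq (uu S n x) (lk S x)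

/-- Pack a reversed list of digits. -/
def pack : List ℕ → ℕ → ℕ
  | [], acc => acc
  | x :: l, acc => pack l (x + 8 * acc)

def good : List ℕ :=
  [[4, 7, 6, 5, 3, 2, 1, 0], [6, 5, 4, 7, 3, 2, 1, 0], [5, 6, 1, 2, 7, 4, 3, 0],
   [1, 2, 7, 4, 5, 6, 3, 0], [7, 1, 5, 3, 6, 2, 4, 0], [3, 6, 7, 2, 1, 4, 5, 0],
   [7, 3, 5, 1, 4, 2, 6, 0], [5, 2, 3, 4, 1, 6, 7, 0]].map fun l => pack l 0

def full (S : ℕ) : Bool :=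
  !cmt S || (per S && (!pwr S || (nrm S || good.any (fun t => Nat.beq S t))))

/-- Backtracking over the digits. -/
def srch : ℕ → List ℕ → Bool
  | 0, l => frc full (pack l 0)
  | k+1, l => ball fun d => l.any (fun t => Nat.beq d t) || srch k (d :: l)

set_option maxRecDepth 10000 in
theorem srch_ok : srch 7 [0] = true := by decide +kernel

theorem ball_iff (p : ℕ → Bool) : ball p = true ↔ ∀ n : Fin 8, p n = true := by
  simp [ball, Fin.forall_fin_succ]

theorem bex_iff (p : ℕ → Bool) (k : ℕ) : bex p k = true ↔ ∃ j < k, p j = true := by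
  induction k with
  | zero => simp [bex]
  | succ k ih =>
    simp only [bex, Bool.or_eq_true, ih, Nat.lt_succ_iff_lt_or_eq]
    constructor
    · rintro (h | ⟨j, hj, h⟩)
      · exact ⟨k, Or.inr rfl, h⟩
      · exact ⟨j, Or.inl hj, h⟩
    · rintro ⟨j, hj | rfl, h⟩
      · exact Or.inr ⟨j, hj, h⟩
      · exact Or.inl h

theorem srch_step {k : ℕ} {l : List ℕ} (h : srch (k + 1) l = true) (d : Fin 8)
    (hd : ∀ t ∈ l, (d : ℕ) ≠ t) : srch k ((d : ℕ) :: l) = true := by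
  have h1 := (ball_iff _).1 h d
  rw [Bool.or_eq_true] at h1
  rcases h1 with h1 | h1
  · rw [List.any_eq_true] at h1
    obtain ⟨t, ht, h2⟩ := h1
    exact absurd (Nat.eq_of_beq_eq_true h2) (hd t ht)
  · exact h1

def adF (n m : Fin 8) : Fin 8 := ⟨ad n m, by unfold ad; omega⟩

def ngF (n : Fin 8) : Fin 8 := ⟨ng n, by unfold ng; omega⟩

theorem adF_ng (n m : Fin 8) : adF (ngF n) (adF n m) = m := by revert n m; decide

theorem adF_ng2 (n m : Fin 8) : adF n (adF (ngF n) m) = m := by revert n m; decide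

theorem lk_pack (d0 d1 d2 d3 d4 d5 d6 d7 : ℕ) (h0 : d0 < 8) (h1 : d1 < 8) (h2 : d2 < 8)
    (h3 : d3 < 8) (h4 : d4 < 8) (h5 : d5 < 8) (h6 : d6 < 8) (h7 : d7 < 8) :
    lk (pack [d7, d6, d5, d4, d3, d2, d1, d0] 0) 0 = d0 ∧
    lk (pack [d7, d6, d5, d4, d3, d2, d1, d0] 0) 1 = d1 ∧
    lk (pack [d7, d6, d5, d4, d3, d2, d1, d0] 0) 2 = d2 ∧
    lk (pack [d7, d6, d5, d4, d3, d2, d1, d0] 0) 3 = d3 ∧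
    lk (pack [d7, d6, d5, d4, d3, d2, d1, d0] 0) 4 = d4 ∧
    lk (pack [d7, d6, d5, d4, d3, d2, d1, d0] 0) 5 = d5 ∧
    lk (pack [d7, d6, d5, d4, d3, d2, d1, d0] 0) 6 = d6 ∧
    lk (pack [d7, d6, d5, d4, d3, d2, d1, d0] 0) 7 = d7 := by
  simp only [pack, lk, Nat.shiftRight_eq_div_pow]
  refine ⟨?_, ?_, ?_, ?_, ?_, ?_, ?_, ?_⟩ <;> norm_num <;> omega

theorem search (σ : Equiv.Perm (Fin 8)) (h0 : σ 0 = 0)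
    (H : ∀ n, ∃ k : ℕ, ∀ x, σ (adF n x) = adF (σ n) ((σ ^ k) x)) :
    (∀ n x, σ (adF n x) = adF (σ n) (σ x)) ∨
      ∃ t ∈ good, ∀ n : Fin 8, ((σ n : Fin 8) : ℕ) = lk t n := by
  have hne : ∀ i j : Fin 8, i ≠ j → ((σ i : Fin 8) : ℕ) ≠ ((σ j : Fin 8) : ℕ) := fun i j hij h =>
    hij (σ.injective (Fin.ext h))
  have hz : ((σ 0 : Fin 8) : ℕ) = 0 := by rw [h0]; rfl
  have s1 : srch 7 [((σ 0 : Fin 8) : ℕ)] = true := by rw [hz]; exact srch_ok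
  have s2 := srch_step s1 (σ 1) (by simp [hne])
  have s3 := srch_step s2 (σ 2) (by simp [hne])
  have s4 := srch_step s3 (σ 3) (by simp [hne])
  have s5 := srch_step s4 (σ 4) (by simp [hne])
  have s6 := srch_step s5 (σ 5) (by simp [hne])
  have s7 := srch_step s6 (σ 6) (by simp [hne])
  have s8 := srch_step s7 (σ 7) (by simp [hne])
  obtain ⟨S, hS⟩ : ∃ S, S = pack [((σ 7 : Fin 8) : ℕ), ((σ 6 : Fin 8) : ℕ), ((σ 5 : Fin 8) : ℕ),
    ((σ 4 : Fin 8) : ℕ), ((σ 3 : Fin 8) : ℕ), ((σ 2 : Fin 8) : ℕ), ((σ 1 : Fin 8) : ℕ),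
    ((σ 0 : Fin 8) : ℕ)] 0 := ⟨_, rfl⟩
  have hf : full S = true := by rw [hS]; exact s8
  have hlk : ∀ n : Fin 8, lk S n = ((σ n : Fin 8) : ℕ) := by
    have b0 := (σ 0).isLt
    have b1 := (σ 1).isLt
    have b2 := (σ 2).isLt
    have b3 := (σ 3).isLt
    have b4 := (σ 4).isLt
    have b5 := (σ 5).isLt
    have b6 := (σ 6).isLt
    have b7 := (σ 7).isLt
    obtain ⟨c0, c1, c2, c3, c4, c5, c6, c7⟩ := lk_pack _ _ _ _ _ _ _ _ b0 b1 b2 b3 b4 b5 b6 b7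
    rw [← hS] at c0 c1 c2 c3 c4 c5 c6 c7
    intro n
    fin_cases n
    · exact c0
    · exact c1
    · exact c2
    · exact c3
    · exact c4
    · exact c5
    · exact c6
    · exact c7
  clear s1 s2 s3 s4 s5 s6 s7 s8 hS
  have huu : ∀ n x : Fin 8, uu S n x = (adF (ngF (σ n)) (σ (adF n x)) : Fin 8) := by
    intro n x
    rw [uu_eq, hlk n]
    have := hlk (adF n x)
    simp only [adF] at this
    rw [this]
    rfl
  have hit : ∀ (k : ℕ) (x : Fin 8), iter S k x = ((σ ^ k) x : Fin 8) := by
    intro k x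
    induction k with
    | zero => rfl
    | succ k ih => rw [iter, ih, hlk, pow_succ']; rfl
  have hH : ∀ n, ∃ k : ℕ, ∀ x, adF (ngF (σ n)) (σ (adF n x)) = (σ ^ k) x := by
    intro n
    obtain ⟨k, hk⟩ := H n
    exact ⟨k, fun x => by rw [hk, adF_ng]⟩
  have hc : cmt S = true := by
    refine (ball_iff _).2 fun n => (ball_iff _).2 fun x => ?_
    obtain ⟨k, hk⟩ := hH n
    have e : uu S n (lk S x) = lk S (uu S n x) := by
      rw [hlk, huu, huu, hk, hk, hlk]
      congr 1
      rw [← Equiv.Perm.mul_apply, ← Equiv.Perm.mul_apply, ← pow_succ, ← pow_succ']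
    rw [e]
    exact Nat.beq_refl _
  simp only [full, hc, Bool.not_true, Bool.false_or, Bool.and_eq_true, Bool.or_eq_true] at hf
  obtain ⟨hp, hf⟩ := hf
  have hσ12 : σ ^ 12 = 1 := by
    ext x
    have := Nat.eq_of_beq_eq_true ((ball_iff _).1 hp x)
    rw [hit] at this
    simpa using this
  have hpw : pwr S = true := by
    refine (ball_iff _).2 fun n => (bex_iff _ _).2 ?_
    obtain ⟨k, hk⟩ := hH n
    refine ⟨k % 12, Nat.mod_lt _ (by norm_num), (ball_iff _).2 fun x => ?_⟩
    have e : uu S n x = iter S (k % 12) x := by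
      rw [huu, hk, hit, ← pow_eq_pow_mod _ hσ12]
    rw [e]
    exact Nat.beq_refl _
  rw [hpw] at hf
  simp only [Bool.not_true, Bool.false_eq_true, false_or] at hf
  rcases hf with hf | hf
  · left
    intro n x
    have := Nat.eq_of_beq_eq_true ((ball_iff _).1 ((ball_iff _).1 hf n) x)
    rw [huu, hlk] at this
    rw [← Fin.ext this, adF_ng2]
  · right
    obtain ⟨t, ht, h⟩ := List.any_eq_true.1 hf
    refine ⟨t, ht, fun n => ?_⟩
    rw [← hlk, Nat.eq_of_beq_eq_true h]

/-! ### The regular representation -/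

def PA : Equiv.Perm (Fin 8) := ⟨adF 1, adF 3, by decide, by decide⟩
def PB : Equiv.Perm (Fin 8) := ⟨adF 4, adF 4, by decide, by decide⟩

def w {M : Type*} [Group M] (e : ℕ × ℕ × ℕ) (x y z : M) : M := x ^ e.1 * y ^ e.2.1 * z ^ e.2.2

theorem map_w {M N : Type*} [Group M] [Group N] (f : M →* N) (e : ℕ × ℕ × ℕ) (x y z : M) :
    f (w e x y z) = w e (f x) (f y) (f z) := by simp [w]

def rel (i : Bool) {M : Type*} [Group M] (x y z : M) : Prop :=
  if i then z⁻¹ * x * z = x ∧ z⁻¹ * y * z = x ^ 3 * y * z ^ 2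
  else z⁻¹ * x * z = x * y * z ^ 2 ∧ z⁻¹ * y * z = x ^ 2

instance (i : Bool) {M : Type*} [Group M] [DecidableEq M] (x y z : M) : Decidable (rel i x y z) := by
  unfold rel; infer_instance

def basic {M : Type*} [Group M] (x y z : M) : Prop :=
  x ^ 4 = 1 ∧ x ^ 2 ≠ 1 ∧ y ^ 2 = 1 ∧ y ≠ 1 ∧ z ^ 4 = 1 ∧ z ^ 2 ≠ 1 ∧ y⁻¹ * x * y = x

instance {M : Type*} [Group M] [DecidableEq M] (x y z : M) : Decidable (basic x y z) := by
  unfold basic; infer_instance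

def goal (X : Type*) [Group X] (c : X) : Prop :=
  (orderOf c = 2 ∨ orderOf c = 4) ∧
    ∃ a₁ b₁ c₁ : X, closure ({a₁, b₁, c₁} : Set X) = ⊤ ∧
      orderOf a₁ = 4 ∧ orderOf b₁ = 2 ∧ b₁⁻¹ * a₁ * b₁ = a₁ ∧
      ((Nat.card X = 16 ∧ orderOf c₁ = 2 ∧
          c₁⁻¹ * a₁ * c₁ = a₁ ∧ c₁⁻¹ * b₁ * c₁ = a₁ ^ 2 * b₁) ∨
       (Nat.card X = 16 ∧ orderOf c₁ = 2 ∧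
          c₁⁻¹ * a₁ * c₁ = a₁ ^ 3 ∧ c₁⁻¹ * b₁ * c₁ = b₁) ∨
       (Nat.card X = 16 ∧ orderOf c₁ = 2 ∧
          c₁⁻¹ * a₁ * c₁ = a₁ * b₁ ∧ c₁⁻¹ * b₁ * c₁ = b₁) ∨
       (Nat.card X = 32 ∧ orderOf c₁ = 4 ∧
          c₁⁻¹ * a₁ * c₁ = a₁ ∧ c₁⁻¹ * b₁ * c₁ = a₁ ^ 3 * b₁ * c₁ ^ 2) ∨
       (Nat.card X = 32 ∧ orderOf c₁ = 4 ∧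
          c₁⁻¹ * a₁ * c₁ = a₁ * b₁ * c₁ ^ 2 ∧ c₁⁻¹ * b₁ * c₁ = a₁ ^ 2))

theorem order_four {M : Type*} [Group M] {x : M} (h1 : x ^ 4 = 1) (h2 : x ^ 2 ≠ 1) :
    orderOf x = 4 := by
  have := orderOf_eq_prime_pow (p := 2) (n := 1) (x := x) (by simpa using h2) (by simpa using h1)
  simpa using this

theorem basic_of_map {M N : Type*} [Group M] [Group N] (f : M →* N) (hf : Function.Injective f)
    {x y z : M} (h : basic (f x) (f y) (f z)) : basic x y z := by
  obtain ⟨h1, h2, h3, h4, h5, h6, h7⟩ := h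
  refine ⟨hf ?_, fun e => h2 ?_, hf ?_, fun e => h4 ?_, hf ?_, fun e => h6 ?_, hf ?_⟩
  · simpa using h1
  · rw [← map_pow, e, map_one]
  · simpa using h3
  · rw [e, map_one]
  · simpa using h5
  · rw [← map_pow, e, map_one]
  · simpa using h7

theorem rel_of_map {M N : Type*} [Group M] [Group N] (f : M →* N) (hf : Function.Injective f)
    (i : Bool) {x y z : M} (h : rel i (f x) (f y) (f z)) : rel i x y z := by
  cases i
  · simp only [rel, Bool.false_eq_true, if_false] at h ⊢
    exact ⟨hf (by simpa using h.1), hf (by simpa using h.2)⟩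
  · simp only [rel, if_true] at h ⊢
    exact ⟨hf (by simpa using h.1), hf (by simpa using h.2)⟩

theorem w_mem {M : Type*} [Group M] (H : Subgroup M) (e : ℕ × ℕ × ℕ) {x y z : M} (hx : x ∈ H)
    (hy : y ∈ H) (hz : z ∈ H) : w e x y z ∈ H :=
  H.mul_mem (H.mul_mem (H.pow_mem hx _) (H.pow_mem hy _)) (H.pow_mem hz _)

theorem finish {X : Type*} [Group X] (ρ : X →* Equiv.Perm (Fin 8)) (hρ : Function.Injective ρ)
    (a b c : X) (hcl : closure ({a, b, c} : Set X) = ⊤) (hcard : Nat.card X = 8 * orderOf c)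
    (hA : ρ a = PA) (hB : ρ b = PB) (i : Bool) (C : Equiv.Perm (Fin 8)) (hC : ρ c = C)
    (e1 e2 e3 e4 e5 e6 : ℕ × ℕ × ℕ)
    (h : basic PA PB C ∧
      basic (w e1 PA PB C) (w e2 PA PB C) (w e3 PA PB C) ∧
      rel i (w e1 PA PB C) (w e2 PA PB C) (w e3 PA PB C) ∧
      w e4 (w e1 PA PB C) (w e2 PA PB C) (w e3 PA PB C) = PA ∧
      w e5 (w e1 PA PB C) (w e2 PA PB C) (w e3 PA PB C) = PB ∧
      w e6 (w e1 PA PB C) (w e2 PA PB C) (w e3 PA PB C) = C) : goal X c := by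
  subst hC
  rw [← hA, ← hB] at h
  simp only [← map_w] at h
  obtain ⟨h1, h2, h3, h4, h5, h6⟩ := h
  replace h1 := basic_of_map ρ hρ h1
  replace h2 := basic_of_map ρ hρ h2
  replace h3 := rel_of_map ρ hρ i h3
  replace h4 := hρ h4
  replace h5 := hρ h5
  replace h6 := hρ h6
  obtain ⟨x, hx⟩ : ∃ x, x = w e1 a b c := ⟨_, rfl⟩
  obtain ⟨y, hy⟩ : ∃ y, y = w e2 a b c := ⟨_, rfl⟩
  obtain ⟨z, hz⟩ : ∃ z, z = w e3 a b c := ⟨_, rfl⟩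
  rw [← hx, ← hy, ← hz] at h2 h3 h4 h5 h6
  have hc4 : orderOf c = 4 := order_four h1.2.2.2.2.1 h1.2.2.2.2.2.1
  have h32 : Nat.card X = 32 := by rw [hcard, hc4]
  obtain ⟨g1, g2, g3, g4, g5, g6, g7⟩ := h2
  refine ⟨Or.inr hc4, x, y, z, ?_, order_four g1 g2, orderOf_eq_prime g3 g4, g7, ?_⟩
  · rw [eq_top_iff, ← hcl, closure_le]
    have hxm : x ∈ closure ({x, y, z} : Set X) := subset_closure (by simp)
    have hym : y ∈ closure ({x, y, z} : Set X) := subset_closure (by simp)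
    have hzm : z ∈ closure ({x, y, z} : Set X) := subset_closure (by simp)
    rintro u (rfl | rfl | rfl)
    · rw [← h4]; exact w_mem _ _ hxm hym hzm
    · rw [← h5]; exact w_mem _ _ hxm hym hzm
    · rw [← h6]; exact w_mem _ _ hxm hym hzm
  · cases i
    · simp only [rel, Bool.false_eq_true, if_false] at h3
      exact Or.inr (Or.inr (Or.inr (Or.inr ⟨h32, order_four g5 g6, h3.1, h3.2⟩)))
    · simp only [rel, if_true] at h3
      exact Or.inr (Or.inr (Or.inr (Or.inl ⟨h32, order_four g5 g6, h3.1, h3.2⟩)))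

/-- The element of `G` with a given code. -/
def f {X : Type*} [Group X] (a b : X) (n : Fin 8) : X := a ^ ((n : ℕ) % 4) * b ^ ((n : ℕ) / 4)

theorem f_mul {X : Type*} [Group X] {a b : X} (ha : a ^ 4 = 1) (hb : b ^ 2 = 1)
    (hab : Commute a b) (n m : Fin 8) : f a b n * f a b m = f a b (adF n m) := by
  have e1 : ((adF n m : Fin 8) : ℕ) % 4 = ((n : ℕ) % 4 + (m : ℕ) % 4) % 4 := by
    simp only [adF, ad]; omega
  have e2 : ((adF n m : Fin 8) : ℕ) / 4 = ((n : ℕ) / 4 + (m : ℕ) / 4) % 2 := by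
    simp only [adF, ad]; omega
  unfold f
  rw [e1, e2, ← pow_eq_pow_mod (_ + _) ha, ← pow_eq_pow_mod (_ + _) hb, pow_add, pow_add]
  have := (hab.pow_pow ((m : ℕ) % 4) ((n : ℕ) / 4)).eq
  simp only [mul_assoc]
  rw [← mul_assoc (b ^ _) (a ^ _), ← this]
  simp only [mul_assoc]

theorem f_zero {X : Type*} [Group X] (a b : X) : f a b 0 = 1 := by simp [f]

end Q17

open Q17 in
theorem stmt17 {X : Type*} [Group X] [Finite X] (a b c : X)
    (ha : orderOf a = 4) (hb : orderOf b = 2)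
    (hab : b⁻¹ * a * b = a)
    (hG : Nat.card (closure ({a, b} : Set X)) = 8)
    (hprod : (closure ({a, b} : Set X) : Set X) * (zpowers c : Set X) = Set.univ)
    (hint : closure ({a, b} : Set X) ⊓ zpowers c = ⊥)
    (hcore : (zpowers c).normalCore = ⊥)
    (hnotnorm : ¬ (closure ({a, b} : Set X)).Normal) :
    (orderOf c = 2 ∨ orderOf c = 4) ∧
    ∃ a₁ b₁ c₁ : X, closure ({a₁, b₁, c₁} : Set X) = ⊤ ∧
      orderOf a₁ = 4 ∧ orderOf b₁ = 2 ∧ b₁⁻¹ * a₁ * b₁ = a₁ ∧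
      ((Nat.card X = 16 ∧ orderOf c₁ = 2 ∧
          c₁⁻¹ * a₁ * c₁ = a₁ ∧ c₁⁻¹ * b₁ * c₁ = a₁ ^ 2 * b₁) ∨
       (Nat.card X = 16 ∧ orderOf c₁ = 2 ∧
          c₁⁻¹ * a₁ * c₁ = a₁ ^ 3 ∧ c₁⁻¹ * b₁ * c₁ = b₁) ∨
       (Nat.card X = 16 ∧ orderOf c₁ = 2 ∧
          c₁⁻¹ * a₁ * c₁ = a₁ * b₁ ∧ c₁⁻¹ * b₁ * c₁ = b₁) ∨
       (Nat.card X = 32 ∧ orderOf c₁ = 4 ∧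
          c₁⁻¹ * a₁ * c₁ = a₁ ∧ c₁⁻¹ * b₁ * c₁ = a₁ ^ 3 * b₁ * c₁ ^ 2) ∨
       (Nat.card X = 32 ∧ orderOf c₁ = 4 ∧
          c₁⁻¹ * a₁ * c₁ = a₁ * b₁ * c₁ ^ 2 ∧ c₁⁻¹ * b₁ * c₁ = a₁ ^ 2)) := by
  have ha4 : a ^ 4 = 1 := by rw [← ha]; exact pow_orderOf_eq_one a
  have hb2 : b ^ 2 = 1 := by rw [← hb]; exact pow_orderOf_eq_one b
  have hcomm : Commute a b := by
    have : b * (b⁻¹ * a * b) = b * a := by rw [hab]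
    rw [← mul_assoc, mul_inv_cancel_left] at this
    exact this
  have hmul := f_mul ha4 hb2 hcomm
  have hf0 : f a b 0 = 1 := f_zero a b
  have hf1 : f a b 1 = a := by simp [f]
  have hf4 : f a b 4 = b := by
    simp [f]
  -- `G` is the range of `f`
  have hinv : ∀ n, (f a b n)⁻¹ = f a b (ngF n) := by
    intro n
    rw [inv_eq_iff_mul_eq_one, hmul, ← hf0]
    congr 1
    revert n; decide
  let K : Subgroup X :=
    { carrier := Set.range (f a b)
      mul_mem' := by rintro _ _ ⟨n, rfl⟩ ⟨m, rfl⟩; exact ⟨adF n m, (hmul n m).symm⟩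
      one_mem' := ⟨0, hf0⟩
      inv_mem' := by rintro _ ⟨n, rfl⟩; exact ⟨ngF n, (hinv n).symm⟩ }
  have hfG : ∀ n, f a b n ∈ closure ({a, b} : Set X) := fun n =>
    mul_mem (pow_mem (subset_closure (by simp)) _) (pow_mem (subset_closure (by simp)) _)
  have hGK : ∀ g ∈ closure ({a, b} : Set X), ∃ n, f a b n = g := by
    have : closure ({a, b} : Set X) ≤ K := by
      rw [closure_le]
      rintro u (rfl | rfl)
      · exact ⟨1, hf1⟩
      · exact ⟨4, hf4⟩
    exact fun g hg => this hg
  have hfinj : Function.Injective (f a b) := by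
    let F : Fin 8 → closure ({a, b} : Set X) := fun n => ⟨f a b n, hfG n⟩
    have hs : Function.Surjective F := fun ⟨g, hg⟩ => by
      obtain ⟨n, hn⟩ := hGK g hg
      exact ⟨n, Subtype.ext hn⟩
    have hb : Function.Bijective F :=
      (Nat.bijective_iff_surjective_and_card F).2 ⟨hs, by rw [hG]; simp⟩
    exact fun n m h => hb.1 (Subtype.ext h)
  have hdec : ∀ x : X, ∃ n : Fin 8, ∃ k : ℕ, x = f a b n * c ^ k := by
    intro x
    have hx : x ∈ (closure ({a, b} : Set X) : Set X) * (zpowers c : Set X) := by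
      rw [hprod]; trivial
    obtain ⟨g, hg, y, hy, rfl⟩ := hx
    obtain ⟨n, rfl⟩ := hGK g hg
    obtain ⟨k, rfl⟩ := mem_powers_iff_mem_zpowers.2 hy
    exact ⟨n, k, rfl⟩
  -- the coset space
  let E : Fin 8 → X ⧸ zpowers c := fun n => QuotientGroup.mk (f a b n)
  have hEb : Function.Bijective E := by
    constructor
    · intro n m h
      have h1 : (f a b n)⁻¹ * f a b m ∈ zpowers c := QuotientGroup.eq.1 h
      have h2 : (f a b n)⁻¹ * f a b m ∈ closure ({a, b} : Set X) ⊓ zpowers c :=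
        Subgroup.mem_inf.2 ⟨mul_mem (inv_mem (hfG n)) (hfG m), h1⟩
      rw [hint, mem_bot, inv_mul_eq_one] at h2
      exact hfinj h2
    · intro q
      obtain ⟨x, rfl⟩ := QuotientGroup.mk_surjective q
      obtain ⟨n, k, rfl⟩ := hdec x
      refine ⟨n, QuotientGroup.eq.2 ?_⟩
      rw [inv_mul_cancel_left]
      exact npow_mem_zpowers c k
  let e : Fin 8 ≃ X ⧸ zpowers c := Equiv.ofBijective E hEb
  have hcard : Nat.card X = 8 * orderOf c := by
    rw [Subgroup.card_eq_card_quotient_mul_card_subgroup (zpowers c), Nat.card_zpowers,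
      ← Nat.card_congr e, Nat.card_fin]
  let ρ : X →* Equiv.Perm (Fin 8) :=
    (e.symm.permCongrHom.toMonoidHom).comp (MulAction.toPermHom X (X ⧸ zpowers c))
  have hρdef : ∀ x n m, ρ x n = m ↔ (QuotientGroup.mk (x * f a b n) : X ⧸ zpowers c) = QuotientGroup.mk (f a b m) := by
    intro x n m
    have : ρ x n = e.symm (x • e n) := rfl
    rw [this, Equiv.symm_apply_eq]
    rfl
  have hρ : Function.Injective ρ := by
    have h1 : Function.Injective (MulAction.toPermHom X (X ⧸ zpowers c)) := by
      rw [← MonoidHom.ker_eq_bot_iff, ← Subgroup.normalCore_eq_ker, hcore]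
    exact (e.symm.permCongrHom.injective).comp h1
  have hρf : ∀ n m, ρ (f a b n) m = adF n m := by
    intro n m
    rw [hρdef, hmul]
  have hA : ρ a = PA := by
    ext m
    rw [← hf1, hρf]; rfl
  have hB : ρ b = PB := by
    ext m
    rw [← hf4, hρf]; rfl
  have hc0 : ρ c 0 = 0 := by
    rw [hρdef, hf0, mul_one]
    refine QuotientGroup.eq.2 ?_
    rw [mul_one]
    exact inv_mem (mem_zpowers c)
  have hck0 : ∀ k : ℕ, ((ρ c) ^ k) 0 = 0 := by
    intro k
    induction k with
    | zero => rfl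
    | succ k ih => rw [pow_succ, Equiv.Perm.mul_apply, hc0, ih]
  have hadF0 : ∀ n, adF n 0 = n := by decide
  have hH : ∀ n, ∃ k : ℕ, ∀ x, ρ c (adF n x) = adF (ρ c n) ((ρ c ^ k) x) := by
    intro n
    obtain ⟨m, k, hk⟩ := hdec (c * f a b n)
    have h1 : ∀ x, ρ c (adF n x) = adF m ((ρ c ^ k) x) := by
      intro x
      have := congrArg (fun y => ρ y x) hk
      simpa only [map_mul, map_pow, Equiv.Perm.mul_apply, hρf] using this
    have h2 : ρ c n = m := by
      have := h1 0
      rwa [hadF0, hck0, hadF0] at this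
    exact ⟨k, fun x => by rw [h1, h2]⟩
  have hcl : closure ({a, b, c} : Set X) = ⊤ := by
    rw [eq_top_iff]
    intro x _
    obtain ⟨n, k, rfl⟩ := hdec x
    exact mul_mem (mul_mem (pow_mem (subset_closure (by simp)) _)
      (pow_mem (subset_closure (by simp)) _)) (pow_mem (subset_closure (by simp)) _)
  rcases search (ρ c) hc0 hH with hn | ⟨t, ht, hn⟩
  · exfalso
    apply hnotnorm
    have hcc : ∀ n, c * f a b n = f a b (ρ c n) * c := by
      intro n
      apply hρ
      ext x
      simp only [map_mul, Equiv.Perm.mul_apply, hρf, hn]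
    have hck : ∀ (k : ℕ) (g : X), g ∈ closure ({a, b} : Set X) →
        c ^ k * g * (c ^ k)⁻¹ ∈ closure ({a, b} : Set X) := by
      intro k
      induction k with
      | zero => intro g hg; simpa using hg
      | succ k ih =>
        intro g hg
        obtain ⟨n, rfl⟩ := hGK g hg
        have : c ^ (k + 1) * f a b n * (c ^ (k + 1))⁻¹
            = c ^ k * f a b (ρ c n) * (c ^ k)⁻¹ := by
          rw [pow_succ, mul_assoc (c ^ k) c, hcc]
          group
        rw [this]
        exact ih _ (hfG _)
    refine ⟨fun g hg x => ?_⟩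
    obtain ⟨n, k, rfl⟩ := hdec x
    have : f a b n * c ^ k * g * (f a b n * c ^ k)⁻¹
        = f a b n * (c ^ k * g * (c ^ k)⁻¹) * (f a b n)⁻¹ := by group
    rw [this]
    exact mul_mem (mul_mem (hfG n) (hck k g hg)) (inv_mem (hfG n))
  · have key := finish ρ hρ a b c hcl hcard hA hB
    have hC : ∀ C : Equiv.Perm (Fin 8), (∀ n : Fin 8, ((C n : Fin 8) : ℕ) = lk t n) → ρ c = C := by
      intro C h
      ext n
      rw [hn, h]
    change goal X c
    simp only [good, List.map_cons, List.map_nil, List.mem_cons, List.not_mem_nil, or_false] at ht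
    rcases ht with rfl | rfl | rfl | rfl | rfl | rfl | rfl | rfl
    · exact key true ⟨![0, 1, 2, 3, 5, 6, 7, 4], ![0, 1, 2, 3, 7, 4, 5, 6], by decide, by decide⟩
        (hC _ (by decide +kernel)) (1, 0, 0) (0, 1, 0) (0, 0, 1) (1, 0, 0) (0, 1, 0) (0, 0, 1) (by decide +kernel)
    · exact key true ⟨![0, 1, 2, 3, 7, 4, 5, 6], ![0, 1, 2, 3, 5, 6, 7, 4], by decide, by decide⟩
        (hC _ (by decide +kernel)) (1, 0, 0) (0, 1, 0) (0, 0, 3) (1, 0, 0) (0, 1, 0) (0, 0, 3) (by decide +kernel)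
    · exact key false ⟨![0, 3, 4, 7, 2, 1, 6, 5], ![0, 5, 4, 1, 2, 7, 6, 3], by decide, by decide⟩
        (hC _ (by decide +kernel)) (0, 0, 1) (2, 1, 2) (1, 0, 0) (0, 0, 1) (2, 1, 2) (1, 0, 0) (by decide +kernel)
    · exact key false ⟨![0, 3, 6, 5, 4, 7, 2, 1], ![0, 7, 6, 1, 4, 3, 2, 5], by decide, by decide⟩
        (hC _ (by decide +kernel)) (0, 0, 1) (0, 1, 2) (1, 0, 0) (0, 0, 1) (2, 1, 0) (1, 0, 0) (by decide +kernel)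
    · exact key true ⟨![0, 4, 2, 6, 3, 5, 1, 7], ![0, 6, 2, 4, 1, 5, 3, 7], by decide, by decide⟩
        (hC _ (by decide +kernel)) (1, 1, 0) (0, 1, 0) (0, 0, 3) (1, 1, 0) (0, 1, 0) (0, 0, 3) (by decide +kernel)
    · exact key false ⟨![0, 5, 4, 1, 2, 7, 6, 3], ![0, 3, 4, 7, 2, 1, 6, 5], by decide, by decide⟩
        (hC _ (by decide +kernel)) (0, 0, 1) (2, 1, 2) (1, 0, 2) (0, 1, 1) (0, 0, 2) (1, 0, 0) (by decide +kernel)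
    · exact key true ⟨![0, 6, 2, 4, 1, 5, 3, 7], ![0, 4, 2, 6, 3, 5, 1, 7], by decide, by decide⟩
        (hC _ (by decide +kernel)) (1, 1, 0) (0, 1, 0) (0, 0, 1) (1, 1, 0) (0, 1, 0) (0, 0, 1) (by decide +kernel)
    · exact key false ⟨![0, 7, 6, 1, 4, 3, 2, 5], ![0, 3, 6, 5, 4, 7, 2, 1], by decide, by decide⟩
        (hC _ (by decide +kernel)) (0, 0, 1) (0, 1, 2) (1, 0, 2) (0, 1, 1) (2, 1, 0) (1, 0, 0) (by decide +kernel)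
end
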